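/- Let G be a finite group acting freely by diffeomorphisms on the sphere S³, let N = S³/G be the orbit space, let y₀ ∈ N, let c : S⁴ → N be the constant map with value y₀, and let f : S⁴ → N be continuous. Then: (i) if f is nullhomotopic, the pair (f,c) is loose; (ii) if f is not nullhomotopic and #G ≤ 2, then the minimum over all continuous f' homotopic to f and g homotopic to c of the cardinality of {x ∈ S⁴ : f'(x) = g(x)} equals #G; (iii) if f is not nullhomotopic and #G ≥ 3, then for every continuous f' homotopic to f and g homotopic to c the set {x ∈ S⁴ : f'(x) = g(x)} is infinite. -/

import Mathlib

open scoped Manifold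

/-- The unit sphere `Sᵏ ⊆ ℝ^{k+1}`. -/
abbrev Sph (k : ℕ) : Type :=
  Metric.sphere (0 : EuclideanSpace ℝ (Fin (k + 1))) 1

/-- A pair of maps is loose if it can be deformed to a coincidence free pair. -/
def Loose {X Y : Type} [TopologicalSpace X] [TopologicalSpace Y]
    (f₁ f₂ : C(X, Y)) : Prop :=
  ∃ f₁' f₂' : C(X, Y), f₁.Homotopic f₁' ∧ f₂.Homotopic f₂' ∧ ∀ x, f₁' x ≠ f₂' x

/-- A map is nullhomotopic if it is homotopic to a constant map. -/
def Nullhomotopic {X Y : Type} [TopologicalSpace X] [TopologicalSpace Y]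
    (f : C(X, Y)) : Prop :=
  ∃ y : Y, f.Homotopic (ContinuousMap.const X y)

set_option linter.all false

section 
open Set

/-- Homotopy on a set `Z` through maps into `T`. -/
def HomOn {X Y : Type*} [TopologicalSpace X] [TopologicalSpace Y] (Z : Set X) (T : Set Y)
    (f g : X → Y) : Prop :=
  ∃ H : ℝ × X → Y, ContinuousOn H (Icc 0 1 ×ˢ Z) ∧ (∀ t ∈ Icc (0:ℝ) 1, ∀ x ∈ Z, H (t, x) ∈ T) ∧
    (∀ x ∈ Z, H (0, x) = f x) ∧ (∀ x ∈ Z, H (1, x) = g x)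

namespace HomOn
variable {X Y X' Y' : Type*} [TopologicalSpace X] [TopologicalSpace Y] [TopologicalSpace X']
  [TopologicalSpace Y'] {Z : Set X} {T : Set Y} {f g h : X → Y}

theorem refl (hf : ContinuousOn f Z) (hT : ∀ x ∈ Z, f x ∈ T) : HomOn Z T f f :=
  ⟨fun p => f p.2, hf.comp continuousOn_snd (fun p hp => hp.2), fun t _ x hx => hT x hx,
    fun _ _ => rfl, fun _ _ => rfl⟩

theorem of_eqOn (hf : ContinuousOn f Z) (hT : ∀ x ∈ Z, f x ∈ T) (h : ∀ x ∈ Z, f x = g x) :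
    HomOn Z T f g :=
  ⟨fun p => f p.2, hf.comp continuousOn_snd (fun p hp => hp.2), fun t _ x hx => hT x hx,
    fun _ _ => rfl, h⟩

theorem symm (h : HomOn Z T f g) : HomOn Z T g f := by
  obtain ⟨H, h1, h2, h3, h4⟩ := h
  refine ⟨fun p => H (1 - p.1, p.2), h1.comp (by fun_prop) ?_, ?_, ?_, ?_⟩
  · rintro ⟨t, x⟩ ⟨⟨ht0, ht1⟩, hx⟩
    refine ⟨⟨?_, ?_⟩, hx⟩ <;> simp at * <;> linarith
  · intro t ht x hx
    exact h2 _ ⟨by linarith [ht.2], by linarith [ht.1]⟩ x hx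
  · intro x hx; simpa using h4 x hx
  · intro x hx; simpa using h3 x hx

theorem trans (hh : HomOn Z T f g) (h' : HomOn Z T g h) : HomOn Z T f h := by
  obtain ⟨H, h1, h2, h3, h4⟩ := hh
  obtain ⟨H', h1', h2', h3', h4'⟩ := h'
  refine ⟨fun p => if p.1 ≤ 1/2 then H (2 * p.1, p.2) else H' (2 * p.1 - 1, p.2), ?_, ?_, ?_, ?_⟩
  · have hfr : ∀ p : ℝ × X, p ∈ frontier {p : ℝ × X | p.1 ≤ 1/2} → p.1 = 1/2 := by
      intro p hp
      exact frontier_le_subset_eq continuous_fst continuous_const hp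
    apply ContinuousOn.if
    · rintro p ⟨⟨hp1, hp2⟩, hp3⟩
      have := hfr p hp3
      rw [this]
      have e1 : (2 * (1/2) : ℝ) = 1 := by norm_num
      rw [e1, sub_self, h4 _ hp2, h3' _ hp2]
    · apply h1.comp (by fun_prop)
      rintro ⟨t, x⟩ ⟨⟨⟨ht0, ht1⟩, hx⟩, hp⟩
      have hp' : t ≤ 1/2 := closure_lt_subset_le' hp
      simp at *
      exact ⟨⟨ht0, by linarith⟩, hx⟩
    · apply h1'.comp (by fun_prop)
      rintro ⟨t, x⟩ ⟨⟨⟨ht0, ht1⟩, hx⟩, hp⟩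
      have hp' : 1/2 ≤ t := by
        simp only [not_le] at hp
        exact closure_lt_subset_le continuous_const continuous_fst hp
      simp at *
      exact ⟨⟨by linarith, by linarith⟩, hx⟩
  · intro t ht x hx
    dsimp only
    split_ifs with hh
    · exact h2 _ ⟨by linarith [ht.1], by linarith⟩ x hx
    · exact h2' _ ⟨by linarith, by linarith [ht.2]⟩ x hx
  · intro x hx; simpa using h3 x hx
  · intro x hx
    have : ¬ ((1:ℝ) ≤ 1/2) := by norm_num
    simp only [this, if_false]
    have e1 : (2 * 1 - 1 : ℝ) = 1 := by norm_num
    rw [e1, h4' x hx]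
where
  closure_lt_subset_le' {p : ℝ × X} (hp : p ∈ closure {p : ℝ × X | p.1 ≤ 1/2}) : p.1 ≤ 1/2 := by
    rwa [IsClosed.closure_eq (isClosed_le continuous_fst continuous_const)] at hp

theorem mono {Z' : Set X} (h : HomOn Z T f g) (hZ : Z' ⊆ Z) : HomOn Z' T f g := by
  obtain ⟨H, h1, h2, h3, h4⟩ := h
  exact ⟨H, h1.mono (prod_mono le_rfl hZ), fun t ht x hx => h2 t ht x (hZ hx),
    fun x hx => h3 x (hZ hx), fun x hx => h4 x (hZ hx)⟩

theorem congr {f' g' : X → Y} (h : HomOn Z T f g) (hf : ∀ x ∈ Z, f x = f' x)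
    (hg : ∀ x ∈ Z, g x = g' x) : HomOn Z T f' g' := by
  obtain ⟨H, h1, h2, h3, h4⟩ := h
  exact ⟨H, h1, h2, fun x hx => (h3 x hx).trans (hf x hx), fun x hx => (h4 x hx).trans (hg x hx)⟩

theorem comp_right {Z' : Set X'} {k : X' → X} (h : HomOn Z T f g) (hk : ContinuousOn k Z')
    (hm : ∀ x ∈ Z', k x ∈ Z) : HomOn Z' T (f ∘ k) (g ∘ k) := by
  obtain ⟨H, h1, h2, h3, h4⟩ := h
  refine ⟨fun p => H (p.1, k p.2), h1.comp ?_ ?_, fun t ht x hx => h2 t ht _ (hm x hx),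
    fun x hx => h3 _ (hm x hx), fun x hx => h4 _ (hm x hx)⟩
  · exact continuousOn_fst.prodMk (hk.comp continuousOn_snd fun p hp => hp.2)
  · rintro ⟨t, x⟩ ⟨ht, hx⟩; exact ⟨ht, hm x hx⟩

theorem comp_left {T' : Set Y'} {k : Y → Y'} (h : HomOn Z T f g) (hk : ContinuousOn k T)
    (hm : ∀ x ∈ T, k x ∈ T') : HomOn Z T' (k ∘ f) (k ∘ g) := by
  obtain ⟨H, h1, h2, h3, h4⟩ := h
  refine ⟨fun p => k (H p), hk.comp h1 ?_, fun t ht x hx => hm _ (h2 t ht _ hx),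
    fun x hx => by simp [h3 _ hx], fun x hx => by simp [h4 _ hx]⟩
  rintro ⟨t, x⟩ ⟨ht, hx⟩; exact h2 t ht x hx

theorem left_cont (h : HomOn Z T f g) : ContinuousOn f Z := by
  obtain ⟨H, h1, h2, h3, h4⟩ := h
  have : ContinuousOn (fun x => H (0, x)) Z :=
    h1.comp (by fun_prop) (fun x hx => ⟨by simp, hx⟩)
  exact this.congr (fun x hx => (h3 x hx).symm)

theorem left_mem (h : HomOn Z T f g) : ∀ x ∈ Z, f x ∈ T := by
  obtain ⟨H, h1, h2, h3, h4⟩ := h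
  intro x hx; rw [← h3 x hx]; exact h2 0 (by simp) x hx

theorem right_cont (h : HomOn Z T f g) : ContinuousOn g Z := h.symm.left_cont
theorem right_mem (h : HomOn Z T f g) : ∀ x ∈ Z, g x ∈ T := h.symm.left_mem

theorem linear {W : Type*} [AddCommGroup W] [TopologicalSpace W] [Module ℝ W]
    [ContinuousAdd W] [ContinuousSMul ℝ W]
    {T : Set W} {f g : X → W} (hf : ContinuousOn f Z) (hg : ContinuousOn g Z)
    (hT : ∀ t ∈ Icc (0:ℝ) 1, ∀ x ∈ Z, (1 - t) • f x + t • g x ∈ T) : HomOn Z T f g := by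
  refine ⟨fun p => (1 - p.1) • f p.2 + p.1 • g p.2, ?_, hT, by simp, by simp⟩
  have hf' : ContinuousOn (fun p : ℝ × X => f p.2) (Icc 0 1 ×ˢ Z) :=
    hf.comp continuousOn_snd (fun p hp => hp.2)
  have hg' : ContinuousOn (fun p : ℝ × X => g p.2) (Icc 0 1 ×ˢ Z) :=
    hg.comp continuousOn_snd (fun p hp => hp.2)
  fun_prop

/-- Close maps are homotopic through nonvanishing maps. -/
theorem of_close {W : Type*} [NormedAddCommGroup W] [NormedSpace ℝ W]
    {f g : X → W} (hf : ContinuousOn f Z) (hg : ContinuousOn g Z)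
    (h : ∀ x ∈ Z, ‖g x - f x‖ < ‖f x‖) : HomOn Z {0}ᶜ f g := by
  refine linear hf hg fun t ht x hx => ?_
  intro h0
  have h1 : f x = - (t • (g x - f x)) := by
    have h0' : (1 - t) • f x + t • g x = 0 := h0
    have : f x + t • (g x - f x) = 0 := by rw [← h0']; module
    exact eq_neg_of_add_eq_zero_left this
  have h2 : ‖f x‖ ≤ ‖g x - f x‖ := by
    conv_lhs => rw [h1]
    rw [norm_neg, norm_smul, Real.norm_of_nonneg ht.1]
    exact mul_le_of_le_one_left (norm_nonneg _) ht.2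
  linarith [h x hx]

end HomOn

end

section 
open Set

theorem tietze_fd {X W : Type*} [TopologicalSpace X] [NormalSpace X] [NormedAddCommGroup W]
    [NormedSpace ℝ W] [FiniteDimensional ℝ W] {s : Set X} (hs : IsClosed s) {f : X → W}
    (hf : ContinuousOn f s) : ∃ g : X → W, Continuous g ∧ ∀ x ∈ s, g x = f x := by
  haveI := TietzeExtension.of_tvs ℝ (E := W)
  obtain ⟨g, hg⟩ := ContinuousMap.exists_restrict_eq hs
    (⟨s.restrict f, continuousOn_iff_continuous_restrict.1 hf⟩ : C(s, W))
  refine ⟨g, g.continuous, fun x hx => ?_⟩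
  have := congrArg (fun k : C(s, W) => k ⟨x, hx⟩) hg
  exact this

theorem smooth_approx {V W : Type*} [NormedAddCommGroup V] [NormedSpace ℝ V]
    [FiniteDimensional ℝ V] [NormedAddCommGroup W]
    [NormedSpace ℝ W] [FiniteDimensional ℝ W] {K : Set V} (hK : IsClosed K) {f : V → W}
    (hf : ContinuousOn f K) {ε : ℝ} (hε : 0 < ε) :
    ∃ P : V → W, ContDiff ℝ (⊤ : ℕ∞) P ∧ ∀ x ∈ K, ‖P x - f x‖ < ε := by
  obtain ⟨g, hg, hgf⟩ := tietze_fd hK hf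
  obtain ⟨P, hP, hPg, -⟩ := hg.exists_contDiff_approx (⊤ : ℕ∞) (ε := fun _ => ε)
    continuous_const (fun _ => hε)
  exact ⟨P, hP, fun x hx => by rw [← hgf x hx, ← dist_eq_norm]; exact hPg x⟩

section
variable {V W : Type*} [NormedAddCommGroup V] [NormedSpace ℝ V]
    [FiniteDimensional ℝ V] [NormedAddCommGroup W]
    [NormedSpace ℝ W] [FiniteDimensional ℝ W]

theorem smooth_homog {f : V → W} (hf : ContinuousOn f {0}ᶜ) (hf0 : ∀ x ≠ 0, f x ≠ 0) :
    ∃ F : V → W, ContDiffOn ℝ 1 F {0}ᶜ ∧ (∀ (c : ℝ) x, 0 < c → F (c • x) = F x) ∧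
      HomOn {0}ᶜ {0}ᶜ f F := by
  set ρ : V → ℝ := fun v => ‖toEuclidean v‖ with hρ
  have hρc : Continuous ρ := by fun_prop
  have hρ0 : ∀ v, v ≠ 0 → 0 < ρ v := fun v hv => by simpa [hρ] using hv
  have hρs : ∀ (c : ℝ) v, 0 < c → ρ (c • v) = c * ρ v := fun c v hc => by
    simp [hρ, norm_smul, abs_of_pos hc]
  have hρd : ContDiffOn ℝ 1 ρ {0}ᶜ := by
    intro v hv
    have : ContDiffAt ℝ 1 (fun w : EuclideanSpace ℝ (Fin (Module.finrank ℝ V)) => ‖w‖)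
        (toEuclidean v) := contDiffAt_norm ℝ (by simpa using hv)
    exact (this.comp v toEuclidean.contDiff.contDiffAt).contDiffWithinAt
  set K : Set V := {v | ρ v = 1} with hK
  have hKc : IsCompact K := by
    have : K = toEuclidean.symm '' (Metric.sphere 0 1) := by
      ext v
      constructor
      · intro hv; exact ⟨toEuclidean v, by simpa [hK] using hv, by simp⟩
      · rintro ⟨w, hw, rfl⟩; simpa [hK, hρ] using hw
    rw [this]
    exact (isCompact_sphere _ _).image toEuclidean.symm.continuous
  have hK0 : ∀ v ∈ K, v ≠ 0 := by
    rintro v hv rfl; simp [hK, hρ] at hv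
  have hfK : ContinuousOn f K := hf.mono hK0
  obtain ⟨m, hm, hmf⟩ : ∃ m > 0, ∀ v ∈ K, m ≤ ‖f v‖ := by
    rcases K.eq_empty_or_nonempty with h | h
    · exact ⟨1, one_pos, by simp [h]⟩
    · obtain ⟨v, hv, hmin⟩ := hKc.exists_isMinOn h hfK.norm
      exact ⟨‖f v‖, norm_pos_iff.2 (hf0 v (hK0 v hv)), fun w hw => hmin hw⟩
  obtain ⟨P, hP, hPf⟩ := smooth_approx hKc.isClosed hfK hm
  have hn : ∀ v, v ≠ 0 → (ρ v)⁻¹ • v ∈ K := by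
    intro v hv
    simp only [hK, mem_setOf_eq]
    rw [hρs _ _ (inv_pos.2 (hρ0 v hv)), inv_mul_cancel₀ (hρ0 v hv).ne']
  have hci : ContinuousOn (fun v : V => (ρ v)⁻¹) {0}ᶜ :=
    hρc.continuousOn.inv₀ fun v hv => (hρ0 v hv).ne'
  have hcn : ContinuousOn (fun v : V => (ρ v)⁻¹ • v) {0}ᶜ := hci.smul continuousOn_id
  refine ⟨fun v => P ((ρ v)⁻¹ • v), ?_, ?_, ?_⟩
  · apply (hP.of_le (by norm_cast)).comp_contDiffOn
    exact (hρd.inv fun v hv => (hρ0 v hv).ne').smul contDiffOn_id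
  · intro c x hc
    dsimp only
    rw [hρs c x hc, smul_smul, mul_inv, mul_comm c⁻¹, mul_assoc, inv_mul_cancel₀ hc.ne', mul_one]
  · have h1 : HomOn {0}ᶜ {0}ᶜ f (fun v => f ((ρ v)⁻¹ • v)) := by
      have hp : ∀ t ∈ Icc (0:ℝ) 1, ∀ v : V, v ≠ 0 → 0 < (1 - t) + t * (ρ v)⁻¹ := by
        intro t ht v hv
        have := inv_pos.2 (hρ0 v hv)
        rcases eq_or_lt_of_le ht.1 with h | h
        · rw [← h]; simp
        · have := mul_pos h this; linarith [ht.2]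
      refine ⟨fun p => f (((1 - p.1) + p.1 * (ρ p.2)⁻¹) • p.2), ?_, ?_, ?_, ?_⟩
      · apply hf.comp
        · have : ContinuousOn (fun p : ℝ × V => (ρ p.2)⁻¹) (Icc 0 1 ×ˢ {0}ᶜ) :=
            hci.comp continuousOn_snd (fun p hp => hp.2)
          fun_prop
        · rintro ⟨t, v⟩ ⟨ht, hv⟩
          exact smul_ne_zero (hp t ht v hv).ne' hv
      · intro t ht v hv
        exact hf0 _ (smul_ne_zero (hp t ht v hv).ne' hv)
      · simp
      · simp
    refine h1.trans (HomOn.of_close (h1.right_cont) ?_ ?_)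
    · exact hP.continuous.comp_continuousOn hcn
    · intro v hv
      exact (hPf _ (hn v hv)).trans_le (hmf _ (hn v hv))

/-- images of `C¹` maps from lower dimensional open sets are small -/
theorem dimH_image_lt {f : V → W} {s : Set V} (hs : IsOpen s) (hf : ContDiffOn ℝ 1 f s)
    (h : Module.finrank ℝ V < Module.finrank ℝ W) : dimH (f '' s) < Module.finrank ℝ W := by
  have h1 : dimH (f '' s) ≤ dimH s := dimH_image_le_of_locally_lipschitzOn fun x hx => by
    obtain ⟨C, u, hu, hl⟩ := ((hf x hx).contDiffAt (hs.mem_nhds hx)).exists_lipschitzOnWith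
    exact ⟨C, u, nhdsWithin_le_nhds hu, hl⟩
  calc _ ≤ dimH s := h1
    _ ≤ dimH (univ : Set V) := dimH_mono (subset_univ _)
    _ = Module.finrank ℝ V := Real.dimH_univ_eq_finrank V
    _ < _ := by exact_mod_cast h
end

/-- choice of generic directions -/
theorem generic_choice {V W : Type*} [NormedAddCommGroup V] [NormedSpace ℝ V]
    [FiniteDimensional ℝ V] [NormedAddCommGroup W]
    [NormedSpace ℝ W] [FiniteDimensional ℝ W] {F : V → W}
    (hF : ContDiffOn ℝ 1 F {0}ᶜ) (hd : Module.finrank ℝ V + 2 < 2 * Module.finrank ℝ W)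
    (hW : 1 < Module.finrank ℝ W)
    {O : Set (W × W × V)} (hO : IsOpen O) (hOne : O.Nonempty) :
    ∃ p q : W, ∃ v : V, (p, q, v) ∈ O ∧
      (∀ x y : V, x ≠ 0 → y ≠ 0 → x - y = v → ∀ a b : ℝ, p = a • F x → q = b • F y → False) ∧
      (v ≠ 0 → ∀ a : ℝ, p ≠ a • F v ∧ p ≠ a • F (-v) ∧ q ≠ a • F v ∧ q ≠ a • F (-v)) := by
  let f1 : V × V × ℝ × ℝ → W × W × V := fun z => (z.2.2.1 • F z.1, z.2.2.2 • F z.2.1, z.1 - z.2.1)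
  let f2 : V × ℝ × W → W × W × V := fun z => (z.2.1 • F z.1, z.2.2, z.1)
  let f3 : V × ℝ × W → W × W × V := fun z => (z.2.1 • F (-z.1), z.2.2, z.1)
  let f4 : V × ℝ × W → W × W × V := fun z => (z.2.2, z.2.1 • F z.1, z.1)
  let f5 : V × ℝ × W → W × W × V := fun z => (z.2.2, z.2.1 • F (-z.1), z.1)
  let s1 : Set (V × V × ℝ × ℝ) := {z | z.1 ≠ 0 ∧ z.2.1 ≠ 0}
  let s2 : Set (V × ℝ × W) := {z | z.1 ≠ 0}
  have hs1 : IsOpen s1 :=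
    (isOpen_ne.preimage continuous_fst).inter (isOpen_ne.preimage (continuous_fst.comp continuous_snd))
  have hs2 : IsOpen s2 := isOpen_ne.preimage continuous_fst
  have hF1 : ContDiffOn ℝ 1 (fun z : V × V × ℝ × ℝ => F z.1) s1 :=
    hF.comp contDiff_fst.contDiffOn (fun z hz => hz.1)
  have hF1' : ContDiffOn ℝ 1 (fun z : V × V × ℝ × ℝ => F z.2.1) s1 :=
    hF.comp (contDiff_fst.comp contDiff_snd).contDiffOn (fun z hz => hz.2)
  have hF2 : ContDiffOn ℝ 1 (fun z : V × ℝ × W => F z.1) s2 :=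
    hF.comp contDiff_fst.contDiffOn (fun z hz => hz)
  have hF3 : ContDiffOn ℝ 1 (fun z : V × ℝ × W => F (-z.1)) s2 :=
    hF.comp contDiff_fst.neg.contDiffOn (fun z hz => by simpa [s2] using hz)
  have e1 : dimH (f1 '' s1) < Module.finrank ℝ (W × W × V) := by
    refine dimH_image_lt hs1 ?_ (by simp; omega)
    have g1 : ContDiff ℝ 1 (fun z : V × V × ℝ × ℝ => z.2.2.1) := by fun_prop
    have g2 : ContDiff ℝ 1 (fun z : V × V × ℝ × ℝ => z.2.2.2) := by fun_prop
    have g3 : ContDiff ℝ 1 (fun z : V × V × ℝ × ℝ => z.1 - z.2.1) := by fun_prop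
    exact (g1.contDiffOn.smul hF1).prodMk ((g2.contDiffOn.smul hF1').prodMk g3.contDiffOn)
  have e2 : dimH (f2 '' s2) < Module.finrank ℝ (W × W × V) := by
    refine dimH_image_lt hs2 ?_ (by simp; omega)
    have g1 : ContDiff ℝ 1 (fun z : V × ℝ × W => z.2.1) := by fun_prop
    have g2 : ContDiff ℝ 1 (fun z : V × ℝ × W => z.2.2) := by fun_prop
    have g3 : ContDiff ℝ 1 (fun z : V × ℝ × W => z.1) := by fun_prop
    exact (g1.contDiffOn.smul hF2).prodMk (g2.contDiffOn.prodMk g3.contDiffOn)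
  have e3 : dimH (f3 '' s2) < Module.finrank ℝ (W × W × V) := by
    refine dimH_image_lt hs2 ?_ (by simp; omega)
    have g1 : ContDiff ℝ 1 (fun z : V × ℝ × W => z.2.1) := by fun_prop
    have g2 : ContDiff ℝ 1 (fun z : V × ℝ × W => z.2.2) := by fun_prop
    have g3 : ContDiff ℝ 1 (fun z : V × ℝ × W => z.1) := by fun_prop
    exact (g1.contDiffOn.smul hF3).prodMk (g2.contDiffOn.prodMk g3.contDiffOn)
  have e4 : dimH (f4 '' s2) < Module.finrank ℝ (W × W × V) := by
    refine dimH_image_lt hs2 ?_ (by simp; omega)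
    have g1 : ContDiff ℝ 1 (fun z : V × ℝ × W => z.2.1) := by fun_prop
    have g2 : ContDiff ℝ 1 (fun z : V × ℝ × W => z.2.2) := by fun_prop
    have g3 : ContDiff ℝ 1 (fun z : V × ℝ × W => z.1) := by fun_prop
    exact g2.contDiffOn.prodMk ((g1.contDiffOn.smul hF2).prodMk g3.contDiffOn)
  have e5 : dimH (f5 '' s2) < Module.finrank ℝ (W × W × V) := by
    refine dimH_image_lt hs2 ?_ (by simp; omega)
    have g1 : ContDiff ℝ 1 (fun z : V × ℝ × W => z.2.1) := by fun_prop
    have g2 : ContDiff ℝ 1 (fun z : V × ℝ × W => z.2.2) := by fun_prop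
    have g3 : ContDiff ℝ 1 (fun z : V × ℝ × W => z.1) := by fun_prop
    exact g2.contDiffOn.prodMk ((g1.contDiffOn.smul hF3).prodMk g3.contDiffOn)
  have hD : Dense (f1 '' s1 ∪ f2 '' s2 ∪ f3 '' s2 ∪ f4 '' s2 ∪ f5 '' s2)ᶜ := by
    apply dense_compl_of_dimH_lt_finrank
    simp only [dimH_union, max_lt_iff]
    exact ⟨⟨⟨⟨e1, e2⟩, e3⟩, e4⟩, e5⟩
  obtain ⟨⟨p, q, v⟩, h1, h2⟩ := hD.inter_open_nonempty O hO hOne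
  simp only [mem_compl_iff, mem_union, not_or] at h2
  obtain ⟨⟨⟨⟨h21, h22⟩, h23⟩, h24⟩, h25⟩ := h2
  refine ⟨p, q, v, h1, ?_, ?_⟩
  · intro x y hx hy hxy a b hp hq
    exact h21 ⟨(x, y, a, b), ⟨hx, hy⟩, by simp [f1, hxy, ← hp, ← hq]⟩
  · intro hv a
    refine ⟨fun h => ?_, fun h => ?_, fun h => ?_, fun h => ?_⟩
    · exact h22 ⟨(v, a, q), hv, by simp [f2, ← h]⟩
    · exact h23 ⟨(v, a, q), hv, by simp [f3, ← h]⟩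
    · exact h24 ⟨(v, a, p), hv, by simp [f4, ← h]⟩
    · exact h25 ⟨(v, a, p), hv, by simp [f5, ← h]⟩

end

section 
open Set

section
variable {E W : Type*} [NormedAddCommGroup E] [NormedSpace ℝ E]
    [FiniteDimensional ℝ E] [NormedAddCommGroup W]
    [NormedSpace ℝ W] [FiniteDimensional ℝ W]

theorem susp_step1 {F : E × ℝ → W × ℝ} (hF : ContDiffOn ℝ 1 F {0}ᶜ) (hF0 : ∀ x ≠ 0, F x ≠ 0)
    (hFh : ∀ (c : ℝ) x, 0 < c → F (c • x) = F x)
    (hd : Module.finrank ℝ E + 1 < 2 * Module.finrank ℝ W) :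
    ∃ F2 : E × ℝ → W × ℝ, HomOn {0}ᶜ {0}ᶜ F F2 ∧ (∀ (c : ℝ) x, 0 < c → F2 (c • x) = F2 x) ∧
      (∀ x t1 t2, (x, t1) ≠ (0 : E × ℝ) → (x, t2) ≠ (0 : E × ℝ) → (F2 (x, t1)).1 = 0 →
        (F2 (x, t1)).2 < 0 → (F2 (x, t2)).1 = 0 → 0 < (F2 (x, t2)).2 → t1 < t2) ∧
      (F2 (0, 1)).1 ≠ 0 ∧ (F2 (0, -1)).1 ≠ 0 := by
  obtain ⟨⟨p1, p2⟩, ⟨q1, q2⟩, ⟨v1, v2⟩, hO, hbad, hpole⟩ := generic_choice hF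
    (by simp; omega) (by simp; omega)
    (O := {z | z.1.2 < 0 ∧ 0 < z.2.1.2 ∧ 0 < z.2.2.2})
    (by
      have a1 : IsOpen {z : (W × ℝ) × (W × ℝ) × (E × ℝ) | z.1.2 < 0} :=
        isOpen_lt (by fun_prop) (by fun_prop)
      have a2 : IsOpen {z : (W × ℝ) × (W × ℝ) × (E × ℝ) | 0 < z.2.1.2} :=
        isOpen_lt (by fun_prop) (by fun_prop)
      have a3 : IsOpen {z : (W × ℝ) × (W × ℝ) × (E × ℝ) | 0 < z.2.2.2} :=
        isOpen_lt (by fun_prop) (by fun_prop)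
      exact a1.inter (a2.inter a3))
    ⟨((0, -1), (0, 1), (0, 1)), by simp⟩
  simp only [mem_setOf_eq] at hO
  obtain ⟨hp2, hq2, hv2⟩ := hO
  have hv0 : ((v1, v2) : E × ℝ) ≠ 0 := by
    intro h; rw [Prod.mk_eq_zero] at h; exact hv2.ne' h.2
  -- the linear path
  let A : ℝ → E × ℝ → E × ℝ := fun r z => (z.1 + (r * z.2) • v1, z.2 * (1 - r + r * v2))
  have hA0 : ∀ r ∈ Icc (0:ℝ) 1, ∀ z, z ≠ 0 → A r z ≠ 0 := by
    rintro r ⟨hr0, hr1⟩ ⟨x, t⟩ hz h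
    apply hz
    simp only [A, Prod.mk_eq_zero] at h ⊢
    have : 0 < 1 - r + r * v2 := by
      rcases hr0.eq_or_lt with h | h
      · rw [← h]; simp
      · have := mul_pos h hv2; linarith
    have ht : t = 0 := by
      rcases mul_eq_zero.1 h.2 with h | h
      · exact h
      · exact absurd h this.ne'
    refine ⟨?_, ht⟩
    simpa [ht] using h.1
  let S : ℝ → W × ℝ → W × ℝ := fun r w =>
    (w.1 - r • ((max w.2 0 / q2) • q1 + (max (-w.2) 0 / (-p2)) • p1), w.2)
  have hS0 : ∀ r w, w ≠ 0 → S r w ≠ 0 := by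
    rintro r ⟨y, τ⟩ hw h
    apply hw
    simp only [S, Prod.mk_eq_zero] at h ⊢
    obtain ⟨h1, h2⟩ := h
    subst h2
    simpa using h1
  have hScont : Continuous (fun z : ℝ × (W × ℝ) => S z.1 z.2) := by
    simp only [S]; fun_prop
  have hAcont : Continuous (fun z : ℝ × (E × ℝ) => A z.1 z.2) := by
    simp only [A]; fun_prop
  have hS1 : ∀ w : W × ℝ, (S 1 w).1 = 0 → (S 1 w).2 < 0 → ∃ a : ℝ, 0 < a ∧ w = a • (p1, p2) := by
    rintro ⟨y, τ⟩ h1 h2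
    simp only [S] at h1 h2
    refine ⟨τ / p2, div_pos_of_neg_of_neg h2 hp2, ?_⟩
    rw [max_eq_right h2.le, max_eq_left (by linarith)] at h1
    simp only [zero_div, zero_smul, zero_add, one_smul, neg_div_neg_eq] at h1
    rw [sub_eq_zero] at h1
    simp [h1, hp2.ne]
  have hS2 : ∀ w : W × ℝ, (S 1 w).1 = 0 → 0 < (S 1 w).2 → ∃ a : ℝ, 0 < a ∧ w = a • (q1, q2) := by
    rintro ⟨y, τ⟩ h1 h2
    simp only [S] at h1 h2
    refine ⟨τ / q2, div_pos h2 hq2, ?_⟩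
    rw [max_eq_left h2.le, max_eq_right (by linarith)] at h1
    simp only [zero_div, zero_smul, add_zero, one_smul] at h1
    rw [sub_eq_zero] at h1
    simp [h1, hq2.ne']
  have hA1h : ∀ (c : ℝ) z, A 1 (c • z) = c • A 1 z := by
    rintro c ⟨x, t⟩
    simp [A, smul_smul, mul_assoc]
  have hpoleS : ∀ z : E × ℝ, (z = (v1, v2) ∨ z = -(v1, v2)) → (S 1 (F z)).1 ≠ 0 := by
    intro z hz h
    have hz0 : z ≠ 0 := by
      rcases hz with rfl | rfl
      · exact hv0
      · simpa using hv0
    have hne := hS0 1 _ (hF0 z hz0)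
    rcases lt_trichotomy (S 1 (F z)).2 0 with h2 | h2 | h2
    · obtain ⟨a, ha, he⟩ := hS1 _ h h2
      have : ((p1, p2) : W × ℝ) = a⁻¹ • F z := by rw [he, smul_smul, inv_mul_cancel₀ ha.ne', one_smul]
      rcases hz with rfl | rfl
      · exact (hpole hv0 _).1 this
      · exact (hpole hv0 _).2.1 this
    · exact hne (Prod.ext h h2)
    · obtain ⟨a, ha, he⟩ := hS2 _ h h2
      have : ((q1, q2) : W × ℝ) = a⁻¹ • F z := by rw [he, smul_smul, inv_mul_cancel₀ ha.ne', one_smul]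
      rcases hz with rfl | rfl
      · exact (hpole hv0 _).2.2.1 this
      · exact (hpole hv0 _).2.2.2 this
  refine ⟨fun z => S 1 (F (A 1 z)), ?_, ?_, ?_, ?_, ?_⟩
  · refine ⟨fun z => S z.1 (F (A z.1 z.2)), ?_, ?_, ?_, ?_⟩
    · have h1 : ContinuousOn (fun z : ℝ × (E × ℝ) => F (A z.1 z.2)) (Icc 0 1 ×ˢ {0}ᶜ) :=
        hF.continuousOn.comp hAcont.continuousOn (fun z hz => hA0 _ hz.1 _ hz.2)
      exact hScont.comp_continuousOn (continuousOn_fst.prodMk h1)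
    · intro t ht x hx
      exact hS0 _ _ (hF0 _ (hA0 t ht x hx))
    · intro x hx; simp [S, A]
    · intro x hx; rfl
  · intro c x hc
    dsimp only
    rw [hA1h, hFh _ _ hc]
  · intro x t1 t2 hx1 hx2 h1 h2 h3 h4
    obtain ⟨a, ha, he⟩ := hS1 _ h1 h2
    obtain ⟨b, hb, he'⟩ := hS2 _ h3 h4
    have hp : ((p1, p2) : W × ℝ) = a⁻¹ • F (A 1 (x, t1)) := by
      rw [he, smul_smul, inv_mul_cancel₀ ha.ne', one_smul]
    have hq : ((q1, q2) : W × ℝ) = b⁻¹ • F (A 1 (x, t2)) := by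
      rw [he', smul_smul, inv_mul_cancel₀ hb.ne', one_smul]
    by_contra hlt
    rcases (not_lt.1 hlt).eq_or_lt with h | h
    · subst h
      rw [he] at he'
      have := congrArg Prod.snd he'
      simp at this
      have i1 := mul_neg_of_pos_of_neg ha hp2
      have i2 := mul_pos hb hq2
      linarith
    · have hc : 0 < (t1 - t2)⁻¹ := inv_pos.2 (sub_pos.2 h)
      have hc0 : t1 - t2 ≠ 0 := (sub_pos.2 h).ne'
      refine hbad ((t1 - t2)⁻¹ • A 1 (x, t1)) ((t1 - t2)⁻¹ • A 1 (x, t2))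
        (smul_ne_zero hc.ne' (hA0 1 (by simp) _ hx1)) (smul_ne_zero hc.ne' (hA0 1 (by simp) _ hx2))
        ?_ a⁻¹ b⁻¹ (by rw [hFh _ _ hc]; exact hp) (by rw [hFh _ _ hc]; exact hq)
      rw [← smul_sub]
      simp only [A, Prod.mk_sub_mk, Prod.smul_mk, Prod.mk.injEq]
      constructor
      · rw [add_sub_add_left_eq_sub, ← sub_smul, smul_smul, one_mul, one_mul, inv_mul_cancel₀ hc0,
          one_smul]
      · simp only [sub_self, zero_add, one_mul, smul_eq_mul]
        rw [← sub_mul, inv_mul_cancel_left₀ hc0]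
  · apply hpoleS
    left; simp [A]
  · apply hpoleS
    right; simp [A]

theorem susp_step2 {F : E × ℝ → W × ℝ} (hF : ContinuousOn F {0}ᶜ) (hF0 : ∀ x ≠ 0, F x ≠ 0)
    (hFh : ∀ (c : ℝ) x, 0 < c → F (c • x) = F x)
    (hlt : ∀ x t1 t2, (x, t1) ≠ (0 : E × ℝ) → (x, t2) ≠ (0 : E × ℝ) → (F (x, t1)).1 = 0 →
        (F (x, t1)).2 < 0 → (F (x, t2)).1 = 0 → 0 < (F (x, t2)).2 → t1 < t2)
    (hp1 : (F (0, 1)).1 ≠ 0) (hp2 : (F (0, -1)).1 ≠ 0) :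
    ∃ s : E → ℝ, Continuous s ∧ s 0 = 0 ∧
      (∀ x t, x ≠ 0 → (F (x, t)).1 = 0 → (F (x, t)).2 < 0 → t < s x) ∧
      (∀ x t, x ≠ 0 → (F (x, t)).1 = 0 → 0 < (F (x, t)).2 → s x < t) := by
  have hne : ∀ {x : E} {t : ℝ}, x ≠ 0 → ((x, t) : E × ℝ) ≠ 0 := fun hx h => hx (congrArg Prod.fst h)
  -- bound
  have hpole : ∀ e : ℝ, (F (0, e)).1 ≠ 0 → e ≠ 0 → ∃ δ > 0, ∀ x : E, ‖x‖ < δ → (F (x, e)).1 ≠ 0 := by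
    intro e he he0
    have hc : ContinuousAt F (0, e) :=
      hF.continuousAt (isOpen_ne.mem_nhds (by intro h; exact he0 (congrArg Prod.snd h)))
    have hc2 : ContinuousAt (fun x : E => (F (x, e)).1) 0 := by
      have h2 : ContinuousAt (fun x : E => ((x, e) : E × ℝ)) 0 := by fun_prop
      exact continuousAt_fst.comp (ContinuousAt.comp (f := fun x : E => ((x, e) : E × ℝ)) hc h2)
    have := hc2.eventually_ne he
    obtain ⟨δ, hδ, h⟩ := Metric.eventually_nhds_iff.1 this
    exact ⟨δ, hδ, fun x hx => h (by simpa using hx)⟩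
  obtain ⟨δ1, hδ1, hd1⟩ := hpole 1 hp1 one_ne_zero
  obtain ⟨δ2, hδ2, hd2⟩ := hpole (-1) hp2 (by norm_num)
  obtain ⟨T, hT0, hT⟩ : ∃ T > 0, ∀ x : E, ‖x‖ = 1 → ∀ t : ℝ, (F (x, t)).1 = 0 → |t| < T := by
    refine ⟨max (δ1⁻¹) (δ2⁻¹) + 1, by positivity, ?_⟩
    intro x hx t h0
    by_contra hcon
    push Not at hcon
    have htpos : 0 < |t| := lt_of_lt_of_le (by positivity) hcon
    have key : F (x, t) = F (|t|⁻¹ • x, |t|⁻¹ * t) := by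
      rw [← hFh (|t|⁻¹) (x, t) (inv_pos.2 htpos)]; rfl
    have hn : ‖|t|⁻¹ • x‖ = |t|⁻¹ := by rw [norm_smul, hx]; simp
    have l1 : |t|⁻¹ < δ1 := by
      apply inv_lt_of_inv_lt₀ hδ1; linarith [le_max_left δ1⁻¹ δ2⁻¹]
    have l2 : |t|⁻¹ < δ2 := by
      apply inv_lt_of_inv_lt₀ hδ2; linarith [le_max_right δ1⁻¹ δ2⁻¹]
    rcases le_or_gt 0 t with ht | ht
    · rw [abs_of_nonneg ht] at *
      rw [key, inv_mul_cancel₀ htpos.ne'] at h0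
      exact hd1 _ (by rw [hn]; exact l1) h0
    · rw [abs_of_neg ht] at *
      have e : (-t)⁻¹ * t = -1 := by rw [inv_neg, neg_mul, inv_mul_cancel₀ ht.ne]
      rw [key, e] at h0
      exact hd2 _ (by rw [hn]; exact l2) h0
  -- compact pieces
  let Sp := Metric.sphere (0 : E) 1
  have hSp : ∀ x ∈ Sp, x ≠ 0 ∧ ‖x‖ = 1 := by
    intro x hx
    have : ‖x‖ = 1 := by simpa [Sp] using hx
    exact ⟨by intro h; rw [h] at this; simp at this, this⟩
  have hFc : ContinuousOn F (Sp ×ˢ Icc (-T) T) := hF.mono (fun z hz => by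
    obtain ⟨x, t⟩ := z; exact hne (hSp x hz.1).1)
  have hcomp : ∀ (ε : ℝ) (C : Set ℝ), IsClosed C →
      IsCompact {z : E × ℝ | z ∈ Sp ×ˢ Icc (-T) T ∧ (F z).1 = 0 ∧ 0 ≤ ε * (F z).2 ∧ z.2 ∈ C} := by
    intro ε C hC
    have hK : IsCompact (Sp ×ˢ Icc (-T) T) := (isCompact_sphere _ _).prod isCompact_Icc
    have : {z : E × ℝ | z ∈ Sp ×ˢ Icc (-T) T ∧ (F z).1 = 0 ∧ 0 ≤ ε * (F z).2 ∧ z.2 ∈ C} =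
      (Sp ×ˢ Icc (-T) T ∩ (F ⁻¹' {w | w.1 = 0 ∧ 0 ≤ ε * w.2})) ∩ {z | z.2 ∈ C} := by
      ext z; simp only [mem_setOf_eq, mem_inter_iff, mem_preimage]; tauto
    rw [this]
    apply IsCompact.inter_right
    · apply hK.of_isClosed_subset _ inter_subset_left
      apply hFc.preimage_isClosed_of_isClosed hK.isClosed
      have a1 : IsClosed {w : W × ℝ | w.1 = 0} := isClosed_eq continuous_fst continuous_const
      have a2 : IsClosed {w : W × ℝ | 0 ≤ ε * w.2} := isClosed_le continuous_const (by fun_prop)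
      exact a1.inter a2
    · exact hC.preimage continuous_snd
  -- slices
  have hexc : ∀ x0 ∈ Sp, ∃ c : ℝ, ∀ t, (F (x0, t)).1 = 0 → ((F (x0, t)).2 < 0 → t < c) ∧
      (0 < (F (x0, t)).2 → c < t) := by
    intro x0 hx0
    have hx00 := (hSp x0 hx0).1
    have slice : ∀ ε : ℝ, IsCompact {t : ℝ | t ∈ Icc (-T) T ∧ (F (x0, t)).1 = 0 ∧ 0 ≤ ε * (F (x0, t)).2} := by
      intro ε
      have h1 := ((hcomp ε univ isClosed_univ).inter_right
        (isClosed_eq (continuous_fst (X := E) (Y := ℝ)) (continuous_const (y := x0)))).image continuous_snd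
      convert h1 using 1
      ext t
      simp only [mem_setOf_eq, mem_image, mem_inter_iff, Prod.exists]
      constructor
      · rintro ⟨a, b, c⟩
        exact ⟨x0, t, ⟨⟨⟨hx0, a⟩, b, c, trivial⟩, rfl⟩, rfl⟩
      · rintro ⟨x, t', ⟨⟨⟨h1, h2⟩, h3, h4, -⟩, h5⟩, h6⟩
        subst h5; subst h6
        exact ⟨h2, h3, h4⟩
    have hK := (slice (-1)).union (isCompact_singleton (x := -T - 1))
    have hL := (slice 1).union (isCompact_singleton (x := T + 1))
    obtain ⟨k, hk, hkm⟩ := hK.exists_isMaxOn ⟨-T - 1, Or.inr rfl⟩ continuousOn_id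
    obtain ⟨l, hl, hlm⟩ := hL.exists_isMinOn ⟨T + 1, Or.inr rfl⟩ continuousOn_id
    have hkl : k < l := by
      rcases hk with ⟨a1, a2, a3⟩ | hk
      · rcases hl with ⟨b1, b2, b3⟩ | hl
        · refine hlt x0 k l (hne hx00) (hne hx00) a2 ?_ b2 ?_
          · rcases (show (F (x0, k)).2 ≤ 0 by linarith).eq_or_lt with h | h
            · exact absurd (Prod.ext a2 h) (hF0 _ (hne hx00))
            · exact h
          · rcases (show 0 ≤ (F (x0, l)).2 by linarith).eq_or_lt with h | h
            · exact absurd (Prod.ext b2 h.symm) (hF0 _ (hne hx00))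
            · exact h
        · rw [mem_singleton_iff.1 hl]; linarith [a1.2]
      · rw [mem_singleton_iff.1 hk]
        rcases hl with ⟨b1, b2, b3⟩ | hl
        · linarith [b1.1]
        · rw [mem_singleton_iff.1 hl]; linarith
    refine ⟨(k + l) / 2, fun t h0 => ⟨fun h => ?_, fun h => ?_⟩⟩
    · have ht := abs_lt.1 (hT x0 (hSp x0 hx0).2 t h0)
      have : t ≤ k := hkm (Or.inl ⟨⟨ht.1.le, ht.2.le⟩, h0, by linarith⟩)
      linarith
    · have ht := abs_lt.1 (hT x0 (hSp x0 hx0).2 t h0)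
      have : l ≤ t := hlm (Or.inl ⟨⟨ht.1.le, ht.2.le⟩, h0, by linarith⟩)
      linarith
  -- partition of unity
  obtain ⟨g, hg⟩ := exists_continuous_forall_mem_convex_of_local_const
    (X := Sp) (E := ℝ) (t := fun x => {c | ∀ t, (F (x.1, t)).1 = 0 → ((F (x.1, t)).2 < 0 → t < c) ∧
      (0 < (F (x.1, t)).2 → c < t)}) (by
        intro x c hc d hd a b ha hb hab t h0
        have hc' := hc t h0
        have hd' := hd t h0
        refine ⟨fun h => ?_, fun h => ?_⟩
        · have := hc'.1 h
          have := hd'.1 h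
          simp only [smul_eq_mul]
          rcases ha.eq_or_lt with h | h
          · subst h; have : b = 1 := by linarith
            subst this; linarith
          · have e : t = a * t + b * t := by rw [← add_mul, hab, one_mul]
            linarith [mul_lt_mul_of_pos_left (hc'.1 ‹_›) h, mul_le_mul_of_nonneg_left (hd'.1 ‹_›).le hb]
        · have := hc'.2 h
          have := hd'.2 h
          simp only [smul_eq_mul]
          rcases ha.eq_or_lt with h | h
          · subst h; have : b = 1 := by linarith
            subst this; linarith
          · have e : t = a * t + b * t := by rw [← add_mul, hab, one_mul]
            linarith [mul_lt_mul_of_pos_left (hc'.2 ‹_›) h, mul_le_mul_of_nonneg_left (hd'.2 ‹_›).le hb]) (by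
        rintro ⟨x0, hx0⟩
        obtain ⟨c, hc⟩ := hexc x0 hx0
        refine ⟨c, ?_⟩
        have hx00 := (hSp x0 hx0).1
        have c1 := ((hcomp (-1) (Ici c) isClosed_Ici).image continuous_fst).isClosed
        have c2 := ((hcomp 1 (Iic c) isClosed_Iic).image continuous_fst).isClosed
        have n1 : x0 ∉ Prod.fst '' {z : E × ℝ | z ∈ Sp ×ˢ Icc (-T) T ∧ (F z).1 = 0 ∧ 0 ≤ -1 * (F z).2 ∧ z.2 ∈ Ici c} := by
          rintro ⟨⟨x, t⟩, ⟨h1, h2, h3, h4⟩, h5⟩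
          simp only at h5; subst h5
          rcases (show (F (x, t)).2 ≤ 0 by linarith).eq_or_lt with h | h
          · exact absurd (Prod.ext h2 h) (hF0 _ (hne hx00))
          · exact absurd ((hc t h2).1 h) (not_lt.2 h4)
        have n2 : x0 ∉ Prod.fst '' {z : E × ℝ | z ∈ Sp ×ˢ Icc (-T) T ∧ (F z).1 = 0 ∧ 0 ≤ 1 * (F z).2 ∧ z.2 ∈ Iic c} := by
          rintro ⟨⟨x, t⟩, ⟨h1, h2, h3, h4⟩, h5⟩
          simp only at h5; subst h5
          rcases (show 0 ≤ (F (x, t)).2 by linarith).eq_or_lt with h | h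
          · exact absurd (Prod.ext h2 h.symm) (hF0 _ (hne hx00))
          · exact absurd ((hc t h2).2 h) (not_lt.2 h4)
        have tv : Filter.Tendsto (fun y : Sp => (y : E)) (nhds ⟨x0, hx0⟩) (nhds x0) :=
          (continuous_subtype_val (p := (· ∈ Sp))).tendsto ⟨x0, hx0⟩
        have ev := tv (c1.isOpen_compl.mem_nhds (x := x0) n1)
        have tv : Filter.Tendsto (fun y : Sp => (y : E)) (nhds ⟨x0, hx0⟩) (nhds x0) :=
          (continuous_subtype_val (p := (· ∈ Sp))).tendsto ⟨x0, hx0⟩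
        have ev2 := tv (c2.isOpen_compl.mem_nhds (x := x0) n2)
        filter_upwards [ev, ev2]
        rintro ⟨x, hx⟩ h1 h2 t h0
        have ht := abs_lt.1 (hT x (hSp x hx).2 t h0)
        refine ⟨fun h => ?_, fun h => ?_⟩
        · by_contra hcon
          exact h1 ⟨(x, t), ⟨⟨hx, ⟨ht.1.le, ht.2.le⟩⟩, h0, by linarith, not_lt.1 hcon⟩, rfl⟩
        · by_contra hcon
          exact h2 ⟨(x, t), ⟨⟨hx, ⟨ht.1.le, ht.2.le⟩⟩, h0, by linarith, not_lt.1 hcon⟩, rfl⟩)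
  -- homogenize
  classical
  obtain ⟨g', hg'c, hg'⟩ := tietze_fd (X := E) (W := ℝ) (s := Sp) Metric.isClosed_sphere
    (f := fun x => if h : x ∈ Sp then g ⟨x, h⟩ else 0) (by
      rw [continuousOn_iff_continuous_restrict]
      convert g.continuous using 1
      ext ⟨x, hx⟩
      simp [hx])
  obtain ⟨M, hM⟩ := ((isCompact_sphere (0 : E) 1).exists_bound_of_continuousOn hg'c.continuousOn)
  have hns : ∀ x : E, x ≠ 0 → ‖x‖⁻¹ • x ∈ Sp := by
    intro x hx; simp [Sp, norm_smul, hx]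
  have hgood : ∀ x : E, x ≠ 0 → ∀ t, (F (x, t)).1 = 0 →
      ((F (x, t)).2 < 0 → t < ‖x‖ * g' (‖x‖⁻¹ • x)) ∧ (0 < (F (x, t)).2 → ‖x‖ * g' (‖x‖⁻¹ • x) < t) := by
    intro x hx t
    have hxp : 0 < ‖x‖ := norm_pos_iff.2 hx
    have e : F (x, t) = F (‖x‖⁻¹ • x, ‖x‖⁻¹ * t) := by
      rw [← hFh (‖x‖⁻¹) (x, t) (inv_pos.2 hxp)]; rfl
    rw [e, hg' _ (hns x hx), dif_pos (hns x hx)]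
    intro h0
    have := hg ⟨_, hns x hx⟩ (‖x‖⁻¹ * t) h0
    refine ⟨fun h => ?_, fun h => ?_⟩
    · have := this.1 h
      rwa [inv_mul_lt_iff₀ hxp] at this
    · have := this.2 h
      rwa [lt_inv_mul_iff₀ hxp] at this
  refine ⟨fun x => ‖x‖ * g' (‖x‖⁻¹ • x), ?_, by simp, fun x t hx h0 => (hgood x hx t h0).1,
    fun x t hx h0 => (hgood x hx t h0).2⟩
  rw [continuous_iff_continuousAt]
  intro x
  by_cases hx : x = 0
  · subst hx
    have : Filter.Tendsto (fun x : E => ‖x‖ * M) (nhds 0) (nhds 0) := by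
      have h : Continuous (fun x : E => ‖x‖ * M) := by fun_prop
      simpa using h.tendsto 0
    simp only [ContinuousAt, norm_zero, zero_mul]
    apply squeeze_zero_norm _ this
    intro x
    rw [norm_mul, norm_norm]
    by_cases hx : x = 0
    · simp [hx]
    · exact mul_le_mul_of_nonneg_left (hM _ (hns x hx)) (norm_nonneg _)
  · have hxn : ‖x‖ ≠ 0 := norm_ne_zero_iff.2 hx
    have h1 : ContinuousAt (fun x : E => ‖x‖⁻¹ • x) x := by fun_prop (disch := assumption)
    have h2 := ContinuousAt.comp (f := fun x : E => ‖x‖⁻¹ • x) (g := g') (x := x) hg'c.continuousAt h1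
    exact continuous_norm.continuousAt.mul h2

/-- the suspension of `h` -/
noncomputable def susp (h : E → W) (z : E × ℝ) : W × ℝ := ((‖z.1‖ / ‖h z.1‖) • h z.1, z.2)

theorem hat_continuous {h : E → W} (hc : ContinuousOn h {0}ᶜ) (h0 : ∀ x ≠ 0, h x ≠ 0) :
    Continuous (fun x => (‖x‖ / ‖h x‖) • h x) := by
  rw [continuous_iff_continuousAt]
  intro x
  by_cases hx : x = 0
  · subst hx
    have : Filter.Tendsto (fun x : E => ‖x‖) (nhds 0) (nhds 0) := by
      simpa using (continuous_norm (E := E)).tendsto 0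
    simp only [ContinuousAt, norm_zero, zero_div, zero_smul]
    apply squeeze_zero_norm _ this
    intro x
    by_cases hx : x = 0
    · simp [hx]
    · rw [norm_smul, norm_div, norm_norm, norm_norm, div_mul_cancel₀]
      exact norm_ne_zero_iff.2 (h0 x hx)
  · have h1 : ContinuousAt h x := hc.continuousAt (isOpen_ne.mem_nhds hx)
    have : ‖h x‖ ≠ 0 := norm_ne_zero_iff.2 (h0 x hx)
    fun_prop (disch := assumption)

theorem suspension {f : E × ℝ → W × ℝ} (hf : ContinuousOn f {0}ᶜ) (hf0 : ∀ x ≠ 0, f x ≠ 0)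
    (hd : Module.finrank ℝ E + 1 < 2 * Module.finrank ℝ W) :
    ∃ h : E → W, ContinuousOn h {0}ᶜ ∧ (∀ x ≠ 0, h x ≠ 0) ∧ HomOn {0}ᶜ {0}ᶜ f (susp h) := by
  obtain ⟨F, hF, hFh, hfF⟩ := smooth_homog hf hf0
  obtain ⟨F2, hFF2, hF2h, hlt, hp1, hp2⟩ := susp_step1 hF hfF.right_mem hFh hd
  obtain ⟨s, hs, hs0, hK, hL⟩ := susp_step2 hFF2.right_cont hFF2.right_mem hF2h hlt hp1 hp2
  have hF2c := hFF2.right_cont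
  have hF20 := hFF2.right_mem
  have hpole : ∀ t : ℝ, t ≠ 0 → (F2 (0, t)).1 ≠ 0 := by
    intro t ht
    rcases lt_or_gt_of_ne ht with h | h
    · have := hF2h (-t) (0, -1) (by linarith)
      simp at this
      rw [this]; exact hp2
    · have := hF2h t (0, 1) h
      simp at this
      rw [this]; exact hp1
  have hsh : ∀ (r : ℝ) (z : E × ℝ), z ≠ 0 → ((z.1, z.2 + r * s z.1) : E × ℝ) ≠ 0 := by
    rintro r ⟨x, t⟩ hz h
    apply hz
    rw [Prod.mk_eq_zero] at h ⊢
    obtain ⟨h1, h2⟩ := h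
    simp only at h1 h2
    subst h1
    rw [hs0] at h2
    simpa using h2
  let F3 : E × ℝ → W × ℝ := fun z => F2 (z.1, z.2 + 1 * s z.1)
  have e1 : HomOn {0}ᶜ {0}ᶜ F2 F3 := by
    refine ⟨fun z => F2 (z.2.1, z.2.2 + z.1 * s z.2.1), ?_, ?_, ?_, ?_⟩
    · exact hF2c.comp (by fun_prop) (fun z hz => hsh _ _ hz.2)
    · intro t ht z hz
      exact hF20 _ (hsh _ _ hz)
    · simp
    · simp [F3]
  have hF3c := e1.right_cont
  have hF30 := e1.right_mem
  have hsgn : ∀ z : E × ℝ, z ≠ 0 → (F3 z).1 = 0 →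
      (z.2 < 0 ∧ (F3 z).2 < 0) ∨ (0 < z.2 ∧ 0 < (F3 z).2) := by
    rintro ⟨x, t⟩ hz h
    by_cases hx : x = 0
    · subst hx
      simp only [F3, hs0, mul_zero, add_zero] at h
      exact absurd h (hpole t (by rintro rfl; exact hz rfl))
    · have hne := hF30 _ hz
      rcases lt_trichotomy (F3 (x, t)).2 0 with h2 | h2 | h2
      · left
        refine ⟨?_, h2⟩
        have := hK x _ hx h h2
        simp only at this ⊢; linarith
      · exact absurd (Prod.ext h h2) hne
      · right
        refine ⟨?_, h2⟩
        have := hL x _ hx h h2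
        simp only at this ⊢; linarith
  have e2 : HomOn {0}ᶜ {0}ᶜ F3 (fun z => ((F3 z).1, z.2)) := by
    apply HomOn.linear hF3c (by fun_prop)
    intro r hr z hz h
    have h' := Prod.mk_eq_zero.1 h
    simp only [Prod.fst_add, Prod.smul_fst, Prod.snd_add, Prod.smul_snd, smul_eq_mul] at h'
    obtain ⟨h1, h2⟩ := h'
    rw [← add_smul, sub_add_cancel, one_smul] at h1
    rcases hsgn z hz h1 with ⟨a, b⟩ | ⟨a, b⟩ 
    · rcases hr.1.eq_or_lt with h | h
      · rw [← h] at h2; linarith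
      · nlinarith [mul_neg_of_pos_of_neg h a, mul_nonneg (sub_nonneg.2 hr.2) (neg_pos.2 b).le]
    · rcases hr.1.eq_or_lt with h | h
      · rw [← h] at h2; linarith
      · nlinarith [mul_pos h a, mul_nonneg (sub_nonneg.2 hr.2) b.le]
  let h : E → W := fun x => (F3 (x, 0)).1
  have hx0 : ∀ x : E, x ≠ 0 → ((x, (0:ℝ)) : E × ℝ) ≠ 0 := fun x hx h => hx (congrArg Prod.fst h)
  have hh0 : ∀ x ≠ 0, h x ≠ 0 := by
    intro x hx h0
    rcases hsgn (x, 0) (hx0 x hx) h0 with ⟨a, b⟩ | ⟨a, b⟩ <;> simp at a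
  have hhc : ContinuousOn h {0}ᶜ := by
    have : ContinuousOn (fun x : E => F3 (x, 0)) {0}ᶜ := hF3c.comp (by fun_prop) (fun x hx => hx0 x hx)
    exact continuous_fst.comp_continuousOn this
  refine ⟨h, hhc, hh0, hfF.trans (hFF2.trans (e1.trans (e2.trans ?_)))⟩
  have hsc : Continuous (susp h) := ((hat_continuous hhc hh0).comp continuous_fst).prodMk continuous_snd
  apply HomOn.linear (by fun_prop) hsc.continuousOn
  rintro r hr ⟨x, t⟩ hz h0
  have h' := Prod.mk_eq_zero.1 h0
  simp only [susp, Prod.fst_add, Prod.smul_fst, Prod.snd_add, Prod.smul_snd, smul_eq_mul] at h'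
  obtain ⟨h1, h2⟩ := h'
  have ht : t = 0 := by linarith
  subst ht
  have hx : x ≠ 0 := by rintro rfl; exact hz rfl
  have hxx : 0 < ‖x‖ / ‖h x‖ := div_pos (norm_pos_iff.2 hx) (norm_pos_iff.2 (hh0 x hx))
  have h1' : (1 - r + r * (‖x‖ / ‖h x‖)) • h x = 0 := by
    rw [add_smul, mul_smul]; exact h1
  have : 0 < 1 - r + r * (‖x‖ / ‖h x‖) := by
    rcases hr.1.eq_or_lt with h | h
    · rw [← h]; simp
    · have := mul_pos h hxx; linarith [hr.2]
  exact smul_ne_zero this.ne' (hh0 x hx) h1'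

end

end

section 
open Set

noncomputable def detForm (n : ℕ) : (Fin n → ℝ) [⋀^Fin n]→L[ℝ] ℝ :=
  { (Matrix.detRowAlternating : (Fin n → ℝ) [⋀^Fin n]→ₗ[ℝ] ℝ) with
    cont := by
      show Continuous fun M : Fin n → Fin n → ℝ => Matrix.det (Matrix.of M)
      exact Continuous.matrix_det (continuous_id) }

theorem detForm_apply (n : ℕ) (v : Fin n → Fin n → ℝ) : detForm n v = Matrix.det (Matrix.of v) := rfl

noncomputable def bumpF (n : ℕ) : (Fin n → ℝ) → ℝ :=
  (⟨1/4, 1/2, by norm_num, by norm_num⟩ : ContDiffBump (0 : Fin n → ℝ))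

theorem bumpF_contDiff (n : ℕ) : ContDiff ℝ (⊤ : ℕ∞) (bumpF n) := ContDiffBump.contDiff _
theorem bumpF_nonneg (n : ℕ) (x) : 0 ≤ bumpF n x := ContDiffBump.nonneg _
theorem bumpF_zero {n : ℕ} {x : Fin n → ℝ} (h : 1/2 ≤ ‖x‖) : bumpF n x = 0 :=
  ContDiffBump.zero_of_le_dist _ (by simpa [dist_zero_right] using h)
theorem bumpF_pos {n : ℕ} {x : Fin n → ℝ} (h : ‖x‖ < 1/2) : 0 < bumpF n x :=
  ContDiffBump.pos_of_mem_ball _ (by simpa [dist_zero_right] using h)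

/-- Jacobian determinant. -/
noncomputable def Jd {n : ℕ} (P : (Fin n → ℝ) → (Fin n → ℝ)) (x : Fin n → ℝ) : ℝ :=
  detForm n (fun j => fderiv ℝ P x (Pi.single j 1))

/-- The degree integral. -/
noncomputable def degI {n : ℕ} (P : (Fin n → ℝ) → (Fin n → ℝ)) (a b : Fin n → ℝ) : ℝ :=
  ∫ x in Icc a b, bumpF n (P x) * Jd P x

theorem degI_hom {n : ℕ} {Φ : (Fin (n+1) → ℝ) → (Fin n → ℝ)} {a b : Fin n → ℝ} (hab : a ≤ b)
    (hΦs : ContDiff ℝ (⊤ : ℕ∞) Φ)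
    (h : ∀ y : Fin (n+1) → ℝ, (Fin.tail y : Fin n → ℝ) ∈ Icc a b → (∃ i, (Fin.tail y : Fin n → ℝ) i = a i ∨ (Fin.tail y : Fin n → ℝ) i = b i) → y 0 ∈ Icc (0:ℝ) 1 →
      1/2 ≤ ‖Φ y‖) : degI (fun x => Φ (Fin.cons 0 x)) a b = degI (fun x => Φ (Fin.cons 1 x)) a b := by
  set ω : (Fin n → ℝ) → (Fin n → ℝ) [⋀^Fin n]→L[ℝ] ℝ := fun y => bumpF n y • detForm n with hω
  have hωd : Differentiable ℝ ω := by
    apply Differentiable.smul_const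
    exact (bumpF_contDiff n).differentiable (by simp)
  set β : (Fin (n+1) → ℝ) → (Fin (n+1) → ℝ) [⋀^Fin n]→L[ℝ] ℝ :=
    fun x => (ω (Φ x)).compContinuousLinearMap (fderiv ℝ Φ x) with hβ
  have hΦ' : Differentiable ℝ (fderiv ℝ Φ) :=
    (hΦs.fderiv_right (m := 1) (by norm_cast)).differentiable (by simp)
  have hβd : Differentiable ℝ β := by
    intro x
    apply DifferentiableAt.continuousAlternatingMapCompContinuousLinearMap
    · exact (hωd _).comp x (hΦs.differentiable (by simp) x)
    · exact hΦ' x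
  have hext : ∀ x, extDeriv β x = 0 := by
    intro x
    rw [hβ, extDeriv_pullback (r := (⊤:ℕ∞)) (hωd _) hΦs.contDiffAt
      (by rw [minSmoothness_of_isRCLikeNormedField]; norm_cast)]
    ext v
    apply AlternatingMap.map_linearDependent (extDeriv ω (Φ x)).toAlternatingMap
    intro hli
    have := hli.fintype_card_le_finrank
    simp at this
  have hβv : ∀ x (v : Fin n → Fin (n+1) → ℝ),
      β x v = bumpF n (Φ x) * detForm n (fun j => fderiv ℝ Φ x (v j)) := fun x v => rfl
  let e : Fin (n+1) → (Fin (n+1) → ℝ) := fun i => Pi.single i 1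
  have hbv : ∀ v, Differentiable ℝ (fun x => β x v) := fun v => hβd.continuousAlternatingMap_apply_const v
  have key := MeasureTheory.integral_divergence_of_hasFDerivAt_off_countable'
    (Fin.cons 0 a) (Fin.cons 1 b) (by
      intro i; refine Fin.cases ?_ ?_ i
      · simp
      · intro j; simpa using hab j)
    (fun i x => (-1 : ℝ) ^ (i : ℕ) • β x (i.removeNth e))
    (fun i x => (-1 : ℝ) ^ (i : ℕ) • fderiv ℝ (fun x => β x (i.removeNth e)) x) ∅ countable_empty
    (fun i => ((hbv (i.removeNth e)).continuous.const_smul ((-1 : ℝ) ^ (i : ℕ))).continuousOn)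
    (fun x _ i => ((hbv (i.removeNth e)) x).hasFDerivAt.const_smul ((-1 : ℝ) ^ (i : ℕ)))
    (by
      have : (fun x : Fin (n+1) → ℝ => ∑ i : Fin (n+1), ((-1 : ℝ) ^ (i : ℕ) • fderiv ℝ (fun x => β x (i.removeNth e)) x) (Pi.single i 1))
        = fun x => extDeriv β x e := by
          ext x; rw [extDeriv_apply (hβd x)]; simp [e]
      rw [this]
      simp only [hext]
      exact MeasureTheory.integrableOn_zero)
  have e0 : (fun x : Fin (n+1) → ℝ => ∑ i : Fin (n+1), ((-1 : ℝ) ^ (i : ℕ) • fderiv ℝ (fun x => β x (i.removeNth e)) x) (Pi.single i 1))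
        = fun x => 0 := by
          ext x; rw [← show (extDeriv β x) e = 0 by rw [hext]; rfl, extDeriv_apply (hβd x)]; simp [e]
  rw [e0, Fin.sum_univ_succ] at key
  have hz : ∀ (i : Fin n) (c : ℝ), (c = a i ∨ c = b i) →
    (∫ x in Icc ((Fin.cons 0 a : Fin (n+1) → ℝ) ∘ i.succ.succAbove)
      ((Fin.cons 1 b : Fin (n+1) → ℝ) ∘ i.succ.succAbove),
      (-1 : ℝ) ^ (i.succ : ℕ) • β (i.succ.insertNth c x) (i.succ.removeNth e)) = 0 := by
    intro i c hc
    apply MeasureTheory.setIntegral_eq_zero_of_forall_eq_zero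
    intro x hx
    rw [hβv]
    have : bumpF n (Φ (i.succ.insertNth c x)) = 0 := by
      apply bumpF_zero
      set y : Fin (n+1) → ℝ := i.succ.insertNth c x with hy
      have hyi : y i.succ = c := by simp [hy]
      have hyj : ∀ j, y (i.succ.succAbove j) = x j := by intro j; simp [hy]
      have hyall : ∀ k, (Fin.cons 0 a : Fin (n+1) → ℝ) k ≤ y k ∧ y k ≤ (Fin.cons 1 b : Fin (n+1) → ℝ) k := by
        intro k
        rcases Fin.eq_self_or_eq_succAbove i.succ k with h | ⟨j, h⟩
        · subst h; rw [hyi]; simp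
          have := hab i
          rcases hc with rfl | rfl <;> simp [this]
        · subst h; rw [hyj]; exact ⟨hx.1 j, hx.2 j⟩
      apply h
      · exact ⟨fun k => by simpa [Fin.tail] using (hyall k.succ).1, fun k => by simpa [Fin.tail] using (hyall k.succ).2⟩
      · exact ⟨i, by simpa [Fin.tail, hyi] using hc⟩
      · simpa using hyall 0
    simp [this]
  have hface : ∀ (c : ℝ) (R : (Fin n → ℝ) → (Fin n → ℝ)), (∀ x, Φ (Fin.cons c x) = R x) →
     (∫ x in Icc ((Fin.cons 0 a : Fin (n+1) → ℝ) ∘ (0 : Fin (n+1)).succAbove)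
      ((Fin.cons 1 b : Fin (n+1) → ℝ) ∘ (0 : Fin (n+1)).succAbove),
      (-1 : ℝ) ^ ((0 : Fin (n+1)) : ℕ) • β ((0 : Fin (n+1)).insertNth c x) ((0 : Fin (n+1)).removeNth e)) = degI R a b := by
    intro c R hR
    unfold degI
    have e1 : ((Fin.cons 0 a : Fin (n+1) → ℝ) ∘ (0 : Fin (n+1)).succAbove) = a := by ext; simp
    have e2 : ((Fin.cons 1 b : Fin (n+1) → ℝ) ∘ (0 : Fin (n+1)).succAbove) = b := by ext; simp
    rw [e1, e2]
    congr 1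
    ext x
    rw [hβv]
    simp only [Fin.insertNth_zero']
    rw [hR]
    simp only [Fin.val_zero, pow_zero, one_smul]
    congr 2
    ext1 j
    have hR' : R = fun x => Φ (Fin.cons c x) := by ext1 x; rw [hR]
    have hd : HasFDerivAt (fun x : Fin n → ℝ => (Fin.cons c x : Fin (n+1) → ℝ))
      (ContinuousLinearMap.pi (Fin.cons 0 (fun i => ContinuousLinearMap.proj i) : Fin (n+1) → ((Fin n → ℝ) →L[ℝ] ℝ))) x := by
      rw [hasFDerivAt_pi]
      intro i; refine Fin.cases ?_ ?_ i
      · simpa using hasFDerivAt_const c x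
      · intro j; simpa using hasFDerivAt_apply (𝕜 := ℝ) j x
    have := ((hΦs.differentiable (by simp) (Fin.cons c x)).hasFDerivAt.comp x hd).fderiv
    rw [hR']
    erw [this]
    simp only [ContinuousLinearMap.comp_apply]
    congr 1
    ext i
    refine Fin.cases ?_ ?_ i
    · simp [e, Fin.removeNth]
    · intro k; simp [e, Fin.removeNth, Pi.single_apply]
  rw [Finset.sum_eq_zero, add_zero] at key
  · rw [hface _ (fun x => Φ (Fin.cons 1 x)) (by intro x; simp), hface _ (fun x => Φ (Fin.cons 0 x)) (by intro x; simp)] at key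
    simp at key
    linarith
  · intro i _
    rw [hz i _ (Or.inr (by simp)), hz i _ (Or.inl (by simp)), sub_zero]

theorem degI_invariance {n : ℕ} {P Q : (Fin n → ℝ) → (Fin n → ℝ)} {a b : Fin n → ℝ} (hab : a ≤ b)
    (hP : ContDiff ℝ (⊤ : ℕ∞) P) (hQ : ContDiff ℝ (⊤ : ℕ∞) Q)
    (h : ∀ x ∈ Icc a b, (∃ i, x i = a i ∨ x i = b i) → ∀ t ∈ Icc (0:ℝ) 1,
      1/2 ≤ ‖(1 - t) • P x + t • Q x‖) : degI P a b = degI Q a b := by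
  set Φ : (Fin (n+1) → ℝ) → (Fin n → ℝ) := fun y => (1 - y 0) • P (Fin.tail y) + y 0 • Q (Fin.tail y)
    with hΦ
  have htail : ContDiff ℝ (⊤ : ℕ∞) (fun y : Fin (n+1) → ℝ => (Fin.tail y : Fin n → ℝ)) := by
    unfold Fin.tail; fun_prop
  have hΦs : ContDiff ℝ (⊤ : ℕ∞) Φ := by
    have h1 := hP.comp htail
    have h2 := hQ.comp htail
    have h0 : ContDiff ℝ (⊤ : ℕ∞) (fun y : Fin (n+1) → ℝ => y 0) := by fun_prop
    exact ((contDiff_const.sub h0).smul h1).add (h0.smul h2)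
  have := degI_hom hab hΦs (fun y hy hb h0 => h _ hy hb _ h0)
  simpa [hΦ] using this

end

section 
open Set Metric

section
variable {n : ℕ}

theorem cube_eq (c : Fin n → ℝ) {r : ℝ} (hr : 0 ≤ r) :
    closedBall c r = Icc (fun i => c i - r) (fun i => c i + r) := by
  rw [closedBall_pi _ hr]
  simp only [Real.closedBall_eq_Icc]
  exact pi_univ_Icc _ _

theorem cube_sphere (c : Fin n → ℝ) {r : ℝ} (hr : 0 < r) {x : Fin n → ℝ} (hx : x ∈ closedBall c r)
    (h : ∃ i, x i = c i - r ∨ x i = c i + r) : x ∈ sphere c r := by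
  rw [mem_sphere]
  apply le_antisymm hx
  obtain ⟨i, hi⟩ := h
  have := dist_le_pi_dist x c i
  rw [Real.dist_eq] at this
  rcases hi with hi | hi <;> rw [hi] at this <;> simp [abs_of_pos hr] at this <;> exact this

def IsDeg (φ : (Fin n → ℝ) → (Fin n → ℝ)) (c : Fin n → ℝ) (r d : ℝ) : Prop :=
  ∃ (P : (Fin n → ℝ) → (Fin n → ℝ)) (l : ℝ), ContDiff ℝ (⊤ : ℕ∞) P ∧ 0 < l ∧
    (∀ x ∈ sphere c r, 4 ≤ ‖l • φ x‖) ∧ (∀ x ∈ sphere c r, ‖P x - l • φ x‖ ≤ 1) ∧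
    degI P (fun i => c i - r) (fun i => c i + r) = d

theorem IsDeg.unique {φ : (Fin n → ℝ) → (Fin n → ℝ)} {c : Fin n → ℝ} {r d d' : ℝ} (hr : 0 < r)
    (h : IsDeg φ c r d) (h' : IsDeg φ c r d') : d = d' := by
  obtain ⟨P, l, h1, h2, h3, h4, rfl⟩ := h
  obtain ⟨P', l', h1', h2', h3', h4', rfl⟩ := h'
  apply degI_invariance _ h1 h1'
  · intro x hx hb t ht
    rw [← cube_eq c hr.le] at hx
    have hxs := cube_sphere c hr hx hb
    have a1 := h3 x hxs
    have a2 := h4 x hxs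
    have a3 := h3' x hxs
    have a4 := h4' x hxs
    have e : ((1 - t) * l + t * l') • φ x =
      ((1 - t) • P x + t • P' x) - ((1 - t) • (P x - l • φ x) + t • (P' x - l' • φ x)) := by
      simp only [smul_sub, smul_smul, add_smul]; abel
    have b1 : ‖(1 - t) • (P x - l • φ x) + t • (P' x - l' • φ x)‖ ≤ 1 := by
      refine (norm_add_le _ _).trans ?_
      rw [norm_smul, norm_smul, Real.norm_of_nonneg ht.1, Real.norm_of_nonneg (sub_nonneg.2 ht.2)]
      nlinarith [ht.1, ht.2]
    have b2 : 4 ≤ ‖((1 - t) * l + t * l') • φ x‖ := by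
      rw [norm_smul, Real.norm_of_nonneg h2.le] at a1
      rw [norm_smul, Real.norm_of_nonneg h2'.le] at a3
      rw [norm_smul, Real.norm_of_nonneg (by nlinarith [ht.1, ht.2])]
      nlinarith [ht.1, ht.2]
    rw [e] at b2
    have := norm_sub_le ((1 - t) • P x + t • P' x) ((1 - t) • (P x - l • φ x) + t • (P' x - l' • φ x))
    linarith
  · intro i; simp; linarith

open Classical in
noncomputable def Dg (φ : (Fin n → ℝ) → (Fin n → ℝ)) (c : Fin n → ℝ) (r : ℝ) : ℝ :=
  if h : ∃ d, IsDeg φ c r d then h.choose else 0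

theorem IsDeg.eq {φ : (Fin n → ℝ) → (Fin n → ℝ)} {c : Fin n → ℝ} {r d : ℝ} (hr : 0 < r)
    (h : IsDeg φ c r d) : Dg φ c r = d := by
  have h' : ∃ d, IsDeg φ c r d := ⟨d, h⟩
  unfold Dg
  rw [dif_pos h']
  exact h'.choose_spec.unique hr h

theorem exists_scale {X W : Type*} [TopologicalSpace X] [NormedAddCommGroup W] [NormedSpace ℝ W]
    {K : Set X} (hK : IsCompact K) {φ : X → W}
    (hc : ContinuousOn φ K) (h0 : ∀ x ∈ K, φ x ≠ 0) : ∃ l : ℝ, 0 < l ∧ ∀ x ∈ K, 4 ≤ ‖l • φ x‖ := by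
  rcases K.eq_empty_or_nonempty with rfl | hne
  · exact ⟨1, one_pos, by simp⟩
  obtain ⟨x, hx, hm⟩ := hK.exists_isMinOn hne hc.norm
  have hp : 0 < ‖φ x‖ := norm_pos_iff.2 (h0 x hx)
  refine ⟨4 / ‖φ x‖, by positivity, fun y hy => ?_⟩
  have : ‖φ x‖ ≤ ‖φ y‖ := hm hy
  rw [norm_smul, Real.norm_of_nonneg (by positivity), div_mul_eq_mul_div, le_div_iff₀ hp]
  linarith

theorem Dg_hom {φ φ' : (Fin n → ℝ) → (Fin n → ℝ)} {c : Fin n → ℝ} {r : ℝ} (hr : 0 < r)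
    (h : HomOn (sphere c r) {0}ᶜ φ φ') : Dg φ c r = Dg φ' c r := by
  obtain ⟨H, h1, h2, h3, h4⟩ := h
  have hK : IsCompact (Icc (0:ℝ) 1 ×ˢ sphere c r) := isCompact_Icc.prod (isCompact_sphere c r)
  obtain ⟨l, hl, hl4⟩ := exists_scale hK h1 (fun p hp => h2 p.1 hp.1 p.2 hp.2)
  obtain ⟨P, hP, hPl⟩ := smooth_approx hK.isClosed (h1.const_smul l) one_pos
  have key : ∀ t ∈ Icc (0:ℝ) 1, ∀ ψ : (Fin n → ℝ) → (Fin n → ℝ), (∀ x ∈ sphere c r, H (t, x) = ψ x) →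
      Dg ψ c r = degI (fun x => P (t, x)) (fun i => c i - r) (fun i => c i + r) := by
    intro t ht ψ hψ
    apply IsDeg.eq hr
    refine ⟨fun x => P (t, x), l, hP.comp (contDiff_const.prodMk contDiff_id), hl, ?_, ?_, rfl⟩
    · intro x hx; rw [← hψ x hx]; exact hl4 (t, x) ⟨ht, hx⟩
    · intro x hx; rw [← hψ x hx]; exact (hPl (t, x) ⟨ht, hx⟩).le
  rw [key 0 (by simp) φ h3, key 1 (by simp) φ' h4]
  have htail : ContDiff ℝ (⊤ : ℕ∞) (fun y : Fin (n+1) → ℝ => (Fin.tail y : Fin n → ℝ)) := by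
    unfold Fin.tail; fun_prop
  have h0 : ContDiff ℝ (⊤ : ℕ∞) (fun y : Fin (n+1) → ℝ => y 0) := by fun_prop
  have := degI_hom (Φ := fun y => P (y 0, Fin.tail y)) (a := fun i => c i - r) (b := fun i => c i + r)
    (by intro i; simp; linarith) (hP.comp (h0.prodMk htail)) ?_
  · simpa using this
  · intro y hy hb hy0
    rw [← cube_eq c hr.le] at hy
    have hxs := cube_sphere c hr hy hb
    have a1 := hl4 (y 0, Fin.tail y) ⟨hy0, hxs⟩
    have a2 := hPl (y 0, Fin.tail y) ⟨hy0, hxs⟩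
    have := norm_sub_norm_le (l • H (y 0, Fin.tail y)) (P (y 0, Fin.tail y))
    rw [norm_sub_rev] at this
    simp only [Pi.smul_apply] at a2
    linarith

theorem Jd_continuous {P : (Fin n → ℝ) → (Fin n → ℝ)} (hP : ContDiff ℝ (⊤ : ℕ∞) P) :
    Continuous (Jd P) := by
  unfold Jd
  apply (detForm n).cont.comp
  apply continuous_pi
  intro j
  exact (hP.continuous_fderiv (by simp)).clm_apply continuous_const

theorem Dg_additive {ι : Type*} (s : Finset ι) {φ : (Fin n → ℝ) → (Fin n → ℝ)} {c₀ : Fin n → ℝ}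
    {r₀ : ℝ} (hr₀ : 0 < r₀) (c : ι → Fin n → ℝ) (r : ι → ℝ) (hr : ∀ i ∈ s, 0 < r i)
    (hsub : ∀ i ∈ s, closedBall (c i) (r i) ⊆ ball c₀ r₀)
    (hdis : ∀ i ∈ s, ∀ j ∈ s, i ≠ j → Disjoint (closedBall (c i) (r i)) (closedBall (c j) (r j)))
    (hc : ContinuousOn φ (closedBall c₀ r₀ \ ⋃ i ∈ s, ball (c i) (r i)))
    (h0 : ∀ x ∈ closedBall c₀ r₀ \ ⋃ i ∈ s, ball (c i) (r i), φ x ≠ 0) :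
    Dg φ c₀ r₀ = ∑ i ∈ s, Dg φ (c i) (r i) := by
  set K := closedBall c₀ r₀ \ ⋃ i ∈ s, ball (c i) (r i) with hKdef
  have hK : IsCompact K := (isCompact_closedBall c₀ r₀).diff
    (isOpen_biUnion fun i _ => isOpen_ball)
  obtain ⟨l, hl, hl4⟩ := exists_scale hK hc h0
  obtain ⟨P, hP, hPl⟩ := smooth_approx hK.isClosed (hc.const_smul l) one_pos
  have hz : ∀ x ∈ K, bumpF n (P x) = 0 := by
    intro x hx
    apply bumpF_zero
    have a1 := hl4 x hx
    have a2 := hPl x hx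
    have := norm_sub_norm_le (l • φ x) (P x)
    rw [norm_sub_rev] at this
    simp only [Pi.smul_apply] at a2
    linarith
  have hs0 : sphere c₀ r₀ ⊆ K := by
    intro x hx
    refine ⟨sphere_subset_closedBall hx, ?_⟩
    simp only [mem_iUnion, not_exists]
    intro i hi hxi
    have := hsub i hi (ball_subset_closedBall hxi)
    rw [mem_ball] at this; rw [mem_sphere] at hx; linarith
  have hs : ∀ i ∈ s, sphere (c i) (r i) ⊆ K := by
    intro i hi x hx
    refine ⟨ball_subset_closedBall (hsub i hi (sphere_subset_closedBall hx)), ?_⟩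
    simp only [mem_iUnion, not_exists]
    intro j hj hxj
    by_cases hij : i = j
    · subst hij; rw [mem_ball] at hxj; rw [mem_sphere] at hx; linarith
    · exact disjoint_left.1 (hdis i hi j hj hij) (sphere_subset_closedBall hx) (ball_subset_closedBall hxj)
  have key : ∀ c r, 0 < r → sphere c r ⊆ K → Dg φ c r =
      ∫ x in closedBall c r, bumpF n (P x) * Jd P x := by
    intro c r hr hs
    rw [cube_eq c hr.le]
    apply IsDeg.eq hr
    exact ⟨P, l, hP, hl, fun x hx => hl4 x (hs hx), fun x hx => (hPl x (hs hx)).le, rfl⟩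
  have hcont : Continuous (fun x => bumpF n (P x) * Jd P x) :=
    ((bumpF_contDiff n).continuous.comp hP.continuous).mul (Jd_continuous hP)
  rw [key _ _ hr₀ hs0, Finset.sum_congr rfl (fun i hi => key _ _ (hr i hi) (hs i hi))]
  rw [← MeasureTheory.integral_biUnion_finset s (fun i _ => measurableSet_closedBall)
    (fun i hi j hj hij => hdis i hi j hj hij)
    (fun i _ => hcont.continuousOn.integrableOn_compact (isCompact_closedBall _ _))]
  apply MeasureTheory.setIntegral_eq_of_subset_of_forall_diff_eq_zero measurableSet_closedBall
  · exact iUnion₂_subset fun i hi => (hsub i hi).trans ball_subset_closedBall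
  · rintro x ⟨hx, hx'⟩
    rw [hz x ⟨hx, fun h => hx' ?_⟩, zero_mul]
    exact (iUnion₂_mono fun i _ => ball_subset_closedBall) h

theorem Dg_zero {φ : (Fin n → ℝ) → (Fin n → ℝ)} {c₀ : Fin n → ℝ}
    {r₀ : ℝ} (hr₀ : 0 < r₀) (hc : ContinuousOn φ (closedBall c₀ r₀))
    (h0 : ∀ x ∈ closedBall c₀ r₀, φ x ≠ 0) : Dg φ c₀ r₀ = 0 := by
  have := Dg_additive (ι := Empty) ∅ hr₀ (fun _ => 0) (fun _ => 0) (by simp) (by simp) (by simp)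
    (φ := φ) (by simpa using hc) (by simpa using h0)
  simpa using this

/-- A smooth map with nonnegative, somewhere positive Jacobian near a zero has nonzero degree. -/
theorem Dg_ne_zero {P : (Fin n → ℝ) → (Fin n → ℝ)} (hP : ContDiff ℝ (⊤ : ℕ∞) P) {r : ℝ} (hr : 0 < r)
    (hP4 : ∀ x ∈ sphere 0 r, 4 ≤ ‖P x‖) (σ : ℝ) (hσ : ∀ x, 0 ≤ σ * Jd P x)
    {x₀ : Fin n → ℝ} (hx₀ : x₀ ∈ ball 0 r) (hPx : ‖P x₀‖ < 1/2) (hJ : 0 < σ * Jd P x₀) :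
    Dg P 0 r ≠ 0 := by
  have : Dg P 0 r = ∫ x in closedBall 0 r, bumpF n (P x) * Jd P x := by
    rw [cube_eq 0 hr.le]
    exact IsDeg.eq hr ⟨P, 1, hP, one_pos, by simpa using hP4, by simp, rfl⟩
  rw [this]
  intro h
  have hcont : Continuous (fun x => σ * (bumpF n (P x) * Jd P x)) :=
    continuous_const.mul (((bumpF_contDiff n).continuous.comp hP.continuous).mul (Jd_continuous hP))
  have h2 : ∫ x in closedBall 0 r, σ * (bumpF n (P x) * Jd P x) = 0 := by
    rw [MeasureTheory.integral_const_mul, h, mul_zero]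
  have h3 : 0 < ∫ x in closedBall 0 r, σ * (bumpF n (P x) * Jd P x) := by
    rw [MeasureTheory.setIntegral_pos_iff_support_of_nonneg_ae]
    · have ho : IsOpen ((Function.support fun x => σ * (bumpF n (P x) * Jd P x)) ∩ ball 0 r) :=
        hcont.isOpen_support.inter isOpen_ball
      have hne : ((Function.support fun x => σ * (bumpF n (P x) * Jd P x)) ∩ ball 0 r).Nonempty := by
        refine ⟨x₀, ?_, hx₀⟩
        rw [Function.mem_support]
        have := bumpF_pos hPx
        have h' : 0 < bumpF n (P x₀) * (σ * Jd P x₀) := mul_pos this hJ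
        intro h''; rw [mul_left_comm] at h''; linarith
      exact (ho.measure_pos _ hne).trans_le (MeasureTheory.measure_mono
        (inter_subset_inter_right _ ball_subset_closedBall))
    · exact Filter.Eventually.of_forall fun x => by
        have := mul_nonneg (bumpF_nonneg n (P x)) (hσ x)
        show 0 ≤ σ * (bumpF n (P x) * Jd P x)
        rw [mul_left_comm]; exact this
    · exact hcont.continuousOn.integrableOn_compact (isCompact_closedBall _ _)
  linarith
end

end

section 
open Set Metric

noncomputable def zc (ε : ℝ) : (Fin 4 → ℝ) →L[ℝ] ℂ :=
  (ContinuousLinearMap.proj (R := ℝ) (φ := fun _ : Fin 4 => ℝ) 0).smulRight (1:ℂ) +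
  (ContinuousLinearMap.proj (R := ℝ) (φ := fun _ : Fin 4 => ℝ) 1).smulRight ((ε:ℂ) * Complex.I)

theorem zc_apply (ε : ℝ) (x : Fin 4 → ℝ) : zc ε x = x 0 + (ε * x 1 : ℝ) * Complex.I := by
  simp [zc]; ring

noncomputable def zModel (m : ℕ) (ε : ℝ) (x : Fin 4 → ℝ) : Fin 4 → ℝ :=
  ![(zc ε x ^ m).re, (zc ε x ^ m).im, x 2, x 3]

theorem zModel_hasFDeriv (m : ℕ) (ε : ℝ) (x : Fin 4 → ℝ) : ∀ v, fderiv ℝ (zModel m ε) x v =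
    ![((m : ℂ) * zc ε x ^ (m-1) * zc ε v).re, ((m : ℂ) * zc ε x ^ (m-1) * zc ε v).im, v 2, v 3] := by
  have h1 : HasFDerivAt (fun x => zc ε x ^ m) (((m : ℂ) * zc ε x ^ (m-1)) • zc ε) x := by
    have := (hasDerivAt_pow m (zc ε x)).hasFDerivAt.restrictScalars ℝ |>.comp x (zc ε).hasFDerivAt
    have e : (((m : ℂ) * zc ε x ^ (m-1)) • zc ε) = (ContinuousLinearMap.restrictScalars ℝ
      (ContinuousLinearMap.toSpanSingleton ℂ ((m:ℂ) * (zc ε) x ^ (m - 1)))) ∘SL zc ε := by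
      ext v
      simp [mul_comm]
    rw [e]
    exact this
  have h2 : HasFDerivAt (zModel m ε) (ContinuousLinearMap.pi
    ![Complex.reCLM.comp (((m : ℂ) * zc ε x ^ (m-1)) • zc ε),
      Complex.imCLM.comp (((m : ℂ) * zc ε x ^ (m-1)) • zc ε),
      ContinuousLinearMap.proj 2, ContinuousLinearMap.proj 3]) x := by
    rw [hasFDerivAt_pi]
    intro i
    fin_cases i
    · exact Complex.reCLM.hasFDerivAt.comp x h1
    · exact Complex.imCLM.hasFDerivAt.comp x h1
    · exact hasFDerivAt_apply (𝕜 := ℝ) 2 x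
    · exact hasFDerivAt_apply (𝕜 := ℝ) 3 x
  intro v
  rw [h2.fderiv]
  ext i
  fin_cases i <;> simp

theorem zModel_contDiff (m : ℕ) (ε : ℝ) : ContDiff ℝ (⊤ : ℕ∞) (zModel m ε) := by
  have h1 : ContDiff ℝ (⊤ : ℕ∞) (fun x => zc ε x ^ m) := (zc ε).contDiff.pow m
  rw [contDiff_pi]
  intro i
  fin_cases i
  · exact Complex.reCLM.contDiff.comp h1
  · exact Complex.imCLM.contDiff.comp h1
  · exact contDiff_apply (𝕜 := ℝ) (E := ℝ) 2
  · exact contDiff_apply (𝕜 := ℝ) (E := ℝ) 3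

theorem zModel_Jd (m : ℕ) (ε : ℝ) (x : Fin 4 → ℝ) :
    Jd (zModel m ε) x = ε * Complex.normSq ((m : ℂ) * zc ε x ^ (m-1)) := by
  unfold Jd
  rw [detForm_apply]
  simp only [zModel_hasFDeriv]
  set w := (m : ℂ) * zc ε x ^ (m-1)
  rw [Matrix.det_succ_row _ 3, Fin.sum_univ_four]
  simp [Matrix.det_fin_three, zc_apply, Fin.succAbove, Complex.normSq_apply]
  ring

theorem zModel_norm (m : ℕ) (hm : 1 ≤ m) (ε : ℝ) (hε : |ε| = 1) {x : Fin 4 → ℝ} (hx : x ∈ sphere 0 8) :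
    4 ≤ ‖zModel m ε x‖ := by
  rw [mem_sphere_zero_iff_norm] at hx
  by_contra hlt
  push Not at hlt
  have c0 := (norm_le_pi_norm (zModel m ε x) 0).trans hlt.le
  have c1 := (norm_le_pi_norm (zModel m ε x) 1).trans hlt.le
  have c2 := (norm_le_pi_norm (zModel m ε x) 2).trans hlt.le
  have c3 := (norm_le_pi_norm (zModel m ε x) 3).trans hlt.le
  simp only [zModel, Matrix.cons_val, Real.norm_eq_abs] at c0 c1 c2 c3
  have hle : ‖zc ε x ^ m‖ < 8 + 1/2 := (Complex.norm_le_abs_re_add_abs_im _).trans_lt (by linarith)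
  have hz : 8 ≤ ‖zc ε x‖ ∧ (‖zc ε x‖ = 8 ∨ True) := by
    refine ⟨?_, Or.inr trivial⟩
    by_contra hz
    push Not at hz
    have : ‖x‖ < 8 := by
      rw [pi_norm_lt_iff (by norm_num)]
      have r1 := Complex.abs_re_le_norm (zc ε x)
      have r2 := Complex.abs_im_le_norm (zc ε x)
      rw [zc_apply] at r1 r2 hz
      simp [abs_mul, hε] at r1 r2
      rw [Complex.ofReal_mul] at hz
      intro i; fin_cases i <;> simp only [Real.norm_eq_abs]
      · exact r1.trans_lt hz
      · exact r2.trans_lt hz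
      · exact c2.trans_lt (by norm_num)
      · exact c3.trans_lt (by norm_num)
    linarith
  have hz := hz.1
  have hp : ‖zc ε x‖ ^ 1 ≤ ‖zc ε x‖ ^ m := pow_le_pow_right₀ (by linarith) hm
  rw [norm_pow] at hle
  have hn : ‖zc ε x ^ m‖ ^ 2 < 64 := by
    rw [← Complex.normSq_eq_norm_sq, Complex.normSq_apply]
    have := abs_le.1 c0; have := abs_le.1 c1
    nlinarith
  rw [norm_pow] at hn
  nlinarith

theorem zModel_Dg (m : ℕ) (hm : 1 ≤ m) (ε : ℝ) (hε : |ε| = 1) : Dg (zModel m ε) 0 8 ≠ 0 := by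
  have hε2 : ε * ε = 1 := by rw [← abs_mul_abs_self, hε]; norm_num
  have hz : zc ε ![1/4, 0, 0, 0] = ((1/4 : ℝ) : ℂ) := by rw [zc_apply]; simp
  apply Dg_ne_zero (zModel_contDiff m ε) (by norm_num) (fun x hx => zModel_norm m hm ε hε hx) ε
    (x₀ := ![1/4, 0, 0, 0])
  · intro x
    rw [zModel_Jd, ← mul_assoc, hε2, one_mul]; exact Complex.normSq_nonneg _
  · rw [mem_ball_zero_iff, pi_norm_lt_iff (by norm_num)]
    intro i; fin_cases i <;> norm_num
  · rw [pi_norm_lt_iff (by norm_num)]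
    unfold zModel
    rw [hz, ← Complex.ofReal_pow]
    intro i; fin_cases i
    · simp only [Fin.zero_eta, Matrix.cons_val_zero, Complex.ofReal_re, Real.norm_eq_abs]
      rw [abs_of_nonneg (by positivity)]
      calc (1/4 : ℝ) ^ m ≤ (1/4)^1 := pow_le_pow_of_le_one (by norm_num) (by norm_num) hm
        _ < 1/2 := by norm_num
    · simp only [Fin.mk_one, Matrix.cons_val_one, Complex.ofReal_im]; norm_num
    · simp
    · simp
  · rw [zModel_Jd, ← mul_assoc, hε2, one_mul, Complex.normSq_pos, hz]
    have : (m:ℂ) ≠ 0 := by exact_mod_cast (by omega : m ≠ 0)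
    apply mul_ne_zero this
    apply pow_ne_zero
    norm_num

end

section 
open Set Metric

/-- continuous logarithm on a simply connected locally path connected space -/
theorem exists_clog {A : Type*} [TopologicalSpace A] [SimplyConnectedSpace A]
    [LocallyPathConnectedSpace A] {c : A → ℂ} (hc : Continuous c) (h0 : ∀ a, c a ≠ 0) :
    ∃ g : A → ℂ, Continuous g ∧ ∀ a, Complex.exp (g a) = c a := by
  obtain ⟨a₀⟩ : Nonempty A := inferInstance
  let f : C(A, {z : ℂ // z ≠ 0}) := ⟨fun a => ⟨c a, h0 a⟩, by fun_prop⟩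
  obtain ⟨F, ⟨_, hF⟩, -⟩ := Complex.isCoveringMap_exp.existsUnique_continuousMap_lifts f a₀
    (Complex.log (c a₀)) (Subtype.ext (Complex.exp_log (h0 a₀)))
  exact ⟨F, F.continuous, fun a => congrArg Subtype.val (congrFun hF a)⟩

theorem continuousOn_of_comp_exp {Y : Type*} [TopologicalSpace Y] {u : ℂ → Y}
    (h : Continuous (fun w => u (Complex.exp w))) : ContinuousOn u {0}ᶜ := by
  rw [continuousOn_iff_continuous_restrict]
  exact (Complex.isAddQuotientCoveringMap_exp).toIsQuotientMap.continuous_iff.2 h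

theorem int_const_of_continuous {A : Type*} [TopologicalSpace A] [PreconnectedSpace A] {g : A → ℂ}
    (hg : Continuous g) (h : ∀ a, ∃ m : ℤ, g a = m * (2 * Real.pi * Complex.I)) (a b : A) : g a = g b := by
  choose m hm using h
  have hr : (2 * Real.pi * Complex.I : ℂ) ≠ 0 := Complex.two_pi_I_ne_zero
  have hc : Continuous (fun a => ((m a : ℤ) : ℝ)) := by
    have : (fun a => ((m a : ℤ) : ℝ)) = fun a => (g a / (2 * Real.pi * Complex.I)).re := by
      ext a; rw [hm a, mul_div_cancel_right₀ _ hr]; simp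
    rw [this]; fun_prop
  have hm' : Continuous m := Int.isClosedEmbedding_coe_real.isEmbedding.continuous_iff.2 hc
  rw [hm a, hm b, PreconnectedSpace.constant ‹_› hm' (x := a) (y := b)]

theorem zpow_homotopy {k : ℂ → ℂ} (hk : ContinuousOn k {0}ᶜ) (h0 : ∀ z ≠ 0, k z ≠ 0) :
    ∃ m : ℤ, HomOn {0}ᶜ {0}ᶜ k (fun z => z ^ m) := by
  obtain ⟨g, hg, hgk⟩ := exists_clog (c := fun w => k (Complex.exp w))
    (hk.comp_continuous Complex.continuous_exp (fun w => Complex.exp_ne_zero w))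
    (fun w => h0 _ (Complex.exp_ne_zero w))
  have h1 : ∀ w, ∃ m : ℤ, g (w + 2 * Real.pi * Complex.I) - g w = m * (2 * Real.pi * Complex.I) := by
    intro w
    have : Complex.exp (g (w + 2 * Real.pi * Complex.I)) = Complex.exp (g w) := by
      rw [hgk, hgk, Complex.exp_periodic w]
    obtain ⟨m, hm⟩ := Complex.exp_eq_exp_iff_exists_int.1 this
    exact ⟨m, by rw [hm]; ring⟩
  obtain ⟨m, hm⟩ := h1 0
  have h2 : ∀ w, g (w + 2 * Real.pi * Complex.I) - g w = m * (2 * Real.pi * Complex.I) := by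
    intro w
    rw [int_const_of_continuous (g := fun w => g (w + 2 * Real.pi * Complex.I) - g w) (by fun_prop) h1 w 0]
    exact hm
  set v : ℂ → ℂ := fun w => g w - m * w with hv
  have hvp : Function.Periodic v (2 * Real.pi * Complex.I) := by
    intro w
    have := h2 w
    simp only [hv]
    linear_combination this
  have hvp' : ∀ w, v (Complex.log (Complex.exp w)) = v w := by
    intro w
    have : Complex.exp (Complex.log (Complex.exp w)) = Complex.exp w := Complex.exp_log (Complex.exp_ne_zero w)
    obtain ⟨j, hj⟩ := Complex.exp_eq_exp_iff_exists_int.1 this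
    rw [hj]
    exact (hvp.int_mul j) w
  have hu : ContinuousOn (fun z => v (Complex.log z)) {0}ᶜ := by
    apply continuousOn_of_comp_exp
    simp only [hvp']
    fun_prop
  have hku : ∀ z ∈ ({0}ᶜ : Set ℂ), k z = z ^ m * Complex.exp (v (Complex.log z)) := by
    intro z hz
    have := hgk (Complex.log z)
    rw [Complex.exp_log hz] at this
    simp only [hv]
    rw [← this, Complex.exp_sub, Complex.exp_int_mul, Complex.exp_log hz]
    field_simp [zpow_ne_zero m hz]
  have hzm : ContinuousOn (fun z : ℂ => z ^ m) {0}ᶜ := fun z hz =>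
    (continuousAt_zpow₀ z m (Or.inl hz)).continuousWithinAt
  refine ⟨m, fun p => p.2 ^ m * Complex.exp ((1 - p.1) * v (Complex.log p.2)), ?_, ?_, ?_, ?_⟩
  · apply ContinuousOn.mul
    · exact hzm.comp continuousOn_snd fun p hp => hp.2
    · apply Complex.continuous_exp.comp_continuousOn
      apply ContinuousOn.mul (by fun_prop)
      exact hu.comp continuousOn_snd fun p hp => hp.2
  · intro t _ z hz
    exact mul_ne_zero (zpow_ne_zero m hz) (Complex.exp_ne_zero _)
  · intro z hz; simp [hku z hz]
  · intro z hz; simp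

end

section 
open Set Metric

abbrev V2 := ℝ × ℝ
abbrev V3 := V2 × ℝ
abbrev V4 := V3 × ℝ

noncomputable def eVl : V4 ≃ₗ[ℝ] (Fin 4 → ℝ) where
  toFun x := ![x.1.1.1, x.1.1.2, x.1.2, x.2]
  invFun y := (((y 0, y 1), y 2), y 3)
  map_add' x y := by ext i; fin_cases i <;> simp
  map_smul' c x := by ext i; fin_cases i <;> simp
  left_inv x := by simp
  right_inv y := by ext i; fin_cases i <;> simp

noncomputable def eV : V4 ≃ₗᵢ[ℝ] (Fin 4 → ℝ) where
  toLinearEquiv := eVl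
  norm_map' x := by
    show ‖(![x.1.1.1, x.1.1.2, x.1.2, x.2] : Fin 4 → ℝ)‖ = _
    apply le_antisymm
    · rw [pi_norm_le_iff_of_nonneg (norm_nonneg _)]
      intro i
      fin_cases i
      · exact (norm_fst_le x.1.1).trans ((norm_fst_le x.1).trans (norm_fst_le x))
      · exact (norm_snd_le x.1.1).trans ((norm_fst_le x.1).trans (norm_fst_le x))
      · exact (norm_snd_le x.1).trans (norm_fst_le x)
      · exact norm_snd_le x
    · have h := fun i => norm_le_pi_norm (![x.1.1.1, x.1.1.2, x.1.2, x.2] : Fin 4 → ℝ) i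
      rw [Prod.norm_def, Prod.norm_def, Prod.norm_def]
      exact max_le (max_le (max_le (h 0) (h 1)) (h 2)) (h 3)

theorem eV_apply (x : V4) : eV x = ![x.1.1.1, x.1.1.2, x.1.2, x.2] := rfl
theorem eV_symm_apply (y : Fin 4 → ℝ) : eV.symm y = (((y 0, y 1), y 2), y 3) := rfl

/-- degree on `V4` -/
noncomputable def vd (φ : V4 → V4) (c : V4) (r : ℝ) : ℝ := Dg (eV ∘ φ ∘ eV.symm) (eV c) r

theorem eV_symm_sphere {c : V4} {r : ℝ} {y : Fin 4 → ℝ} : eV.symm y ∈ sphere c r ↔ y ∈ sphere (eV c) r := by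
  rw [mem_sphere, mem_sphere, ← eV.dist_map, eV.apply_symm_apply]
theorem eV_symm_ball {c : V4} {r : ℝ} {y : Fin 4 → ℝ} : eV.symm y ∈ ball c r ↔ y ∈ ball (eV c) r := by
  rw [mem_ball, mem_ball, ← eV.dist_map, eV.apply_symm_apply]
theorem eV_symm_closedBall {c : V4} {r : ℝ} {y : Fin 4 → ℝ} :
    eV.symm y ∈ closedBall c r ↔ y ∈ closedBall (eV c) r := by
  rw [mem_closedBall, mem_closedBall, ← eV.dist_map, eV.apply_symm_apply]

theorem vd_hom {φ φ' : V4 → V4} {c : V4} {r : ℝ} (hr : 0 < r)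
    (h : HomOn (sphere c r) {0}ᶜ φ φ') : vd φ c r = vd φ' c r := by
  apply Dg_hom hr
  have h1 := h.comp_right (k := eV.symm) (Z' := sphere (eV c) r) eV.symm.continuous.continuousOn
    (fun x hx => eV_symm_sphere.2 hx)
  exact h1.comp_left (k := eV) eV.continuous.continuousOn (fun x hx => by simpa using hx)

theorem vd_additive {ι : Type*} (s : Finset ι) {φ : V4 → V4} {c₀ : V4}
    {r₀ : ℝ} (hr₀ : 0 < r₀) (c : ι → V4) (r : ι → ℝ) (hr : ∀ i ∈ s, 0 < r i)
    (hsub : ∀ i ∈ s, closedBall (c i) (r i) ⊆ ball c₀ r₀)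
    (hdis : ∀ i ∈ s, ∀ j ∈ s, i ≠ j → Disjoint (closedBall (c i) (r i)) (closedBall (c j) (r j)))
    (hc : ContinuousOn φ (closedBall c₀ r₀ \ ⋃ i ∈ s, ball (c i) (r i)))
    (h0 : ∀ x ∈ closedBall c₀ r₀ \ ⋃ i ∈ s, ball (c i) (r i), φ x ≠ 0) :
    vd φ c₀ r₀ = ∑ i ∈ s, vd φ (c i) (r i) := by
  have hmem : ∀ y ∈ closedBall (eV c₀) r₀ \ ⋃ i ∈ s, ball (eV (c i)) (r i),
      eV.symm y ∈ closedBall c₀ r₀ \ ⋃ i ∈ s, ball (c i) (r i) := by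
    rintro y ⟨hy, hy'⟩
    refine ⟨eV_symm_closedBall.2 hy, ?_⟩
    simp only [mem_iUnion, not_exists] at hy' ⊢
    exact fun i hi hb => hy' i hi (eV_symm_ball.1 hb)
  apply Dg_additive s hr₀ (fun i => eV (c i)) r hr
  · intro i hi y hy
    exact eV_symm_ball.1 (hsub i hi (eV_symm_closedBall.2 hy))
  · intro i hi j hj hij
    rw [disjoint_left]
    intro y hy hy'
    exact disjoint_left.1 (hdis i hi j hj hij) (eV_symm_closedBall.2 hy) (eV_symm_closedBall.2 hy')
  · exact eV.continuous.comp_continuousOn (hc.comp eV.symm.continuous.continuousOn hmem)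
  · intro y hy
    simpa using h0 _ (hmem y hy)

theorem hat_gen {X W : Type*} [TopologicalSpace X] [NormedAddCommGroup W] [NormedSpace ℝ W]
    {Z : Set X} {a : X → ℝ} {h : X → W} (ha : ContinuousOn a Z)
    (hh : ContinuousOn h (Z ∩ {x | a x ≠ 0})) (h0 : ∀ x ∈ Z, a x ≠ 0 → h x ≠ 0) :
    ContinuousOn (fun x => (a x / ‖h x‖) • h x) Z := by
  intro x hx
  by_cases hax : a x = 0
  · have hb : ∀ y, ‖(a y / ‖h y‖) • h y‖ ≤ ‖a y‖ := by
      intro y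
      rw [norm_smul, norm_div, norm_norm]
      by_cases hy : ‖h y‖ = 0
      · rw [hy]; simp
      · rw [div_mul_cancel₀ _ hy]
    have h1 : Filter.Tendsto (fun y => ‖a y‖) (nhdsWithin x Z) (nhds 0) := by
      have := (ha x hx).norm
      unfold ContinuousWithinAt at this
      simpa [hax] using this
    unfold ContinuousWithinAt
    simp only [hax, zero_div, zero_smul]
    exact squeeze_zero_norm hb h1
  · have h1 : {y | a y ≠ 0} ∈ nhdsWithin x Z := (ha x hx).eventually_ne hax
    have h2 : ContinuousWithinAt h Z x := by
      have := hh x ⟨hx, hax⟩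
      rwa [continuousWithinAt_inter' h1] at this
    exact ((ha x hx).div h2.norm (by simpa using h0 x hx hax)).smul h2

section
variable {E W : Type*} [NormedAddCommGroup E] [NormedSpace ℝ E] [NormedAddCommGroup W] [NormedSpace ℝ W]

theorem susp_ne {h : E → W} (h0 : ∀ x ≠ 0, h x ≠ 0) {z : E × ℝ} (hz : z ≠ 0) : susp h z ≠ 0 := by
  intro hh
  apply hz
  unfold susp at hh
  rw [Prod.mk_eq_zero] at hh
  have : z.1 = 0 := by
    by_contra hne
    have := h0 _ hne
    simp [hne, this] at hh
  exact Prod.ext this hh.2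

theorem susp_hom {h h' : E → W} (hh : HomOn {0}ᶜ {0}ᶜ h h') : HomOn {0}ᶜ {0}ᶜ (susp h) (susp h') := by
  obtain ⟨H, h1, h2, h3, h4⟩ := hh
  have hp : ∀ p : ℝ × (E × ℝ), p ∈ Icc (0:ℝ) 1 ×ˢ ({0}ᶜ : Set (E × ℝ)) ∩ {x | ‖x.2.1‖ ≠ 0} →
    (p.1, p.2.1) ∈ Icc (0:ℝ) 1 ×ˢ ({0}ᶜ : Set E) := by
    rintro p ⟨hp1, hp2⟩
    exact ⟨hp1.1, by simpa using hp2⟩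
  refine ⟨fun p => susp (fun x => H (p.1, x)) p.2, ?_, ?_, ?_, ?_⟩
  · unfold susp
    apply ContinuousOn.prodMk _ (by fun_prop)
    apply hat_gen (a := fun p : ℝ × (E × ℝ) => ‖p.2.1‖) (h := fun p => H (p.1, p.2.1)) (by fun_prop)
    · exact h1.comp (by fun_prop) hp
    · intro p hp hne
      exact h2 p.1 hp.1 p.2.1 (by simpa using hne)
  · intro t ht z hz
    exact susp_ne (fun x hx => h2 t ht x hx) hz
  · intro z hz
    by_cases hz1 : z.1 = 0
    · simp [susp, hz1]
    · simp [susp, h3 z.1 hz1]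
  · intro z hz
    by_cases hz1 : z.1 = 0
    · simp [susp, hz1]
    · simp [susp, h4 z.1 hz1]

theorem susp_const {w : W} (hw : w ≠ 0) : HomOn ({0}ᶜ : Set (E × ℝ)) {0}ᶜ (susp (fun _ : E => w)) (fun _ => (w, 0)) := by
  apply HomOn.linear
  · unfold susp; fun_prop (disch := simpa using hw)
  · fun_prop
  · intro t ht z hz h
    simp only [susp, Prod.smul_mk, Prod.mk_add_mk, smul_zero, add_zero, smul_smul, ← add_smul] at h
    rw [mem_singleton_iff, Prod.mk_eq_zero, smul_eq_zero, or_iff_left hw] at h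
    obtain ⟨ha, hb⟩ := h
    have hn : 0 < ‖w‖ := norm_pos_iff.2 hw
    have c1 : 0 ≤ (1 - t) * (‖z.1‖ / ‖w‖) := mul_nonneg (by linarith [ht.2]) (by positivity)
    have c2 : t = 0 := by linarith [ht.1]
    subst c2
    simp [hn.ne'] at ha hb
    exact hz (Prod.ext ha hb)

theorem null_extends {Y : Type*} [TopologicalSpace Y] {T : Set Y} {φ : E → Y} {w : Y}
    (h : HomOn (sphere (0:E) 1) T φ (fun _ => w)) (hw : w ∈ T) :
    ∃ ψ : E → Y, ContinuousOn ψ (closedBall 0 1) ∧ (∀ x ∈ closedBall (0:E) 1, ψ x ∈ T) ∧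
      ∀ x ∈ sphere (0:E) 1, ψ x = φ x := by
  obtain ⟨H, h1, h2, h3, h4⟩ := h
  have hs : ∀ x : E, x ≠ 0 → ‖x‖⁻¹ • x ∈ sphere (0:E) 1 := by
    intro x hx
    rw [mem_sphere_zero_iff_norm, norm_smul, norm_inv, norm_norm, inv_mul_cancel₀ (norm_ne_zero_iff.2 hx)]
  have hmn : ∀ x ∈ closedBall (0:E) 1, min 1 (2 - 2 * ‖x‖) ∈ Icc (0:ℝ) 1 := by
    intro x hx
    rw [mem_closedBall_zero_iff] at hx
    exact ⟨le_min zero_le_one (by linarith), min_le_left _ _⟩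
  classical
  refine ⟨fun x => if x = 0 then w else H (min 1 (2 - 2 * ‖x‖), ‖x‖⁻¹ • x), ?_, ?_, ?_⟩
  · intro x hx
    by_cases hx0 : x = 0
    · have : (fun x => if x = 0 then w else H (min 1 (2 - 2 * ‖x‖), ‖x‖⁻¹ • x)) =ᶠ[nhdsWithin x (closedBall 0 1)] fun _ => w := by
        apply Filter.Eventually.filter_mono nhdsWithin_le_nhds
        rw [hx0]
        filter_upwards [ball_mem_nhds (0:E) (by norm_num : (0:ℝ) < 1/2)] with y hy
        rw [mem_ball_zero_iff] at hy
        by_cases hy0 : y = 0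
        · simp [hy0]
        · rw [if_neg hy0, min_eq_left (by linarith), h4 _ (hs y hy0)]
      exact continuousWithinAt_const.congr_of_eventuallyEq this (by simp [hx0])
    · have : (fun x => if x = 0 then w else H (min 1 (2 - 2 * ‖x‖), ‖x‖⁻¹ • x)) =ᶠ[nhdsWithin x (closedBall 0 1)]
         fun x => H (min 1 (2 - 2 * ‖x‖), ‖x‖⁻¹ • x) := by
        apply Filter.Eventually.filter_mono nhdsWithin_le_nhds
        filter_upwards [isOpen_ne.mem_nhds hx0] with y hy
        rw [if_neg hy]
      refine ContinuousWithinAt.congr_of_eventuallyEq ?_ this (by simp [hx0])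
      have c : ContinuousOn (fun x => H (min 1 (2 - 2 * ‖x‖), ‖x‖⁻¹ • x)) (closedBall (0:E) 1 ∩ {x | x ≠ 0}) := by
        apply h1.comp
        · apply ContinuousOn.prodMk (by fun_prop)
          apply ContinuousOn.smul _ continuousOn_id
          exact continuous_norm.continuousOn.inv₀ (fun x hx => norm_ne_zero_iff.2 hx.2)
        · intro x hx
          exact ⟨hmn x hx.1, hs x hx.2⟩
      have := c x ⟨hx, hx0⟩
      rwa [continuousWithinAt_inter (isOpen_ne.mem_nhds hx0)] at this
  · intro x hx
    dsimp only
    split_ifs with hx0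
    · exact hw
    · exact h2 _ (hmn x hx) _ (hs x hx0)
  · intro x hx
    have hx' := mem_sphere_zero_iff_norm.1 hx
    have : x ≠ 0 := by rintro rfl; simp at hx'
    simp only [this, if_false, hx']
    norm_num
    exact h3 x hx
end

end

section 
open Set Metric
open scoped Quaternion

noncomputable def kz (m : ℤ) (z : V2) : V2 :=
  Complex.equivRealProdCLM ((Complex.equivRealProdCLM.symm z) ^ m)

noncomputable def vModel (n : ℕ) (ε : ℝ) (x : V4) : V4 := eV.symm (zModel n ε (eV x))

theorem vModel_deg (m : ℕ) (hm : 1 ≤ m) (ε : ℝ) (hε : |ε| = 1) : vd (vModel m ε) 0 8 ≠ 0 := by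
  have := zModel_Dg m hm ε hε
  unfold vd
  have e : (eV ∘ vModel m ε ∘ eV.symm) = zModel m ε := by ext1 x; simp [vModel]
  rw [e, map_zero]; exact this

theorem kz_ne (m : ℤ) (z : V2) (hz : z ≠ 0) : kz m z ≠ 0 := by
  unfold kz
  rw [map_ne_zero_iff _ (ContinuousLinearEquiv.injective _)]
  apply zpow_ne_zero
  rwa [map_ne_zero_iff _ (ContinuousLinearEquiv.injective _)]

theorem kz_cont (m : ℤ) : ContinuousOn (kz m) {0}ᶜ := by
  have hzm : ContinuousOn (fun z : ℂ => z ^ m) {0}ᶜ := fun z hz =>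
    (continuousAt_zpow₀ z m (Or.inl hz)).continuousWithinAt
  apply (ContinuousLinearEquiv.continuous _).comp_continuousOn
  apply hzm.comp (ContinuousLinearEquiv.continuous _).continuousOn
  intro z hz
  have : z ≠ 0 := hz
  simpa using this

theorem kz_pos (m : ℤ) (hm : m ≠ 0) : ∃ (n : ℕ) (ε : ℝ), 1 ≤ n ∧ |ε| = 1 ∧
    ∀ x : V4, x.1.1 ≠ 0 → ∃ l : ℝ, 0 < l ∧ kz m x.1.1 = l • (vModel n ε x).1.1 := by
  rcases lt_or_gt_of_ne hm with h | h
  · obtain ⟨n, hn⟩ : ∃ n : ℕ, m = -n := ⟨m.natAbs, by omega⟩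
    refine ⟨n, -1, by omega, by simp, fun x hx => ?_⟩
    set z : ℂ := Complex.equivRealProdCLM.symm x.1.1 with hz
    have hz0 : z ≠ 0 := by rw [hz]; simpa using hx
    have hzc : zc (-1) (eV x) = (starRingEnd ℂ) z := by
      apply Complex.ext <;> simp [zc_apply, eV_apply, hz]
    refine ⟨(Complex.normSq z ^ n)⁻¹, by have := Complex.normSq_pos.2 hz0; positivity, ?_⟩
    have e : z ^ m = (((Complex.normSq z ^ n)⁻¹ : ℝ) : ℂ) * (starRingEnd ℂ z) ^ n := by
      rw [hn, zpow_neg, zpow_natCast, ← inv_pow, Complex.inv_def]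
      push_cast
      rw [mul_pow, mul_comm]
      simp
    unfold kz vModel
    rw [← hz, e]
    generalize (Complex.normSq z ^ n)⁻¹ = l
    apply Prod.ext <;> simp [zModel, hzc, eV_symm_apply]
  · obtain ⟨n, hn⟩ : ∃ n : ℕ, m = n := ⟨m.natAbs, by omega⟩
    refine ⟨n, 1, by omega, by simp, fun x hx => ⟨1, one_pos, ?_⟩⟩
    set z : ℂ := Complex.equivRealProdCLM.symm x.1.1 with hz
    have hzc : zc 1 (eV x) = z := by
      apply Complex.ext <;> simp [zc_apply, eV_apply, hz]
    unfold kz vModel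
    rw [← hz, hn]
    apply Prod.ext <;> simp [zModel, hzc, eV_symm_apply]

theorem susp_cont {E W : Type*} [NormedAddCommGroup E] [NormedSpace ℝ E] [NormedAddCommGroup W] [NormedSpace ℝ W]
    {h : E → W} (hc : ContinuousOn h {0}ᶜ) (h0 : ∀ x ≠ 0, h x ≠ 0) : ContinuousOn (susp h) {0}ᶜ :=
  (susp_hom (HomOn.refl hc h0)).left_cont

theorem susp_susp_model (m : ℤ) (hm : m ≠ 0) : ∃ (n : ℕ) (ε : ℝ), 1 ≤ n ∧ |ε| = 1 ∧
    HomOn {0}ᶜ {0}ᶜ (susp (susp (kz m))) (vModel n ε) := by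
  obtain ⟨n, ε, hn, hε, h⟩ := kz_pos m hm
  refine ⟨n, ε, hn, hε, HomOn.linear ?_ ?_ ?_⟩
  · exact susp_cont (susp_cont (kz_cont m) (kz_ne m)) (fun x hx => susp_ne (kz_ne m) hx)
  · apply Continuous.continuousOn
    exact eV.symm.continuous.comp ((zModel_contDiff n ε).continuous.comp eV.continuous)
  · rintro t ⟨ht0, ht1⟩ ⟨⟨z, c⟩, d⟩ hx h0
    have hv : vModel n ε ((z, c), d) = (((vModel n ε ((z,c),d)).1.1, c), d) := rfl
    rw [hv] at h0
    have hx : ((z, c), d) ≠ (0 : V4) := hx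
    simp only [susp, Prod.smul_mk, Prod.mk_add_mk, mem_singleton_iff, Prod.mk_eq_zero] at h0
    obtain ⟨⟨ha, hb⟩, hd⟩ := h0
    have hd0 : d = 0 := by simp only [smul_eq_mul] at hd; linarith
    subst hd0
    have hzc : (z, c) ≠ (0 : V3) := by rintro h; apply hx; rw [h]; rfl
    set α : ℝ := ‖(z, c)‖ / ‖((‖z‖ / ‖kz m z‖) • kz m z, c)‖ with hα
    have hα0 : 0 < α := by
      apply div_pos (norm_pos_iff.2 hzc)
      rw [norm_pos_iff]
      exact susp_ne (kz_ne m) hzc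
    have hc0 : c = 0 := by
      simp only [smul_eq_mul] at hb
      have : ((1 - t) * α + t) * c = 0 := by linarith
      rcases mul_eq_zero.1 this with h | h
      · exfalso
        rcases ht0.eq_or_lt with h' | h'
        · subst h'; simp at h; linarith
        · nlinarith
      · exact h
    subst hc0
    have hz : z ≠ 0 := by rintro rfl; exact hzc rfl
    obtain ⟨l, hl, hk⟩ := h ((z, 0), 0) hz
    dsimp only at hk
    have hb0 : 0 < ‖z‖ / ‖kz m z‖ := div_pos (norm_pos_iff.2 hz) (norm_pos_iff.2 (kz_ne m z hz))
    have hv0 : (vModel n ε ((z, 0), 0)).1.1 ≠ 0 := by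
      intro h'; rw [h', smul_zero] at hk; exact kz_ne m z hz hk
    have : ((1 - t) * α * (‖z‖ / ‖kz m z‖) * l + t) • (vModel n ε ((z, 0), 0)).1.1 = 0 := by
      rw [← ha]
      conv_rhs => rw [smul_smul, smul_smul]
      rw [add_smul, mul_smul _ l, ← hk]
    rcases smul_eq_zero.1 this with h | h
    · rcases ht0.eq_or_lt with h' | h'
      · subst h'
        have : 0 < α * (‖z‖ / ‖kz m z‖) * l := by positivity
        rw [sub_zero, one_mul, add_zero] at h; linarith
      · have : 0 ≤ (1 - t) * α * (‖z‖ / ‖kz m z‖) * l :=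
          mul_nonneg (mul_nonneg (mul_nonneg (by linarith) hα0.le) hb0.le) hl.le
        linarith
    · exact hv0 h

theorem v4_extend {φ : V4 → V4} (hφ : ContinuousOn φ (sphere 0 1)) (h0 : ∀ x ∈ sphere (0:V4) 1, φ x ≠ 0)
    (hd : vd φ 0 1 = 0) : ∃ ψ : V4 → V4, ContinuousOn ψ (closedBall 0 1) ∧
      (∀ x ∈ closedBall (0:V4) 1, ψ x ∈ ({0}ᶜ : Set V4)) ∧ ∀ x ∈ sphere (0:V4) 1, ψ x = φ x := by
  have hs : ∀ x : V4, x ≠ 0 → ‖x‖⁻¹ • x ∈ sphere (0:V4) 1 := by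
    intro x hx
    rw [mem_sphere_zero_iff_norm, norm_smul, norm_inv, norm_norm, inv_mul_cancel₀ (norm_ne_zero_iff.2 hx)]
  set φ1 : V4 → V4 := fun x => φ (‖x‖⁻¹ • x) with hφ1
  have h1c : ContinuousOn φ1 {0}ᶜ := by
    apply hφ.comp
    · exact ContinuousOn.smul (continuous_norm.continuousOn.inv₀ (fun x hx => norm_ne_zero_iff.2 hx)) continuousOn_id
    · exact hs
  have h10 : ∀ x ≠ 0, φ1 x ≠ 0 := fun x hx => h0 _ (hs x hx)
  have h1e : ∀ x ∈ sphere (0:V4) 1, φ1 x = φ x := by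
    intro x hx
    rw [mem_sphere_zero_iff_norm] at hx
    simp [hφ1, hx]
  have hsub : sphere (0:V4) 1 ⊆ {0}ᶜ := by
    rintro x hx rfl
    simp at hx
  obtain ⟨h, hc, hh0, hH⟩ := suspension h1c h10 (by simp)
  obtain ⟨k, kc, k0, kH⟩ := suspension hc hh0 (by simp)
  obtain ⟨m, hm⟩ := zpow_homotopy (k := fun z => Complex.equivRealProdCLM.symm (k (Complex.equivRealProdCLM z)))
    ((ContinuousLinearEquiv.continuous _).comp_continuousOn (kc.comp (ContinuousLinearEquiv.continuous _).continuousOn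
      (fun z hz => by have hz' : z ≠ 0 := hz; show _ ≠ _; rwa [map_ne_zero_iff _ (ContinuousLinearEquiv.injective _)])))
    (fun z hz => by
      rw [map_ne_zero_iff _ (ContinuousLinearEquiv.injective _)]
      apply k0
      rwa [map_ne_zero_iff _ (ContinuousLinearEquiv.injective _)])
  have hkm : HomOn {0}ᶜ {0}ᶜ k (kz m) := by
    have a := (hm.comp_right (k := Complex.equivRealProdCLM.symm) (Z' := {0}ᶜ)
      (ContinuousLinearEquiv.continuous _).continuousOn
      (fun z hz => by have hz' : z ≠ 0 := hz; show _ ≠ _; rwa [map_ne_zero_iff _ (ContinuousLinearEquiv.injective _)])).comp_left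
      (k := Complex.equivRealProdCLM) (T' := {0}ᶜ) (ContinuousLinearEquiv.continuous _).continuousOn
      (fun z hz => by have hz' : z ≠ 0 := hz; show _ ≠ _; rwa [map_ne_zero_iff _ (ContinuousLinearEquiv.injective _)])
    refine a.congr ?_ ?_
    · intro x _; simp
    · intro x _; simp [kz]
  have hfin : HomOn {0}ᶜ {0}ᶜ φ1 (susp (susp (kz m))) :=
    hH.trans (susp_hom (kH.trans (susp_hom hkm)))
  by_cases hm0 : m = 0
  · subst hm0
    have hw : ((1, 0) : V2) ≠ 0 := by simp
    have hk0 : kz 0 = fun _ => (1, 0) := by ext1 z; simp [kz]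
    rw [hk0] at hfin
    have hw3 : (((1, 0), 0) : V3) ≠ 0 := by simp
    have hw4 : ((((1, 0), 0), 0) : V4) ≠ 0 := by simp
    have b1 := susp_const (E := V2) hw
    have b2 := susp_const (E := V3) hw3
    have b3 := susp_hom b1
    have hf2 := hfin.trans (b3.trans b2)
    exact null_extends ((hf2.mono hsub).congr h1e (fun _ _ => rfl)) hw4
  · exfalso
    obtain ⟨n, ε, hn, hε, hM⟩ := susp_susp_model m hm0
    have a1 : vd φ1 0 8 = vd (vModel n ε) 0 8 := by
      apply vd_hom (by norm_num)
      exact (hfin.trans hM).mono (by rintro x hx rfl; simp at hx)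
    have a2 : vd φ1 0 8 = vd φ1 0 1 := by
      have hsub' : ∀ x ∈ closedBall (0:V4) 8 \ ⋃ i ∈ ({()} : Finset Unit), ball (0:V4) 1, x ≠ 0 := by
        rintro x ⟨-, hx⟩ rfl
        simp at hx
      have := vd_additive (ι := Unit) {()} (φ := φ1) (c₀ := 0) (r₀ := 8) (by norm_num) (fun _ => 0) (fun _ => 1) (by simp)
        (by intro _ _; exact closedBall_subset_ball (by norm_num))
        (by intro i _ j _ hij; exact absurd (Subsingleton.elim i j) hij)
        (h1c.mono hsub') (fun x hx => h10 x (hsub' x hx))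
      simpa using this
    have a3 : vd φ1 0 1 = vd φ 0 1 := by
      apply vd_hom (by norm_num)
      exact HomOn.of_eqOn (h1c.mono hsub) (fun x hx => h10 x (hsub hx)) h1e
    apply vModel_deg n hn ε hε
    rw [← a1, a2, a3, hd]

noncomputable def eHV : ℍ[ℝ] ≃L[ℝ] V4 :=
  ContinuousLinearEquiv.ofFinrankEq (by rw [Quaternion.finrank_eq_four]; simp)

noncomputable def qd (φ : V4 → ℍ[ℝ]) (c : V4) (r : ℝ) : ℝ := vd (eHV ∘ φ) c r

theorem qd_hom {φ φ' : V4 → ℍ[ℝ]} {c : V4} {r : ℝ} (hr : 0 < r)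
    (h : HomOn (sphere c r) {0}ᶜ φ φ') : qd φ c r = qd φ' c r :=
  vd_hom hr (h.comp_left (k := eHV) eHV.continuous.continuousOn (fun x hx => by simpa using hx))

theorem qd_additive {ι : Type*} (s : Finset ι) {φ : V4 → ℍ[ℝ]} {c₀ : V4}
    {r₀ : ℝ} (hr₀ : 0 < r₀) (c : ι → V4) (r : ι → ℝ) (hr : ∀ i ∈ s, 0 < r i)
    (hsub : ∀ i ∈ s, closedBall (c i) (r i) ⊆ ball c₀ r₀)
    (hdis : ∀ i ∈ s, ∀ j ∈ s, i ≠ j → Disjoint (closedBall (c i) (r i)) (closedBall (c j) (r j)))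
    (hc : ContinuousOn φ (closedBall c₀ r₀ \ ⋃ i ∈ s, ball (c i) (r i)))
    (h0 : ∀ x ∈ closedBall c₀ r₀ \ ⋃ i ∈ s, ball (c i) (r i), φ x ≠ 0) :
    qd φ c₀ r₀ = ∑ i ∈ s, qd φ (c i) (r i) :=
  vd_additive s hr₀ c r hr hsub hdis (eHV.continuous.comp_continuousOn hc)
    (fun x hx => by simpa using h0 x hx)

theorem qd_zero {φ : V4 → ℍ[ℝ]} {c₀ : V4}
    {r₀ : ℝ} (hr₀ : 0 < r₀) (hc : ContinuousOn φ (closedBall c₀ r₀))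
    (h0 : ∀ x ∈ closedBall c₀ r₀, φ x ≠ 0) : qd φ c₀ r₀ = 0 := by
  have := qd_additive (ι := Empty) ∅ hr₀ (fun _ => 0) (fun _ => 0) (by simp) (by simp) (by simp)
    (φ := φ) (by simpa using hc) (by simpa using h0)
  simpa using this

theorem q_extend {φ : V4 → ℍ[ℝ]} (hφ : ContinuousOn φ (sphere 0 1)) (h0 : ∀ x ∈ sphere (0:V4) 1, φ x ≠ 0)
    (hd : qd φ 0 1 = 0) : ∃ ψ : V4 → ℍ[ℝ], ContinuousOn ψ (closedBall 0 1) ∧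
      (∀ x ∈ closedBall (0:V4) 1, ψ x ≠ 0) ∧ ∀ x ∈ sphere (0:V4) 1, ψ x = φ x := by
  obtain ⟨ψ, h1, h2, h3⟩ := v4_extend (φ := eHV ∘ φ) (eHV.continuous.comp_continuousOn hφ)
    (fun x hx => by simpa using h0 x hx) hd
  refine ⟨eHV.symm ∘ ψ, eHV.symm.continuous.comp_continuousOn h1, fun x hx => ?_, fun x hx => ?_⟩
  · have h' : ψ x ≠ 0 := h2 x hx
    simpa using h'
  · simp [h3 x hx]

end

section 
open Set Metric
open scoped Quaternion

/-- lifting predicate -/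
def PL {X B F : Type*} [TopologicalSpace X] [TopologicalSpace B] [TopologicalSpace F]
    (T : Set B) (L : B → F → Prop) (Z : Set X) : Prop :=
  ∀ U : X → B, ContinuousOn U Z → (∀ z ∈ Z, U z ∈ T) →
    ∃ φ : X → F, ContinuousOn φ Z ∧ ∀ z ∈ Z, L (U z) (φ z)

/-- transition data for homotopy lifting -/
structure LTr {B F : Type*} [MetricSpace B] [TopologicalSpace F] (T : Set B) (L : B → F → Prop)
    (δ : ℝ) (τ : B → B → F → F) : Prop where
  pos : 0 < δ
  cont : ContinuousOn (fun p : B × B × F => τ p.1 p.2.1 p.2.2)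
    {p | p.1 ∈ T ∧ p.2.1 ∈ T ∧ dist p.1 p.2.1 < δ}
  lift : ∀ u₁ ∈ T, ∀ u₀ ∈ T, dist u₁ u₀ < δ → ∀ φ, L u₀ φ → L u₁ (τ u₁ u₀ φ)
  idt : ∀ u ∈ T, ∀ φ, τ u u φ = φ
  ex : ∀ u ∈ T, ∃ φ, L u φ

theorem LTr.hlp {X B F : Type*} [MetricSpace X] [MetricSpace B] [TopologicalSpace F] {T : Set B} {L : B → F → Prop}
    {δ : ℝ} {τ : B → B → F → F} (h : LTr T L δ τ) {Z : Set X} (hZ : IsCompact Z)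
    {U : ℝ × X → B} (hU : ContinuousOn U (Icc 0 1 ×ˢ Z)) (hT : ∀ t ∈ Icc (0:ℝ) 1, ∀ z ∈ Z, U (t, z) ∈ T)
    {φ : X → F} (hφ : ContinuousOn φ Z) (hL : ∀ z ∈ Z, L (U (0, z)) (φ z)) :
    ∃ Φ : ℝ × X → F, ContinuousOn Φ (Icc 0 1 ×ˢ Z) ∧ (∀ t ∈ Icc (0:ℝ) 1, ∀ z ∈ Z, L (U (t, z)) (Φ (t, z))) ∧
      ∀ z ∈ Z, Φ (0, z) = φ z := by
  have huc := (isCompact_Icc.prod hZ).uniformContinuousOn_of_continuous hU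
  rw [Metric.uniformContinuousOn_iff] at huc
  obtain ⟨η, hη, hη'⟩ := huc δ h.pos
  obtain ⟨n, hn⟩ := exists_nat_gt (1 / η)
  have hn0 : 0 < (n:ℝ) := lt_trans (by positivity) hn
  have hnη : 1 / (n:ℝ) < η := by
    rw [div_lt_iff₀ hη] at hn
    rw [div_lt_iff₀ hn0]; linarith
  have key : ∀ k : ℕ, ∃ Φ : ℝ × X → F, ContinuousOn Φ (Icc 0 1 ×ˢ Z) ∧
      (∀ t ∈ Icc (0:ℝ) 1, ∀ z ∈ Z, L (U (min t (k / n), z)) (Φ (t, z))) ∧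
      ∀ z ∈ Z, Φ (0, z) = φ z := by
    intro k
    induction k with
    | zero =>
      refine ⟨fun x => φ x.2, hφ.comp continuousOn_snd (fun x hx => hx.2), ?_, fun z _ => rfl⟩
      intro t ht z hz
      have : min t ((0:ℕ) / n : ℝ) = 0 := by simpa using ht.1
      rw [this]; exact hL z hz
    | succ k ih =>
      obtain ⟨Φ, h1, h2, h3⟩ := ih
      have hm : ∀ (k : ℕ) t, t ∈ Icc (0:ℝ) 1 → min t (k / n : ℝ) ∈ Icc (0:ℝ) 1 := by
        intro k t ht
        exact ⟨le_min ht.1 (by positivity), (min_le_left _ _).trans ht.2⟩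
      have hd : ∀ t ∈ Icc (0:ℝ) 1, ∀ z ∈ Z, dist (U (min t ((k+1:ℕ) / n), z)) (U (min t (k / n), z)) < δ := by
        intro t ht z hz
        apply hη' _ ⟨hm _ t ht, hz⟩ _ ⟨hm _ t ht, hz⟩
        rw [Prod.dist_eq, dist_self, max_lt_iff]
        refine ⟨lt_of_le_of_lt ?_ hnη, hη⟩
        have e : ((k+1:ℕ) / n : ℝ) = k / n + 1 / n := by push_cast; ring
        have : 0 < 1 / (n:ℝ) := by positivity
        rw [Real.dist_eq, e, abs_le]
        constructor
        · rcases min_cases t (k/n:ℝ) with h | h <;> rcases min_cases t (k/n + 1/n:ℝ) with h' | h' <;> linarith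
        · rcases min_cases t (k/n:ℝ) with h | h <;> rcases min_cases t (k/n + 1/n:ℝ) with h' | h' <;> linarith
      have hUc : ∀ k : ℕ, ContinuousOn (fun x : ℝ × X => U (min x.1 (k / n), x.2)) (Icc 0 1 ×ˢ Z) := by
        intro k
        apply hU.comp
        · fun_prop
        · intro x hx; exact ⟨hm k _ hx.1, hx.2⟩
      refine ⟨fun x => τ (U (min x.1 ((k+1:ℕ) / n), x.2)) (U (min x.1 (k / n), x.2)) (Φ x), ?_, ?_, ?_⟩
      · apply h.cont.comp (f := fun x : ℝ × X => ((U (min x.1 ((k+1:ℕ) / n), x.2)), (U (min x.1 (k / n), x.2)), Φ x))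
        · exact (hUc _).prodMk ((hUc _).prodMk h1)
        · intro x hx
          exact ⟨hT _ (hm _ _ hx.1) _ hx.2, hT _ (hm _ _ hx.1) _ hx.2, hd _ hx.1 _ hx.2⟩
      · intro t ht z hz
        exact h.lift _ (hT _ (hm _ _ ht) _ hz) _ (hT _ (hm _ _ ht) _ hz) (hd _ ht _ hz) _ (h2 t ht z hz)
      · intro z hz
        have e : ∀ k : ℕ, min (0:ℝ) (k / n) = 0 := fun k => by
          apply min_eq_left; positivity
        simp only [e]
        rw [h.idt _ (hT 0 (by simp) z hz), h3 z hz]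
  obtain ⟨Φ, h1, h2, h3⟩ := key n
  refine ⟨Φ, h1, ?_, h3⟩
  intro t ht z hz
  have := h2 t ht z hz
  rwa [div_self hn0.ne', min_eq_left ht.2] at this

theorem LTr.contractible {X B F : Type*} [MetricSpace X] [MetricSpace B] [TopologicalSpace F] {T : Set B} {L : B → F → Prop}
    {δ : ℝ} {τ : B → B → F → F} (h : LTr T L δ τ) {Z : Set X} (hZ : IsCompact Z) {z₀ : X} (hz₀ : z₀ ∈ Z)
    (hc : HomOn Z Z id (fun _ => z₀)) : PL T L Z := by
  intro U hU hT
  obtain ⟨H, h1, h2, h3, h4⟩ := hc.symm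
  obtain ⟨φ, hφ⟩ := h.ex _ (hT z₀ hz₀)
  obtain ⟨Φ, a1, a2, a3⟩ := h.hlp hZ (U := fun x => U (H x)) (hU.comp h1 (fun x hx => h2 _ hx.1 _ hx.2))
    (fun t ht z hz => hT _ (h2 t ht z hz)) (φ := fun _ => φ) continuousOn_const
    (fun z hz => by simp only [h3 z hz]; exact hφ)
  refine ⟨fun z => Φ (1, z), a1.comp (by fun_prop) (fun z hz => ⟨by simp, hz⟩), fun z hz => ?_⟩
  have := a2 1 (by simp) z hz
  simpa only [h4 z hz, id] using this

theorem PL.retract {X X' B F : Type*} [TopologicalSpace X] [TopologicalSpace X'] [TopologicalSpace B] [TopologicalSpace F] {T : Set B}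
    {L : B → F → Prop} {Z : Set X} {Z' : Set X'} (h : PL T L Z') (i : X → X') (r : X' → X)
    (hi : ContinuousOn i Z) (hr : ContinuousOn r Z') (hi' : MapsTo i Z Z') (hr' : MapsTo r Z' Z) (hri : ∀ z ∈ Z, r (i z) = z) :
    PL T L Z := by
  intro U hU hT
  obtain ⟨φ, h1, h2⟩ := h (U ∘ r) (hU.comp hr hr') (fun z hz => hT _ (hr' hz))
  refine ⟨φ ∘ i, h1.comp hi hi', fun z hz => ?_⟩
  have := h2 (i z) (hi' hz)
  simpa [hri z hz] using this

/-! the two instances -/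
def T1 : Set ℂ := {u | ‖u‖ = 1}
def L1 (u θ : ℂ) : Prop := Complex.exp θ = u

theorem trans1 : LTr T1 L1 1 (fun u₁ u₀ θ => θ + Complex.log (u₁ / u₀)) where
  pos := one_pos
  cont := by
    have hs : ∀ p : ℂ × ℂ × ℂ, p ∈ {p : ℂ × ℂ × ℂ | p.1 ∈ T1 ∧ p.2.1 ∈ T1 ∧ dist p.1 p.2.1 < 1} →
        p.1 / p.2.1 ∈ Complex.slitPlane ∧ p.2.1 ≠ 0 := by
      rintro p ⟨h1, h2, h3⟩
      have h2' : ‖p.2.1‖ = 1 := h2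
      have h0 : p.2.1 ≠ 0 := by rintro h; rw [h] at h2'; simp at h2'
      refine ⟨?_, h0⟩
      have e : p.1 / p.2.1 = 1 + (p.1 - p.2.1) / p.2.1 := by field_simp; ring
      rw [e]
      apply Complex.mem_slitPlane_of_norm_lt_one
      rw [norm_div, h2', div_one, ← dist_eq_norm]; exact h3
    apply ContinuousOn.add
    · fun_prop
    · apply ContinuousOn.clog
      · exact ContinuousOn.div (by fun_prop) (by fun_prop) (fun p hp => (hs p hp).2)
      · exact fun p hp => (hs p hp).1
  lift := by
    rintro u₁ h1 u₀ h0 - θ h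
    have h0' : ‖u₀‖ = 1 := h0
    have h1' : ‖u₁‖ = 1 := h1
    have a0 : u₀ ≠ 0 := by rintro h; rw [h] at h0'; simp at h0'
    have a1 : u₁ ≠ 0 := by rintro h; rw [h] at h1'; simp at h1'
    unfold L1 at *
    rw [Complex.exp_add, h, Complex.exp_log (div_ne_zero a1 a0)]
    field_simp
  idt := by
    intro u hu θ
    have h0' : ‖u‖ = 1 := hu
    have a0 : u ≠ 0 := by rintro h; rw [h] at h0'; simp at h0'
    simp [div_self a0]
  ex := by
    intro u hu
    have h0' : ‖u‖ = 1 := hu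
    have a0 : u ≠ 0 := by rintro h; rw [h] at h0'; simp at h0'
    exact ⟨Complex.log u, Complex.exp_log a0⟩

def qi : ℍ[ℝ] := ⟨0, 1, 0, 0⟩
def qj : ℍ[ℝ] := ⟨0, 0, 1, 0⟩
def T2 : Set ℍ[ℝ] := {u | u * u = -1}
def L2 (u φ : ℍ[ℝ]) : Prop := φ ≠ 0 ∧ φ * qi = u * φ

@[simp] theorem qi_re : qi.re = 0 := rfl
@[simp] theorem qi_imI : qi.imI = 1 := rfl
@[simp] theorem qi_imJ : qi.imJ = 0 := rfl
@[simp] theorem qi_imK : qi.imK = 0 := rfl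
@[simp] theorem qj_re : qj.re = 0 := rfl
@[simp] theorem qj_imI : qj.imI = 0 := rfl
@[simp] theorem qj_imJ : qj.imJ = 1 := rfl
@[simp] theorem qj_imK : qj.imK = 0 := rfl
theorem qi_sq : qi * qi = -1 := by ext <;> simp
theorem qj_sq : qj * qj = -1 := by ext <;> simp
theorem qij : qj * qi = - (qi * qj) := by ext <;> simp
theorem qj_ne : qj ≠ 0 := by intro h; have := qj_sq; rw [h] at this; simp at this
theorem qi_ne : qi ≠ 0 := by intro h; have := qi_sq; rw [h] at this; simp at this

theorem T2_norm {u : ℍ[ℝ]} (hu : u ∈ T2) : ‖u‖ = 1 := by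
  have : ‖u * u‖ = 1 := by rw [hu, norm_neg, norm_one]
  rw [norm_mul] at this
  nlinarith [norm_nonneg u]

theorem trans2 : LTr T2 L2 2 (fun u₁ u₀ φ => ((2:ℝ)⁻¹ • (1 - u₁ * u₀)) * φ) where
  pos := two_pos
  cont := by fun_prop
  lift := by
    rintro u₁ h1 u₀ h0 hd φ ⟨hφ, h⟩
    have h1' : u₁ * u₁ = -1 := h1
    have h0' : u₀ * u₀ = -1 := h0
    refine ⟨?_, ?_⟩
    · apply mul_ne_zero _ hφ
      apply smul_ne_zero (by norm_num)
      intro h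
      have e : u₁ = - u₀ := by
        have : u₁ * u₀ * u₀ = u₀ := by rw [← sub_eq_zero.1 h, one_mul]
        rw [mul_assoc, h0'] at this
        rw [← this]; simp
      rw [e, dist_eq_norm] at hd
      have : -u₀ - u₀ = (-2:ℝ) • u₀ := by module
      rw [this, norm_smul, T2_norm h0] at hd
      norm_num at hd
    · rw [mul_assoc, h, ← mul_assoc, ← mul_assoc, smul_mul_assoc, mul_smul_comm, sub_mul, mul_sub, mul_assoc u₁, h0',
        ← mul_assoc, h1']
      simp [add_comm]
  idt := by
    intro u hu φ
    have hu' : u * u = -1 := hu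
    rw [hu']
    have : (2:ℝ)⁻¹ • (1 - -1 : ℍ[ℝ]) = 1 := by
      rw [sub_neg_eq_add, smul_add, ← add_smul]; norm_num
    rw [this, one_mul]
  ex := by
    intro u hu
    have hu' : u * u = -1 := hu
    by_cases h : u = -qi
    · refine ⟨qj, qj_ne, ?_⟩
      rw [h, qij, neg_mul]
    · refine ⟨1 - u * qi, ?_, ?_⟩
      · intro h'; apply h
        have : u * qi * qi = qi := by rw [← sub_eq_zero.1 h', one_mul]
        rw [mul_assoc, qi_sq] at this
        rw [← this]; simp
      · rw [sub_mul, mul_sub, mul_assoc, qi_sq, ← mul_assoc, hu']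
        simp [add_comm]

end

section 
open Set Metric
open scoped Quaternion

theorem glue_closed {X F : Type*} [TopologicalSpace X] [TopologicalSpace F] {Z₁ Z₂ : Set X} (h1 : IsClosed Z₁) (h2 : IsClosed Z₂)
    {φ₁ φ₂ : X → F} (hc1 : ContinuousOn φ₁ Z₁) (hc2 : ContinuousOn φ₂ Z₂) (he : ∀ z ∈ Z₁ ∩ Z₂, φ₁ z = φ₂ z) :
    ∃ φ : X → F, ContinuousOn φ (Z₁ ∪ Z₂) ∧ (∀ z ∈ Z₁, φ z = φ₁ z) ∧ ∀ z ∈ Z₂, φ z = φ₂ z := by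
  classical
  have a1 : ∀ z ∈ Z₁, Z₁.piecewise φ₁ φ₂ z = φ₁ z := fun z hz => piecewise_eq_of_mem _ _ _ hz
  have a2 : ∀ z ∈ Z₂, Z₁.piecewise φ₁ φ₂ z = φ₂ z := by
    intro z hz
    by_cases h : z ∈ Z₁
    · rw [a1 z h, he z ⟨h, hz⟩]
    · exact piecewise_eq_of_notMem _ _ _ h
  exact ⟨Z₁.piecewise φ₁ φ₂, (hc1.congr a1).union_of_isClosed (hc2.congr a2) h1 h2, a1, a2⟩

theorem PL.glue1 {X : Type*} [TopologicalSpace X] {Z₁ Z₂ : Set X} (h1 : IsClosed Z₁) (h2 : IsClosed Z₂)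
    (p1 : PL T1 L1 Z₁) (p2 : PL T1 L1 Z₂) (h : IsPreconnected (Z₁ ∩ Z₂)) : PL T1 L1 (Z₁ ∪ Z₂) := by
  intro U hU hT
  obtain ⟨θ₁, c1, l1⟩ := p1 U (hU.mono subset_union_left) (fun z hz => hT z (Or.inl hz))
  obtain ⟨θ₂, c2, l2⟩ := p2 U (hU.mono subset_union_right) (fun z hz => hT z (Or.inr hz))
  unfold L1 at l1 l2
  have : ∃ c : ℂ, Complex.exp c = 1 ∧ ∀ z ∈ Z₁ ∩ Z₂, θ₁ z = θ₂ z + c := by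
    rcases (Z₁ ∩ Z₂).eq_empty_or_nonempty with he | ⟨z₀, hz₀⟩
    · exact ⟨0, by simp, by simp [he]⟩
    · have hd : ∀ z ∈ Z₁ ∩ Z₂, ∃ m : ℤ, θ₁ z - θ₂ z = m * (2 * Real.pi * Complex.I) := by
        intro z hz
        rw [← Complex.exp_eq_one_iff, Complex.exp_sub, l1 z hz.1, l2 z hz.2, div_self]
        rw [← l1 z hz.1]; exact Complex.exp_ne_zero _
      refine ⟨θ₁ z₀ - θ₂ z₀, ?_, ?_⟩
      · rw [Complex.exp_eq_one_iff]; exact hd z₀ hz₀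
      · intro z hz
        haveI := isPreconnected_iff_preconnectedSpace.1 h
        have hcc : Continuous (fun z : (Z₁ ∩ Z₂ : Set X) => θ₁ z - θ₂ z) :=
          continuousOn_iff_continuous_restrict.1 ((c1.mono inter_subset_left).sub (c2.mono inter_subset_right))
        have := int_const_of_continuous hcc (fun a => hd a a.2) ⟨z, hz⟩ ⟨z₀, hz₀⟩
        simp only at this
        rw [← this]; ring
  obtain ⟨c, hc, he⟩ := this
  obtain ⟨φ, b1, b2, b3⟩ := glue_closed h1 h2 c1 (c2.add (continuousOn_const (c := c))) he
  refine ⟨φ, b1, ?_⟩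
  rintro z (hz | hz)
  · rw [b2 z hz]; exact l1 z hz
  · rw [b3 z hz]; unfold L1; simp only [Pi.add_apply, Complex.exp_add, hc, mul_one]; exact l2 z hz

theorem PL.log {X : Type*} [TopologicalSpace X] {Z : Set X} (p : PL T1 L1 Z) {c : X → ℂ}
    (hc : ContinuousOn c Z) (h0 : ∀ z ∈ Z, c z ≠ 0) : ∃ θ : X → ℂ, ContinuousOn θ Z ∧ ∀ z ∈ Z, Complex.exp (θ z) = c z := by
  have hn : ∀ z ∈ Z, ‖c z‖ ≠ 0 := fun z hz => norm_ne_zero_iff.2 (h0 z hz)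
  obtain ⟨θ, h1, h2⟩ := p (fun z => (‖c z‖⁻¹ : ℝ) • c z) ((hc.norm.inv₀ hn).smul hc) (fun z hz => by
    show ‖_‖ = 1
    rw [norm_smul, norm_inv, norm_norm, inv_mul_cancel₀ (hn z hz)])
  refine ⟨fun z => θ z + ((Real.log ‖c z‖ : ℝ) : ℂ), h1.add (Complex.continuous_ofReal.comp_continuousOn (hc.norm.log hn)), fun z hz => ?_⟩
  have := h2 z hz
  unfold L1 at this
  rw [Complex.exp_add, this, ← Complex.ofReal_exp, Real.exp_log (norm_pos_iff.2 (h0 z hz)), Complex.real_smul]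
  have : ((‖c z‖:ℝ):ℂ) ≠ 0 := by exact_mod_cast hn z hz
  push_cast
  field_simp

noncomputable def cq (z : ℂ) : ℍ[ℝ] := Quaternion.ofComplex z

theorem cq_cont : Continuous cq := by
  have : cq = (LinearMap.toContinuousLinearMap Quaternion.ofComplex.toLinearMap) := rfl
  rw [this]; exact ContinuousLinearMap.continuous _

theorem cq_ne {z : ℂ} (hz : z ≠ 0) : cq z ≠ 0 := by
  exact (map_ne_zero_iff Quaternion.ofComplex.toRingHom Quaternion.ofComplex.toRingHom.injective).2 hz

theorem cq_comm (z : ℂ) : cq z * qi = qi * cq z := by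
  ext <;> simp [cq, Quaternion.coe_ofComplex]

theorem lift_diff {X : Type*} [TopologicalSpace X] {Z : Set X} (p : PL T1 L1 Z) {U φ₁ φ₂ : X → ℍ[ℝ]}
    (h1 : ContinuousOn φ₁ Z) (h2 : ContinuousOn φ₂ Z) (l1 : ∀ z ∈ Z, L2 (U z) (φ₁ z)) (l2 : ∀ z ∈ Z, L2 (U z) (φ₂ z)) :
    ∃ θ : X → ℂ, ContinuousOn θ Z ∧ ∀ z ∈ Z, φ₁ z = φ₂ z * cq (Complex.exp (θ z)) := by
  set lam : X → ℍ[ℝ] := fun z => (φ₂ z)⁻¹ * φ₁ z with hlam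
  have hl : ContinuousOn lam Z := (h2.inv₀ (fun z hz => (l2 z hz).1)).mul h1
  have hq : ∀ z ∈ Z, lam z = cq ⟨(lam z).re, (lam z).imI⟩ := by
    intro z hz
    obtain ⟨n1, e1⟩ := l1 z hz
    obtain ⟨n2, e2⟩ := l2 z hz
    have hcomm : lam z * qi = qi * lam z := by
      have : qi * (φ₂ z)⁻¹ = (φ₂ z)⁻¹ * U z := by
        apply mul_left_cancel₀ n2
        rw [← mul_assoc, e2, mul_assoc, mul_inv_cancel₀ n2, mul_one, ← mul_assoc, mul_inv_cancel₀ n2, one_mul]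
      simp only [hlam]
      rw [mul_assoc, e1, ← mul_assoc, ← mul_assoc, this]
    have hj := congrArg QuaternionAlgebra.imJ hcomm
    have hk := congrArg QuaternionAlgebra.imK hcomm
    simp at hj hk
    ext <;> simp [cq, Quaternion.coe_ofComplex] <;> linarith
  have hne : ∀ z ∈ Z, lam z ≠ 0 := fun z hz => mul_ne_zero (inv_ne_zero (l2 z hz).1) (l1 z hz).1
  obtain ⟨θ, t1, t2⟩ := p.log (c := fun z => (⟨(lam z).re, (lam z).imI⟩ : ℂ)) (by
      have : (fun z => (⟨(lam z).re, (lam z).imI⟩ : ℂ)) = fun z => ((lam z).re : ℂ) + ((lam z).imI : ℂ) * Complex.I := by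
        ext z; apply Complex.ext <;> simp
      rw [this]
      have a := Quaternion.continuous_re.comp_continuousOn hl
      have b := Quaternion.continuous_imI.comp_continuousOn hl
      exact (Complex.continuous_ofReal.comp_continuousOn a).add ((Complex.continuous_ofReal.comp_continuousOn b).mul continuousOn_const))
    (fun z hz h => hne z hz (by rw [hq z hz, h]; simp [cq]))
  refine ⟨θ, t1, fun z hz => ?_⟩
  rw [t2 z hz, ← hq z hz, ← mul_assoc, mul_inv_cancel₀ (l2 z hz).1, one_mul]

theorem L2_mul {u φ : ℍ[ℝ]} (h : L2 u φ) {z : ℂ} (hz : z ≠ 0) : L2 u (φ * cq z) := by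
  refine ⟨mul_ne_zero h.1 (cq_ne hz), ?_⟩
  rw [mul_assoc, cq_comm, ← mul_assoc, h.2, mul_assoc]

theorem PL.glue2 {X : Type*} [TopologicalSpace X] [NormalSpace X] {Z₁ Z₂ : Set X} (h1 : IsClosed Z₁) (h2 : IsClosed Z₂)
    (p1 : PL T2 L2 Z₁) (p2 : PL T2 L2 Z₂) (h : PL T1 L1 (Z₁ ∩ Z₂)) : PL T2 L2 (Z₁ ∪ Z₂) := by
  intro U hU hT
  obtain ⟨φ₁, c1, l1⟩ := p1 U (hU.mono subset_union_left) (fun z hz => hT z (Or.inl hz))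
  obtain ⟨φ₂, c2, l2⟩ := p2 U (hU.mono subset_union_right) (fun z hz => hT z (Or.inr hz))
  obtain ⟨θ, t1, t2⟩ := lift_diff h (c1.mono inter_subset_left) (c2.mono inter_subset_right)
    (fun z hz => l1 z hz.1) (fun z hz => l2 z hz.2)
  obtain ⟨θ', t3, t4⟩ := tietze_fd (h1.inter h2) t1
  obtain ⟨φ, b1, b2, b3⟩ := glue_closed h1 h2 c1 (c2.mul (cq_cont.comp (Complex.continuous_exp.comp t3)).continuousOn)
    (fun z hz => by rw [t2 z hz, ← t4 z hz]; rfl)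
  refine ⟨φ, b1, ?_⟩
  rintro z (hz | hz)
  · rw [b2 z hz]; exact l1 z hz
  · rw [b3 z hz]; exact L2_mul (l2 z hz) (Complex.exp_ne_zero _)

/-- Lemma W -/
theorem lift_homotopic {X : Type*} [MetricSpace X] {Z : Set X} (hZ : IsCompact Z) (p : PL T1 L1 Z) {U₀ U₁ φ₀ φ₁ : X → ℍ[ℝ]}
    (hU : HomOn Z T2 U₀ U₁) (h0 : ContinuousOn φ₀ Z) (h1 : ContinuousOn φ₁ Z)
    (l0 : ∀ z ∈ Z, L2 (U₀ z) (φ₀ z)) (l1 : ∀ z ∈ Z, L2 (U₁ z) (φ₁ z)) : HomOn Z {0}ᶜ φ₀ φ₁ := by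
  obtain ⟨H, a1, a2, a3, a4⟩ := hU
  obtain ⟨Φ, b1, b2, b3⟩ := trans2.hlp hZ a1 a2 h0 (fun z hz => by rw [a3 z hz]; exact l0 z hz)
  have hΦ1 : ContinuousOn (fun z => Φ (1, z)) Z := b1.comp (by fun_prop) (fun z hz => ⟨by simp, hz⟩)
  have hΦl : ∀ z ∈ Z, L2 (U₁ z) (Φ (1, z)) := fun z hz => by
    have := b2 1 (by simp) z hz
    rwa [a4 z hz] at this
  have s1 : HomOn Z {0}ᶜ φ₀ (fun z => Φ (1, z)) :=
    ⟨Φ, b1, fun t ht z hz => (b2 t ht z hz).1, b3, fun _ _ => rfl⟩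
  obtain ⟨θ, t1, t2⟩ := lift_diff p h1 hΦ1 l1 hΦl
  refine s1.trans ⟨fun x => Φ (1, x.2) * cq (Complex.exp (x.1 * θ x.2)), ?_, ?_, ?_, ?_⟩
  · apply ContinuousOn.mul
    · exact hΦ1.comp continuousOn_snd (fun x hx => hx.2)
    · apply cq_cont.comp_continuousOn
      apply Complex.continuous_exp.comp_continuousOn
      apply ContinuousOn.mul
      · fun_prop
      · exact t1.comp continuousOn_snd (fun x hx => hx.2)
  · intro t ht z hz
    exact mul_ne_zero (hΦl z hz).1 (cq_ne (Complex.exp_ne_zero _))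
  · intro z hz
    simp [cq]
  · intro z hz
    simp [t2 z hz]

end

section 
open Set Metric
open scoped Quaternion

section
variable {E : Type*} [NormedAddCommGroup E] [NormedSpace ℝ E]

/-- vertically star-shaped sets contract -/
theorem vert_contract {Z : Set (E × ℝ)} {D : Set E} {e : ℝ} {x₀ : E} (hD : Convex ℝ D) (hx₀ : x₀ ∈ D)
    (h1 : ∀ z ∈ Z, z.1 ∈ D) (h2 : ∀ x ∈ D, (x, e) ∈ Z)
    (h3 : ∀ z ∈ Z, ∀ t ∈ Icc (0:ℝ) 1, (z.1, (1 - t) * z.2 + t * e) ∈ Z) :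
    HomOn Z Z id (fun _ => (x₀, e)) := by
  have s1 : HomOn Z Z id (fun z => (z.1, e)) := by
    apply HomOn.linear continuousOn_id (by fun_prop)
    intro t ht z hz
    have : (1 - t) • id z + t • (z.1, e) = (z.1, (1 - t) * z.2 + t * e) := by
      apply Prod.ext
      · simp only [id, Prod.fst_add, Prod.smul_fst]; module
      · simp
    rw [this]; exact h3 z hz t ht
  refine s1.trans ?_
  apply HomOn.linear (by fun_prop) (by fun_prop)
  intro t ht z hz
  have : (1 - t) • (z.1, e) + t • (x₀, e) = ((1 - t) • z.1 + t • x₀, e) := by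
    apply Prod.ext
    · simp
    · simp; ring
  rw [this]
  apply h2
  exact hD (h1 z hz) hx₀ (by linarith [ht.2]) ht.1 (by ring)

theorem preconn_of_contract {X : Type*} [TopologicalSpace X] {Z : Set X} {z₀ : X} (h : HomOn Z Z id (fun _ => z₀)) : IsPreconnected Z := by
  obtain ⟨H, a1, a2, a3, a4⟩ := h
  apply isPreconnected_of_forall z₀
  intro y hy
  refine ⟨(fun t => H (t, y)) '' Icc 0 1, ?_, ⟨1, by simp, a4 y hy⟩, ⟨0, by simp, a3 y hy⟩, ?_⟩
  · rintro _ ⟨t, ht, rfl⟩; exact a2 t ht y hy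
  · apply isPreconnected_Icc.image
    exact a1.comp (by fun_prop) (fun t ht => ⟨ht, hy⟩)

/-- box with one hole -/
def hbox (D O : Set E) (a b c d : ℝ) : Set (E × ℝ) :=
  {z | z.1 ∈ D ∧ z.2 ∈ Icc a b ∧ ¬ (z.1 ∈ O ∧ c < z.2 ∧ z.2 < d)}
def loBox (D O : Set E) (a c m : ℝ) : Set (E × ℝ) := {z | z.1 ∈ D ∧ z.2 ∈ Icc a m ∧ ¬ (z.1 ∈ O ∧ c < z.2)}
def hiBox (D O : Set E) (b d m : ℝ) : Set (E × ℝ) := {z | z.1 ∈ D ∧ z.2 ∈ Icc m b ∧ ¬ (z.1 ∈ O ∧ z.2 < d)}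

variable {D O : Set E} {a b c d m : ℝ}

theorem hbox_eq (h1 : a ≤ c) (h2 : c < m) (h3 : m < d) (h4 : d ≤ b) : hbox D O a b c d = loBox D O a c m ∪ hiBox D O b d m := by
  ext ⟨x, s⟩
  simp only [hbox, loBox, hiBox, mem_setOf_eq, mem_union, mem_Icc]
  constructor
  · rintro ⟨h, ⟨h5, h6⟩, h7⟩
    rcases le_total s m with h8 | h8
    · exact Or.inl ⟨h, ⟨h5, h8⟩, fun h9 => h7 ⟨h9.1, h9.2, by linarith⟩⟩
    · exact Or.inr ⟨h, ⟨h8, h6⟩, fun h9 => h7 ⟨h9.1, by linarith, h9.2⟩⟩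
  · rintro (⟨h, ⟨h5, h6⟩, h7⟩ | ⟨h, ⟨h5, h6⟩, h7⟩)
    · exact ⟨h, ⟨h5, by linarith⟩, fun h9 => h7 ⟨h9.1, h9.2.1⟩⟩
    · exact ⟨h, ⟨by linarith, h6⟩, fun h9 => h7 ⟨h9.1, h9.2.2⟩⟩

theorem hbox_inter (h1 : a ≤ c) (h2 : c < m) (h3 : m < d) (h4 : d ≤ b) : loBox D O a c m ∩ hiBox D O b d m = (D \ O) ×ˢ {m} := by
  ext ⟨x, s⟩
  simp only [loBox, hiBox, mem_setOf_eq, mem_inter_iff, mem_Icc, mem_prod, mem_diff, mem_singleton_iff]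
  constructor
  · rintro ⟨⟨h, ⟨h5, h6⟩, h7⟩, ⟨_, ⟨h8, h9⟩, h10⟩⟩
    have : s = m := le_antisymm h6 h8
    subst this
    exact ⟨⟨h, fun h' => h7 ⟨h', h2⟩⟩, rfl⟩
  · rintro ⟨⟨h, h'⟩, rfl⟩
    exact ⟨⟨h, ⟨by linarith, le_rfl⟩, fun h9 => h' h9.1⟩, h, ⟨le_rfl, by linarith⟩, fun h9 => h' h9.1⟩

theorem lo_contract {x₀ : E} (hD : Convex ℝ D) (hx₀ : x₀ ∈ D) (h1 : a ≤ c) (h2 : c < m) :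
    HomOn (loBox D O a c m) (loBox D O a c m) id (fun _ => (x₀, a)) := by
  apply vert_contract hD hx₀ (fun z hz => hz.1)
  · intro x hx
    exact ⟨hx, ⟨le_rfl, by linarith⟩, fun h => by have := h.2; simp at this; linarith⟩
  · rintro ⟨x, s⟩ ⟨h, ⟨h5, h6⟩, h7⟩ t ⟨ht0, ht1⟩
    simp only at h h5 h6 h7 ⊢
    have e : (1 - t) * s + t * a ≤ s := by nlinarith
    refine ⟨h, ⟨by simp only; nlinarith, by simp only; linarith⟩, fun h8 => h7 ⟨h8.1, ?_⟩⟩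
    have := h8.2; simp only at this; linarith

theorem hi_contract {x₀ : E} (hD : Convex ℝ D) (hx₀ : x₀ ∈ D) (h3 : m < d) (h4 : d ≤ b) :
    HomOn (hiBox D O b d m) (hiBox D O b d m) id (fun _ => (x₀, b)) := by
  apply vert_contract hD hx₀ (fun z hz => hz.1)
  · intro x hx
    exact ⟨hx, ⟨by linarith, le_rfl⟩, fun h => by have := h.2; simp at this; linarith⟩
  · rintro ⟨x, s⟩ ⟨h, ⟨h5, h6⟩, h7⟩ t ⟨ht0, ht1⟩
    simp only at h h5 h6 h7 ⊢
    have e : s ≤ (1 - t) * s + t * b := by nlinarith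
    refine ⟨h, ⟨by simp only; linarith, by simp only; nlinarith⟩, fun h8 => h7 ⟨h8.1, ?_⟩⟩
    have := h8.2; simp only at this; linarith

theorem lo_compact (hD : IsCompact D) (hO : IsOpen O) : IsCompact (loBox D O a c m) := by
  have : loBox D O a c m = (D ×ˢ Icc a m) ∩ (O ×ˢ Ioi c)ᶜ := by
    ext z; simp [loBox, and_assoc]
  rw [this]
  exact (hD.prod isCompact_Icc).inter_right (hO.prod isOpen_Ioi).isClosed_compl

theorem hi_compact (hD : IsCompact D) (hO : IsOpen O) : IsCompact (hiBox D O b d m) := by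
  have : hiBox D O b d m = (D ×ˢ Icc m b) ∩ (O ×ˢ Iio d)ᶜ := by
    ext z; simp [hiBox, and_assoc]
  rw [this]
  exact (hD.prod isCompact_Icc).inter_right (hO.prod isOpen_Iio).isClosed_compl

theorem hbox_conn (hD : Convex ℝ D) (hne : (D \ O).Nonempty) (h1 : a ≤ c) (h2 : c < d) (h4 : d ≤ b) :
    IsPreconnected (hbox D O a b c d) := by
  obtain ⟨x₀, hx₀⟩ := hne
  have e1 : c < (c + d) / 2 := by linarith
  have e2 : (c + d) / 2 < d := by linarith
  rw [hbox_eq h1 e1 e2 h4]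
  have hm : (x₀, (c + d) / 2) ∈ loBox D O a c ((c+d)/2) ∩ hiBox D O b d ((c+d)/2) := by
    rw [hbox_inter h1 e1 e2 h4]; exact ⟨hx₀, rfl⟩
  exact IsPreconnected.union _ hm.1 hm.2 (preconn_of_contract (lo_contract hD hx₀.1 h1 e1)) (preconn_of_contract (hi_contract hD hx₀.1 e2 h4))

theorem hbox_PL1 (hD : Convex ℝ D) (hDc : IsCompact D) (hO : IsOpen O) (hne : (D \ O).Nonempty) (hc : IsPreconnected (D \ O))
    (h1 : a ≤ c) (h2 : c < d) (h4 : d ≤ b) : PL T1 L1 (hbox D O a b c d) := by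
  obtain ⟨x₀, hx₀⟩ := hne
  have e1 : c < (c + d) / 2 := by linarith
  have e2 : (c + d) / 2 < d := by linarith
  have hm : (x₀, (c + d) / 2) ∈ loBox D O a c ((c+d)/2) ∩ hiBox D O b d ((c+d)/2) := by
    rw [hbox_inter h1 e1 e2 h4]; exact ⟨hx₀, rfl⟩
  have l := lo_contract (O := O) hD hx₀.1 h1 e1
  have h := hi_contract (O := O) hD hx₀.1 e2 h4
  rw [hbox_eq h1 e1 e2 h4]
  apply PL.glue1 (lo_compact hDc hO).isClosed (hi_compact hDc hO).isClosed
  · exact trans1.contractible (lo_compact hDc hO) (l.right_mem _ hm.1) l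
  · exact trans1.contractible (hi_compact hDc hO) (h.right_mem _ hm.2) h
  · rw [hbox_inter h1 e1 e2 h4]; exact hc.prod isPreconnected_singleton

theorem hbox_PL2 (hD : Convex ℝ D) (hDc : IsCompact D) (hO : IsOpen O) (hne : (D \ O).Nonempty) (hp : PL T1 L1 (D \ O))
    (h1 : a ≤ c) (h2 : c < d) (h4 : d ≤ b) : PL T2 L2 (hbox D O a b c d) := by
  obtain ⟨x₀, hx₀⟩ := hne
  have e1 : c < (c + d) / 2 := by linarith
  have e2 : (c + d) / 2 < d := by linarith
  have hm : (x₀, (c + d) / 2) ∈ loBox D O a c ((c+d)/2) ∩ hiBox D O b d ((c+d)/2) := by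
    rw [hbox_inter h1 e1 e2 h4]; exact ⟨hx₀, rfl⟩
  have l := lo_contract (O := O) hD hx₀.1 h1 e1
  have h := hi_contract (O := O) hD hx₀.1 e2 h4
  rw [hbox_eq h1 e1 e2 h4]
  apply PL.glue2 (lo_compact hDc hO).isClosed (hi_compact hDc hO).isClosed
  · exact trans2.contractible (lo_compact hDc hO) (l.right_mem _ hm.1) l
  · exact trans2.contractible (hi_compact hDc hO) (h.right_mem _ hm.2) h
  · rw [hbox_inter h1 e1 e2 h4]
    refine hp.retract Prod.fst (fun x => (x, (c+d)/2)) (by fun_prop) (by fun_prop) (fun z hz => hz.1) (fun x hx => ⟨hx, rfl⟩) ?_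
    rintro ⟨x, s⟩ hz
    have : s = (c+d)/2 := hz.2
    simp [this]

/-- box with many holes -/
def mbox {ι : Type*} (D : Set E) (O : ι → Set E) (a b : ℝ) (c d : ι → ℝ) (s : Finset ι) : Set (E × ℝ) :=
  {z | z.1 ∈ D ∧ z.2 ∈ Icc a b ∧ ∀ i ∈ s, ¬ (z.1 ∈ O i ∧ c i < z.2 ∧ z.2 < d i)}

theorem mbox_compact {ι : Type*} {O : ι → Set E} {c d : ι → ℝ} (hDc : IsCompact D) (hO : ∀ i, IsOpen (O i)) (s : Finset ι) :
    IsCompact (mbox D O a b c d s) := by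
  have : mbox D O a b c d s = (D ×ˢ Icc a b) ∩ (⋃ i ∈ s, O i ×ˢ Ioo (c i) (d i))ᶜ := by
    ext z; simp [mbox, and_assoc]
  rw [this]
  exact (hDc.prod isCompact_Icc).inter_right (isOpen_biUnion fun i _ => (hO i).prod isOpen_Ioo).isClosed_compl

theorem box_contract {x₀ : E} (hD : Convex ℝ D) (hx₀ : x₀ ∈ D) (hab : a ≤ b) : HomOn (D ×ˢ Icc a b) (D ×ˢ Icc a b) id (fun _ => (x₀, a)) := by
  apply vert_contract hD hx₀ (fun z hz => hz.1)
  · intro x hx; exact ⟨hx, le_rfl, hab⟩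
  · rintro ⟨x, s⟩ ⟨h, h5, h6⟩ t ⟨ht0, ht1⟩
    simp only at h h5 h6 ⊢
    exact ⟨h, by simp only; nlinarith, by simp only; nlinarith⟩

theorem mbox_PL2 {ι : Type*} {O : ι → Set E} {c d : ι → ℝ} (hD : Convex ℝ D) (hDc : IsCompact D) (hO : ∀ i, IsOpen (O i))
    (hne : ∀ i, (D \ O i).Nonempty) (hDne : D.Nonempty) (hp : ∀ i, PL T1 L1 (D \ O i)) (s : Finset ι) :
    ∀ b : ℝ, a ≤ b → (∀ i ∈ s, a ≤ c i ∧ c i < d i ∧ d i ≤ b) → (∀ i ∈ s, ∀ j ∈ s, i ≠ j → d i ≤ c j ∨ d j ≤ c i) →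
    PL T2 L2 (mbox D O a b c d s) := by
  classical
  obtain ⟨x₀, hx₀⟩ := hDne
  induction s using Finset.induction_on_max_value c with
  | empty =>
    intro b hab _ _
    have e : mbox D O a b c d ∅ = D ×ˢ Icc a b := by ext z; simp [mbox]
    rw [e]
    have := box_contract hD hx₀ hab
    exact trans2.contractible (hDc.prod isCompact_Icc) ⟨hx₀, le_rfl, hab⟩ this
  | insert i s his hmax ih =>
    intro b hab h1 h2
    obtain ⟨hi1, hi2, hi3⟩ := h1 i (by simp)
    have hd : ∀ j ∈ s, d j ≤ c i := by
      intro j hj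
      rcases h2 i (by simp) j (by simp [hj]) (by rintro rfl; exact his hj) with h | h
      · have := hmax j hj; linarith
      · exact h
    have e : mbox D O a b c d (insert i s) = mbox D O a (c i) c d s ∪ hbox D (O i) (c i) b (c i) (d i) := by
      ext ⟨x, t⟩
      simp only [mbox, hbox, mem_setOf_eq, mem_union, mem_Icc, Finset.mem_insert, forall_eq_or_imp]
      constructor
      · rintro ⟨h, ⟨h5, h6⟩, h7, h8⟩
        rcases le_total t (c i) with h9 | h9
        · exact Or.inl ⟨h, ⟨h5, h9⟩, h8⟩
        · exact Or.inr ⟨h, ⟨h9, h6⟩, h7⟩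
      · rintro (⟨h, ⟨h5, h6⟩, h7⟩ | ⟨h, ⟨h5, h6⟩, h7⟩)
        · exact ⟨h, ⟨h5, by linarith⟩, fun h9 => by linarith [h9.2.1], h7⟩
        · exact ⟨h, ⟨by linarith, h6⟩, h7, fun j hj h9 => by linarith [hd j hj, h9.2.2]⟩
    have e' : mbox D O a (c i) c d s ∩ hbox D (O i) (c i) b (c i) (d i) = D ×ˢ Icc (c i) (c i) := by
      ext ⟨x, t⟩
      simp only [mbox, hbox, mem_setOf_eq, mem_inter_iff, mem_Icc, mem_prod]
      constructor
      · rintro ⟨⟨h, ⟨h5, h6⟩, h7⟩, ⟨_, ⟨h8, h9⟩, h10⟩⟩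
        exact ⟨h, h8, h6⟩
      · rintro ⟨h, h5, h6⟩
        exact ⟨⟨h, ⟨by linarith, h6⟩, fun j hj h9 => by linarith [hd j hj, h9.2.2]⟩, h, ⟨h5, by linarith⟩, fun h9 => by linarith [h9.2.1]⟩
    have hb2 : IsClosed (hbox D (O i) (c i) b (c i) (d i)) := by
      rw [hbox_eq (m := (c i + d i)/2) le_rfl (by linarith) (by linarith) hi3]
      exact (lo_compact hDc (hO i)).isClosed.union (hi_compact hDc (hO i)).isClosed
    rw [e]
    apply PL.glue2 (mbox_compact hDc hO s).isClosed hb2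
    · apply ih (c i) hi1
      · intro j hj
        obtain ⟨q1, q2, q3⟩ := h1 j (by simp [hj])
        exact ⟨q1, q2, hd j hj⟩
      · intro j hj k hk hjk
        exact h2 j (by simp [hj]) k (by simp [hk]) hjk
    · exact hbox_PL2 hD hDc (hO i) (hne i) (hp i) le_rfl hi2 hi3
    · rw [e']
      have := box_contract hD hx₀ (le_refl (c i))
      exact trans1.contractible (hDc.prod isCompact_Icc) ⟨hx₀, le_rfl, le_rfl⟩ this

end

end

section 
open Set Metric
open scoped Quaternion

section
variable {E : Type*} [NormedAddCommGroup E] [NormedSpace ℝ E]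

theorem mem_cb {z C : E × ℝ} {R : ℝ} : z ∈ closedBall C R ↔ z.1 ∈ closedBall C.1 R ∧ C.2 - R ≤ z.2 ∧ z.2 ≤ C.2 + R := by
  simp only [mem_closedBall, Prod.dist_eq, max_le_iff, Real.dist_eq, abs_le]
  constructor
  · rintro ⟨h1, h2, h3⟩; exact ⟨h1, by linarith, by linarith⟩
  · rintro ⟨h1, h2, h3⟩; exact ⟨h1, by linarith, by linarith⟩

theorem mem_b {z C : E × ℝ} {R : ℝ} : z ∈ ball C R ↔ z.1 ∈ ball C.1 R ∧ C.2 - R < z.2 ∧ z.2 < C.2 + R := by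
  simp only [mem_ball, Prod.dist_eq, max_lt_iff, Real.dist_eq, abs_lt]
  constructor
  · rintro ⟨h1, h2, h3⟩; exact ⟨h1, by linarith, by linarith⟩
  · rintro ⟨h1, h2, h3⟩; exact ⟨h1, by linarith, by linarith⟩

theorem mball_eq {ι : Type*} (s : Finset ι) (x : ι → E × ℝ) (R ε : ℝ) : closedBall (0:E × ℝ) R \ ⋃ i ∈ s, ball (x i) ε =
    mbox (closedBall 0 R) (fun i : s => ball (x i).1 ε) (-R) R (fun i => (x i).2 - ε) (fun i => (x i).2 + ε) Finset.univ := by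
  ext z
  simp only [mbox, mem_diff, mem_cb, mem_b, mem_setOf_eq, mem_Icc, mem_iUnion, not_exists, Prod.fst_zero, Prod.snd_zero,
    zero_sub, zero_add, Finset.mem_univ, forall_true_left, Subtype.forall, exists_prop, and_assoc]
  constructor
  · rintro ⟨h1, h2, h3, h4⟩
    exact ⟨h1, h2, h3, fun i hi h5 => h4 i ⟨hi, h5⟩⟩
  · rintro ⟨h1, h2, h3, h4⟩
    exact ⟨h1, h2, h3, fun i h5 => h4 i h5.1 h5.2⟩

theorem ann_eq (C x : E × ℝ) (R ε : ℝ) : closedBall C R \ ball x ε =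
    hbox (closedBall C.1 R) (ball x.1 ε) (C.2 - R) (C.2 + R) (x.2 - ε) (x.2 + ε) := by
  ext z
  simp only [hbox, mem_diff, mem_closedBall, mem_ball, mem_setOf_eq, Prod.dist_eq, max_le_iff, max_lt_iff, mem_Icc, Real.dist_eq, abs_le, abs_lt]
  constructor
  · rintro ⟨⟨h1, h2, h3⟩, h4⟩
    exact ⟨h1, ⟨by linarith, by linarith⟩, fun h5 => h4 ⟨h5.1, by linarith [h5.2.1], by linarith [h5.2.2]⟩⟩
  · rintro ⟨h1, ⟨h2, h3⟩, h4⟩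
    exact ⟨⟨h1, by linarith, by linarith⟩, fun h5 => h4 ⟨h5.1, by linarith [h5.2.1], by linarith [h5.2.2]⟩⟩

theorem ann_bounds {C x : E × ℝ} {R ε : ℝ} (h : dist x C + ε ≤ R) :
    dist x.1 C.1 + ε ≤ R ∧ C.2 - R ≤ x.2 - ε ∧ x.2 + ε ≤ C.2 + R := by
  rw [Prod.dist_eq] at h
  have h1 := le_max_left (dist x.1 C.1) (dist x.2 C.2)
  have h2 := le_max_right (dist x.1 C.1) (dist x.2 C.2)
  have h3 := neg_abs_le (x.2 - C.2)
  have h4 := le_abs_self (x.2 - C.2)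
  rw [Real.dist_eq] at *
  refine ⟨by linarith, by linarith, by linarith⟩

theorem ann_ne {C x : E × ℝ} {R ε : ℝ} (hε : 0 < ε) (h : dist x C + ε ≤ R) : (closedBall C R \ ball x ε).Nonempty := by
  obtain ⟨h1, h2, h3⟩ := ann_bounds h
  refine ⟨(x.1, x.2 + ε), ?_, ?_⟩
  · rw [mem_closedBall, Prod.dist_eq, max_le_iff, Real.dist_eq, abs_le]
    refine ⟨by simp only; linarith, by simp only; linarith, by simp only; linarith⟩
  · rw [mem_ball, Prod.dist_eq, not_lt]
    refine le_trans ?_ (le_max_right _ _)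
    simp [abs_of_pos hε]

theorem ann_conn {C x : E × ℝ} {R ε : ℝ} (hε : 0 < ε) (h : dist x C + ε ≤ R) (hne : (closedBall C.1 R \ ball x.1 ε).Nonempty) :
    IsPreconnected (closedBall C R \ ball x ε) := by
  obtain ⟨h1, h2, h3⟩ := ann_bounds h
  rw [ann_eq]
  exact hbox_conn (convex_closedBall _ _) hne h2 (by linarith) h3

theorem ann_PL1 [ProperSpace E] {C x : E × ℝ} {R ε : ℝ} (hε : 0 < ε) (h : dist x C + ε ≤ R) (hne : (closedBall C.1 R \ ball x.1 ε).Nonempty)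
    (hc : IsPreconnected (closedBall C.1 R \ ball x.1 ε)) : PL T1 L1 (closedBall C R \ ball x ε) := by
  obtain ⟨h1, h2, h3⟩ := ann_bounds h
  rw [ann_eq]
  exact hbox_PL1 (convex_closedBall _ _) (isCompact_closedBall _ _) isOpen_ball hne hc h2 (by linarith) h3
end

theorem ann_ne_real {C x R ε : ℝ} (hε : 0 < ε) (h : dist x C + ε ≤ R) : (closedBall C R \ ball x ε).Nonempty := by
  have h3 := neg_abs_le (x - C)
  have h4 := le_abs_self (x - C)
  rw [Real.dist_eq] at h
  refine ⟨x + ε, ?_, ?_⟩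
  · rw [mem_closedBall, Real.dist_eq, abs_le]; constructor <;> linarith
  · simp [abs_of_pos hε]

theorem ann_PL1_V3 {C x : V3} {R ε : ℝ} (hε : 0 < ε) (h : dist x C + ε ≤ R) : PL T1 L1 (closedBall C R \ ball x ε) := by
  have h1 := (ann_bounds h).1
  have h2 := (ann_bounds h1).1
  exact ann_PL1 hε h (ann_ne hε h1) (ann_conn hε h1 (ann_ne_real hε h2))

theorem ann_PL1_V4 {C x : V4} {R ε : ℝ} (hε : 0 < ε) (h : dist x C + ε ≤ R) : PL T1 L1 (closedBall C R \ ball x ε) := by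
  have h1 := (ann_bounds h).1
  have h2 := (ann_bounds h1).1
  exact ann_PL1 hε h (ann_ne hε h1) (ann_conn hε h1 (ann_ne hε h2))

theorem sphere_PL1 (c : V4) {r : ℝ} (hr : 0 < r) : PL T1 L1 (sphere c r) := by
  have h := ann_PL1_V4 (C := c) (x := c) (R := 2 * r) hr (by simp; linarith)
  have hn : ∀ x ∈ closedBall c (2 * r) \ ball c r, ‖x - c‖ ≠ 0 := by
    rintro x ⟨-, hx⟩ h0
    apply hx; rw [mem_ball, dist_eq_norm, h0]; exact hr
  refine h.retract id (fun x => c + (r / ‖x - c‖) • (x - c)) continuousOn_id ?_ ?_ ?_ ?_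
  · have : ContinuousOn (fun x : V4 => r / ‖x - c‖) (closedBall c (2 * r) \ ball c r) :=
      ContinuousOn.div (by fun_prop) (by fun_prop) hn
    fun_prop
  · intro x hx
    rw [mem_sphere] at hx
    exact ⟨by rw [mem_closedBall, id, hx]; linarith, by simp [hx]⟩
  · intro x hx
    rw [mem_sphere, dist_eq_norm, add_sub_cancel_left, norm_smul, norm_div, norm_norm, div_mul_cancel₀ _ (hn x hx), Real.norm_of_nonneg hr.le]
  · intro x hx
    rw [mem_sphere, dist_eq_norm] at hx
    simp [hx, hr.ne']

theorem mball_PL2 {ι : Type*} (s : Finset ι) (x : ι → V4) {R ε : ℝ} (hε : 0 < ε) (hR : 0 ≤ R)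
    (h : ∀ i ∈ s, ‖x i‖ + ε ≤ R)
    (hd : ∀ i ∈ s, ∀ j ∈ s, i ≠ j → 2 * ε ≤ |(x i).2 - (x j).2|) :
    PL T2 L2 (closedBall (0:V4) R \ ⋃ i ∈ s, ball (x i) ε) := by
  rw [mball_eq]
  have hh : ∀ i : s, dist (x i) 0 + ε ≤ R := fun i => by rw [dist_zero_right]; exact h i i.2
  apply mbox_PL2 (convex_closedBall _ _) (isCompact_closedBall _ _) (fun i => isOpen_ball) _ ⟨0, by simpa using hR⟩
  · intro i
    exact ann_PL1_V3 hε (ann_bounds (hh i)).1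
  · linarith
  · intro i _
    obtain ⟨h1, h2, h3⟩ := ann_bounds (hh i)
    simp at h2 h3
    exact ⟨by linarith, by linarith, by linarith⟩
  · intro i _ j _ hij
    have := hd i i.2 j j.2 (fun h => hij (Subtype.ext h))
    rcases le_abs.1 this with h | h
    · right; linarith
    · left; linarith
  · intro i
    exact ann_ne hε (ann_bounds (hh i)).1

end

section 
open Set Metric Filter Topology
open scoped Quaternion

theorem q_nsq (a : ℍ[ℝ]) : ‖a‖ ^ 2 = a.re ^ 2 + a.imI ^ 2 + a.imJ ^ 2 + a.imK ^ 2 := by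
  rw [sq, ← Quaternion.normSq_eq_norm_mul_self, Quaternion.normSq_def']

theorem q_inv (a : ℍ[ℝ]) : a⁻¹ = (‖a‖ ^ 2)⁻¹ • star a := by
  rw [Quaternion.inv_def, Quaternion.normSq_eq_norm_mul_self, sq]

theorem q_unit {p : ℍ[ℝ]} (hp : ‖p‖ = 1) : star p * p = 1 ∧ p * star p = 1 := by
  constructor
  · rw [Quaternion.star_mul_self, Quaternion.normSq_eq_norm_mul_self, hp]; simp
  · rw [Quaternion.self_mul_star, Quaternion.normSq_eq_norm_mul_self, hp]; simp

theorem unit_one_sub {w : ℍ[ℝ]} (hw : ‖w‖ = 1) : ‖1 - w‖ ^ 2 = 2 * (1 - w.re) := by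
  have := q_nsq w
  rw [hw] at this
  rw [q_nsq]; simp; nlinarith

theorem re_lt_one {w : ℍ[ℝ]} (hw : ‖w‖ = 1) (h1 : w ≠ 1) : w.re < 1 := by
  have h := unit_one_sub hw
  have : 0 < ‖1 - w‖ := norm_pos_iff.2 (sub_ne_zero.2 (Ne.symm h1))
  nlinarith

theorem re_inv_half {w : ℍ[ℝ]} (hw : ‖w‖ = 1) (h1 : w ≠ 1) : ((1 - w)⁻¹).re = 1 / 2 := by
  rw [q_inv, unit_one_sub hw]
  have := re_lt_one hw h1
  simp
  have h2 : 1 - w.re ≠ 0 := by linarith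
  field_simp

/-- imaginary nonzero -/
def TI : Set ℍ[ℝ] := {x | x.re = 0 ∧ x ≠ 0}

noncomputable def nrm (x : ℍ[ℝ]) : ℍ[ℝ] := ‖x‖⁻¹ • x

theorem im_sq {x : ℍ[ℝ]} (hx : x.re = 0) : x * x = -((‖x‖ ^ 2 : ℝ) : ℍ[ℝ]) := by
  have h := q_nsq x
  obtain ⟨n, hn⟩ : ∃ n : ℝ, n = ‖x‖ ^ 2 := ⟨_, rfl⟩
  rw [← hn] at h ⊢
  rw [h] at *
  clear hn
  obtain ⟨n, hn⟩ : ∃ n : ℝ, n = x.re ^ 2 + x.imI ^ 2 + x.imJ ^ 2 + x.imK ^ 2 := ⟨_, rfl⟩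
  rw [← hn]
  ext <;> simp [hx]
  · rw [hn, hx]; ring
  all_goals ring

theorem nrm_mem {x : ℍ[ℝ]} (hx : x ∈ TI) : nrm x ∈ T2 := by
  show nrm x * nrm x = -1
  have h0 : ‖x‖ ≠ 0 := norm_ne_zero_iff.2 hx.2
  have : (nrm x).re = 0 := by simp [nrm, hx.1]
  rw [im_sq this]
  have : ‖nrm x‖ = 1 := by rw [nrm, norm_smul, norm_inv, norm_norm, inv_mul_cancel₀ h0]
  rw [this]; simp

theorem nrm_cont : ContinuousOn nrm {0}ᶜ :=
  ContinuousOn.smul (continuous_norm.continuousOn.inv₀ (fun x hx => norm_ne_zero_iff.2 hx)) continuousOn_id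

theorem nrm_smul {l : ℝ} (hl : 0 < l) (x : ℍ[ℝ]) : nrm (l • x) = nrm x := by
  unfold nrm
  rw [norm_smul, Real.norm_of_nonneg hl.le, smul_smul, mul_inv]
  congr 1
  field_simp

theorem HomOn.nrm {X : Type*} [TopologicalSpace X] {Z : Set X} {U V : X → ℍ[ℝ]} (h : HomOn Z TI U V) :
    HomOn Z T2 (fun x => _root_.nrm (U x)) (fun x => _root_.nrm (V x)) :=
  h.comp_left (k := _root_.nrm) (nrm_cont.mono (fun x hx => hx.2)) (fun x hx => nrm_mem hx)

noncomputable def uU (p q f : ℍ[ℝ]) : ℍ[ℝ] := (1 - star p * f)⁻¹ - (1 - star p * q)⁻¹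

theorem star_mul_ne_one {p f : ℍ[ℝ]} (hp : ‖p‖ = 1) (h : f ≠ p) : star p * f ≠ 1 := by
  intro h'
  apply h
  have := congrArg (fun x => p * x) h'
  simpa [← mul_assoc, (q_unit hp).2] using this

theorem norm_star_mul {p f : ℍ[ℝ]} (hp : ‖p‖ = 1) (hf : ‖f‖ = 1) : ‖star p * f‖ = 1 := by
  rw [norm_mul, norm_star, hp, hf, one_mul]

theorem uU_mem {p q f : ℍ[ℝ]} (hp : ‖p‖ = 1) (hq : ‖q‖ = 1) (hf : ‖f‖ = 1) (hpq : p ≠ q) (hfp : f ≠ p) (hfq : f ≠ q) : uU p q f ∈ TI := by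
  have h1 := star_mul_ne_one hp hfp
  have h2 := star_mul_ne_one hp hpq.symm
  constructor
  · unfold uU
    rw [Quaternion.re_sub, re_inv_half (norm_star_mul hp hf) h1, re_inv_half (norm_star_mul hp hq) h2, sub_self]
  · unfold uU
    intro h
    have h3 := inv_injective (sub_eq_zero.1 h)
    have h4 : star p * f = star p * q := by
      have := congrArg (fun x => 1 - x) h3
      simpa using this
    have := congrArg (fun x => p * x) h4
    simp [← mul_assoc, (q_unit hp).2] at this
    exact hfq this

theorem uU_cont {X : Type*} [TopologicalSpace X] {Z : Set X} {p q f : X → ℍ[ℝ]} (hpc : ContinuousOn p Z) (hqc : ContinuousOn q Z) (hfc : ContinuousOn f Z)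
    (hp : ∀ x ∈ Z, ‖p x‖ = 1) (hpq : ∀ x ∈ Z, p x ≠ q x) (hfp : ∀ x ∈ Z, f x ≠ p x) :
    ContinuousOn (fun x => uU (p x) (q x) (f x)) Z := by
  unfold uU
  apply ContinuousOn.sub
  · apply ContinuousOn.inv₀ (by fun_prop)
    intro x hx; exact sub_ne_zero.2 (star_mul_ne_one (hp x hx) (hfp x hx)).symm
  · apply ContinuousOn.inv₀ (by fun_prop)
    intro x hx; exact sub_ne_zero.2 (star_mul_ne_one (hp x hx) (hpq x hx).symm).symm

/-- the swap relation -/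
theorem uU_swap {p q f : ℍ[ℝ]} (hp : ‖p‖ = 1) (hq : ‖q‖ = 1) (hf : ‖f‖ = 1) (hpq : p ≠ q) (hfp : f ≠ p) (hfq : f ≠ q) :
    ∃ l : ℝ, 0 < l ∧ uU p q f = l • (-((1 - star p * q) * uU q p f * (1 - star p * q)⁻¹)) := by
  have hpp := q_unit hp
  have hqq := q_unit hq
  have hff := q_unit hf
  have h1 : p - f ≠ 0 := sub_ne_zero.2 hfp.symm
  have h2 : f - q ≠ 0 := sub_ne_zero.2 hfq
  have h3 : p - q ≠ 0 := sub_ne_zero.2 hpq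
  have n1 : 0 < ‖p - f‖ ^ 2 := by have := norm_pos_iff.2 h1; positivity
  have n2 : 0 < ‖f - q‖ ^ 2 := by have := norm_pos_iff.2 h2; positivity
  have p0 : p ≠ 0 := by rintro rfl; simp at hp
  have q0 : q ≠ 0 := by rintro rfl; simp at hq
  have pinv : (star p)⁻¹ = p := inv_eq_of_mul_eq_one_right hpp.1
  have qinv : (star q)⁻¹ = q := inv_eq_of_mul_eq_one_right hqq.1
  have key : ∀ {a b : ℍ[ℝ]}, a ≠ 0 → b ≠ 0 → a⁻¹ - b⁻¹ = a⁻¹ * (b - a) * b⁻¹ := by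
    intro a b ha hb
    rw [mul_sub, sub_mul, mul_assoc, mul_inv_cancel₀ hb, inv_mul_cancel₀ ha]; simp
  have key' : ∀ {a b : ℍ[ℝ]}, a ≠ 0 → b ≠ 0 → a⁻¹ - b⁻¹ = b⁻¹ * (b - a) * a⁻¹ := by
    intro a b ha hb
    rw [mul_sub, sub_mul, mul_assoc _ a, mul_inv_cancel₀ ha, inv_mul_cancel₀ hb]; simp
  have e1 : 1 - star p * f = star p * (p - f) := by rw [mul_sub, hpp.1]
  have e2 : 1 - star p * q = star p * (p - q) := by rw [mul_sub, hpp.1]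
  have e3 : 1 - star q * f = star q * (q - f) := by rw [mul_sub, hqq.1]
  have e4 : 1 - star q * p = star q * (q - p) := by rw [mul_sub, hqq.1]
  have sp0 : star p ≠ 0 := by simpa using p0
  have sq0 : star q ≠ 0 := by simpa using q0
  have A : uU p q f = (p - f)⁻¹ * (f - q) * ((p - q)⁻¹ * p) := by
    unfold uU
    rw [e1, e2, key (mul_ne_zero sp0 h1) (mul_ne_zero sp0 h3), ← mul_sub, mul_inv_rev, mul_inv_rev, pinv]
    rw [show p - q - (p - f) = f - q by abel]
    simp only [mul_assoc]
    rw [← mul_assoc p (star p), hpp.2, one_mul]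
  have h2' : q - f ≠ 0 := sub_ne_zero.2 hfq.symm
  have h3' : q - p ≠ 0 := sub_ne_zero.2 hpq.symm
  have B : uU q p f = (q - p)⁻¹ * (f - p) * ((q - f)⁻¹ * q) := by
    unfold uU
    rw [e3, e4, key' (mul_ne_zero sq0 h2') (mul_ne_zero sq0 h3'), ← mul_sub, mul_inv_rev, mul_inv_rev, qinv]
    rw [show q - p - (q - f) = f - p by abel]
    simp only [mul_assoc]
    rw [← mul_assoc q (star q), hqq.2, one_mul]
  have C : -((1 - star p * q) * uU q p f * (1 - star p * q)⁻¹) = star p * (p - f) * ((f - q)⁻¹ * q) * ((p - q)⁻¹ * p) := by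
    rw [e2, B, mul_inv_rev, pinv]
    have a1 : (p - q) * (q - p)⁻¹ = -1 := by
      rw [show p - q = -(q - p) by abel, neg_mul, mul_inv_cancel₀ h3']
    have a2 : (q - f)⁻¹ = -(f - q)⁻¹ := by rw [← neg_sub f q, inv_neg]
    have a3 : f - p = -(p - f) := by abel
    rw [a2, a3]
    simp only [mul_assoc]
    rw [← mul_assoc (p - q) ((q - p)⁻¹), a1]
    simp only [mul_neg, neg_mul, one_mul, neg_neg, mul_assoc]
  refine ⟨‖f - q‖ ^ 2 / ‖p - f‖ ^ 2, by positivity, ?_⟩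
  rw [A, C, ← smul_mul_assoc]
  congr 1
  rw [q_inv (p - f), q_inv (f - q)]
  simp only [smul_mul_assoc, mul_smul_comm, smul_smul]
  rw [show ‖f - q‖ ^ 2 / ‖p - f‖ ^ 2 * (‖f - q‖ ^ 2)⁻¹ = (‖p - f‖ ^ 2)⁻¹ by field_simp]
  congr 1
  have b1 : star p * (p - f) = -(star (p - f) * f) := by
    rw [star_sub, mul_sub, sub_mul, hpp.1, hff.1]; abel
  have b2 : star (f - q) * q = -(star f * (f - q)) := by
    rw [star_sub, mul_sub, sub_mul, hqq.1, hff.1]; abel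
  rw [b1, b2, neg_mul_neg, mul_assoc, ← mul_assoc f (star f), hff.2, one_mul]

theorem nrm_conj {a u : ℍ[ℝ]} (ha : a ≠ 0) : nrm (-(a * u * a⁻¹)) = -(a * nrm u * a⁻¹) := by
  have : ‖-(a * u * a⁻¹)‖ = ‖u‖ := by
    rw [norm_neg, norm_mul, norm_mul, norm_inv]
    have := norm_ne_zero_iff.2 ha
    field_simp
  unfold nrm
  rw [this]; simp

theorem swap_lift {p q f φ : ℍ[ℝ]} (hp : ‖p‖ = 1) (hq : ‖q‖ = 1) (hf : ‖f‖ = 1) (hpq : p ≠ q) (hfp : f ≠ p) (hfq : f ≠ q)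
    (h : L2 (nrm (uU q p f)) φ) : L2 (nrm (uU p q f)) ((1 - star p * q) * φ * qj) := by
  obtain ⟨l, hl, e⟩ := uU_swap hp hq hf hpq hfp hfq
  have ha : 1 - star p * q ≠ 0 := sub_ne_zero.2 (star_mul_ne_one hp hpq.symm).symm
  rw [e, nrm_smul hl, nrm_conj ha]
  refine ⟨mul_ne_zero (mul_ne_zero ha h.1) qj_ne, ?_⟩
  set a := 1 - star p * q
  rw [mul_assoc, qij, mul_neg, ← mul_assoc, mul_assoc a, h.2, neg_mul]
  congr 1
  simp only [mul_assoc]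
  rw [← mul_assoc a⁻¹ a, inv_mul_cancel₀ ha, one_mul]

/-- near a coincidence point -/
def near (p q f : ℍ[ℝ]) : Prop :=
  4 * (1 - (star p * f).re) * ‖((1 - star p * q)⁻¹).im‖ ^ 2 < 1 + (star p * f).re

theorem near_hom {X : Type*} [TopologicalSpace X] {Z : Set X} {p q f : X → ℍ[ℝ]} (hpc : ContinuousOn p Z) (hqc : ContinuousOn q Z) (hfc : ContinuousOn f Z)
    (hp : ∀ x ∈ Z, ‖p x‖ = 1) (hq : ∀ x ∈ Z, ‖q x‖ = 1) (hf : ∀ x ∈ Z, ‖f x‖ = 1) (hpq : ∀ x ∈ Z, p x ≠ q x) (hfp : ∀ x ∈ Z, f x ≠ p x)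
    (hn : ∀ x ∈ Z, near (p x) (q x) (f x)) :
    HomOn Z T2 (fun x => nrm (uU (p x) (q x) (f x))) (fun x => nrm ((star (p x) * f x).im)) := by
  have e : ∀ x ∈ Z, nrm (uU (p x) (q x) (f x)) = nrm ((star (p x) * f x).im - ‖1 - star (p x) * f x‖ ^ 2 • ((1 - star (p x) * q x)⁻¹).im) := by
    intro x hx
    have h1 := star_mul_ne_one (hp x hx) (hfp x hx)
    have h2 := star_mul_ne_one (hp x hx) (hpq x hx).symm
    have n1 := norm_star_mul (hp x hx) (hf x hx)
    have n2 := norm_star_mul (hp x hx) (hq x hx)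
    have hr1 := re_inv_half n1 h1
    have hr2 := re_inv_half n2 h2
    have npos : 0 < ‖1 - star (p x) * f x‖ ^ 2 := by
      have := norm_pos_iff.2 (sub_ne_zero.2 h1.symm); positivity
    rw [← nrm_smul npos]
    congr 1
    unfold uU
    rw [smul_sub]
    set w := star (p x) * f x
    set κ := (1 - star (p x) * q x)⁻¹
    rw [q_inv (1 - w), smul_smul, mul_inv_cancel₀ npos.ne', one_smul, unit_one_sub n1]
    ext <;> simp [hr2]
    ring
  refine HomOn.congr (HomOn.nrm (U := fun x => (star (p x) * f x).im - ‖1 - star (p x) * f x‖ ^ 2 • ((1 - star (p x) * q x)⁻¹).im) ?_) (fun x hx => (e x hx).symm) (fun _ _ => rfl)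
  have hκ : ContinuousOn (fun x => (1 - star (p x) * q x)⁻¹) Z := by
    apply ContinuousOn.inv₀ (by fun_prop)
    intro x hx; exact sub_ne_zero.2 (star_mul_ne_one (hp x hx) (hpq x hx).symm).symm
  have hκ' := Quaternion.continuous_im.comp_continuousOn hκ
  have hw : ContinuousOn (fun x => star (p x) * f x) Z := by fun_prop
  have hw' := Quaternion.continuous_im.comp_continuousOn hw
  simp only [Function.comp_def] at hκ' hw'
  apply HomOn.linear
  · exact hw'.sub (ContinuousOn.smul (by fun_prop : ContinuousOn (fun x => ‖1 - star (p x) * f x‖^2) Z) hκ')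
  · exact hw'
  · intro t ht x hx
    have h1 := star_mul_ne_one (hp x hx) (hfp x hx)
    have n1 := norm_star_mul (hp x hx) (hf x hx)
    have hnx := hn x hx
    unfold near at hnx
    set w := star (p x) * f x
    set κ := (1 - star (p x) * q x)⁻¹
    have hlt := re_lt_one n1 h1
    refine ⟨by simp, fun h => ?_⟩
    have hwim : w.im = ((1 - t) * ‖1 - w‖ ^ 2) • κ.im := by
      have : (1 - t) • (w.im - ‖1 - w‖ ^ 2 • κ.im) + t • w.im = w.im - ((1 - t) * ‖1 - w‖ ^ 2) • κ.im := by module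
      rw [this] at h; exact sub_eq_zero.1 h
    have hn2 : ‖w.im‖ ^ 2 = (1 - w.re) * (1 + w.re) := by
      have := q_nsq w
      rw [n1] at this
      rw [q_nsq]; simp; nlinarith
    rw [hwim, norm_smul, unit_one_sub n1, mul_pow, Real.norm_eq_abs, sq_abs] at hn2
    obtain ⟨ht0, ht1⟩ := ht
    have hpos : 0 < 1 - w.re := by linarith
    have ht2 : (1 - t) ^ 2 ≤ 1 := by nlinarith
    have hK : 0 ≤ ‖κ.im‖ ^ 2 := by positivity
    have q1 : (1 - w.re) * (1 + w.re) ≤ (1 - w.re) * (4 * (1 - w.re) * ‖κ.im‖ ^ 2) := by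
      rw [← hn2]
      have : 0 ≤ 4 * (1 - w.re) ^ 2 * ‖κ.im‖ ^ 2 := by positivity
      nlinarith
    have := le_of_mul_le_mul_left q1 hpos
    linarith

end

section 
open Set Metric Filter Topology
open scoped Quaternion

theorem one_add_ne {V κ : ℍ[ℝ]} (hV : V.re = 0) (hκ : κ.re = 1 / 2) : 1 + V * κ ≠ 0 := by
  intro h
  by_cases h0 : V = 0
  · simp [h0] at h
  have h1 : V * κ = -1 := by rw [eq_neg_iff_add_eq_zero, add_comm]; exact h
  have h2 : κ = -V⁻¹ := by
    have := congrArg (fun x => V⁻¹ * x) h1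
    simpa [← mul_assoc, inv_mul_cancel₀ h0] using this
  have h3 : κ.re = 0 := by
    rw [h2, q_inv]; simp [hV]
  rw [hκ] at h3; norm_num at h3

noncomputable def rcv (κ V : ℍ[ℝ]) : ℍ[ℝ] := 1 - (1 + V * κ)⁻¹ * V

theorem rcv_norm {V κ : ℍ[ℝ]} (hV : V.re = 0) (hκ : κ.re = 1 / 2) : ‖rcv κ V‖ = 1 := by
  have h := one_add_ne hV hκ
  have e : rcv κ V = (1 + V * κ)⁻¹ * (1 + V * κ - V) := by
    rw [rcv, mul_sub, inv_mul_cancel₀ h]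
  have n : ‖1 + V * κ - V‖ = ‖1 + V * κ‖ := by
    have : ‖1 + V * κ - V‖ ^ 2 = ‖1 + V * κ‖ ^ 2 := by
      rw [q_nsq, q_nsq]; simp [hV, hκ]; ring
    exact (sq_eq_sq₀ (norm_nonneg _) (norm_nonneg _)).1 this
  rw [e, norm_mul, norm_inv, n, inv_mul_cancel₀ (norm_ne_zero_iff.2 h)]

theorem rcv_ne {V κ : ℍ[ℝ]} (hV : V.re = 0) (hκ : κ.re = 1 / 2) (h0 : V ≠ 0) : rcv κ V ≠ 1 := by
  have h := one_add_ne hV hκ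
  unfold rcv
  intro hh
  rw [sub_eq_self] at hh
  exact (mul_ne_zero (inv_ne_zero h) h0) hh

/-- inverse of `U` -/
noncomputable def vV (p q f : ℍ[ℝ]) : ℍ[ℝ] :=
  (1 - star p * f) * (1 - (1 - star p * q)⁻¹ * (1 - star p * f))⁻¹

theorem vV_den {p q f : ℍ[ℝ]} (hp : ‖p‖ = 1) (hpq : p ≠ q) (hfq : f ≠ q) :
    1 - (1 - star p * q)⁻¹ * (1 - star p * f) ≠ 0 := by
  have ha : 1 - star p * q ≠ 0 := sub_ne_zero.2 (star_mul_ne_one hp hpq.symm).symm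
  intro h
  have h1 := (sub_eq_zero.1 h).symm
  have := congrArg (fun x => (1 - star p * q) * x) h1
  simp only [← mul_assoc, mul_inv_cancel₀ ha, one_mul, mul_one] at this
  have h4 : star p * f = star p * q := by
    have := congrArg (fun x => 1 - x) this
    simpa using this
  have := congrArg (fun x => p * x) h4
  simp [← mul_assoc, (q_unit hp).2] at this
  exact hfq this

theorem vV_inv {p q f : ℍ[ℝ]} (hp : ‖p‖ = 1) (hfp : f ≠ p) :
    vV p q f = (uU p q f)⁻¹ := by
  have ha : 1 - star p * f ≠ 0 := sub_ne_zero.2 (star_mul_ne_one hp hfp).symm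
  have : uU p q f = (1 - (1 - star p * q)⁻¹ * (1 - star p * f)) * (1 - star p * f)⁻¹ := by
    rw [uU, sub_mul, mul_assoc, mul_inv_cancel₀ ha]; simp
  rw [this, mul_inv_rev, inv_inv, vV]

theorem vV_re {p q f : ℍ[ℝ]} (hp : ‖p‖ = 1) (hq : ‖q‖ = 1) (hf : ‖f‖ = 1) (hpq : p ≠ q) (hfq : f ≠ q) :
    (vV p q f).re = 0 := by
  by_cases h : f = p
  · rw [h, vV, (q_unit hp).1]; simp
  · rw [vV_inv hp h, q_inv]
    simp [(uU_mem hp hq hf hpq h hfq).1]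

theorem vV_rcv {p q f : ℍ[ℝ]} (hp : ‖p‖ = 1) (hq : ‖q‖ = 1) (hf : ‖f‖ = 1) (hpq : p ≠ q) (hfq : f ≠ q) :
    p * rcv ((1 - star p * q)⁻¹) (vV p q f) = f := by
  have hκ := re_inv_half (norm_star_mul hp hq) (star_mul_ne_one hp hpq.symm)
  have h1 := one_add_ne (vV_re hp hq hf hpq hfq) hκ
  have hd := vV_den hp hpq hfq
  have : (1 + vV p q f * (1 - star p * q)⁻¹) * (1 - star p * f) = vV p q f := by
    unfold vV
    set κ := (1 - star p * q)⁻¹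
    set d := 1 - star p * f
    calc (1 + d * (1 - κ * d)⁻¹ * κ) * d = d * ((1 - κ * d)⁻¹ * (1 - κ * d)) + d * ((1 - κ * d)⁻¹ * (κ * d)) := by
          rw [inv_mul_cancel₀ hd, add_mul]; simp [mul_assoc]
      _ = d * (1 - κ * d)⁻¹ := by
          rw [← mul_add, ← mul_add]; simp
  have e : (1 + vV p q f * (1 - star p * q)⁻¹)⁻¹ * vV p q f = 1 - star p * f := by
    have := congrArg (fun x => (1 + vV p q f * (1 - star p * q)⁻¹)⁻¹ * x) this
    simp only [← mul_assoc, inv_mul_cancel₀ h1, one_mul] at this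
    simpa only [mul_assoc] using this.symm
  rw [rcv, e]
  simp [← mul_assoc, (q_unit hp).2]

theorem push {f p q φ : V4 → ℍ[ℝ]} (hfc : Continuous f) (hpc : Continuous p) (hqc : Continuous q)
    (hf : ∀ x, ‖f x‖ = 1) (hp : ∀ x, ‖p x‖ = 1) (hq : ∀ x, ‖q x‖ = 1) (hpq : ∀ x, p x ≠ q x)
    (hfq : ∀ x ∈ closedBall (0 : V4) 1, f x ≠ q x) (hfp : ∀ x, 1 ≤ ‖x‖ → f x ≠ p x)
    (hφ : ContinuousOn φ (closedBall 0 1)) (hφ0 : ∀ x ∈ closedBall (0 : V4) 1, φ x ≠ 0)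
    (hL : ∀ x ∈ sphere (0 : V4) 1, L2 (nrm (uU (p x) (q x) (f x))) (φ x)) :
    ∃ H : ℝ × V4 → ℍ[ℝ], ContinuousOn H (Icc 0 1 ×ˢ univ) ∧ (∀ t ∈ Icc (0 : ℝ) 1, ∀ x, ‖H (t, x)‖ = 1) ∧
      (∀ x, H (0, x) = f x) ∧ (∀ x, H (1, x) ≠ p x) ∧ ∀ t ∈ Icc (0 : ℝ) 1, ∀ x, 1 ≤ ‖x‖ → H (t, x) = f x := by
  let V : V4 → ℍ[ℝ] := fun x => vV (p x) (q x) (f x)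
  let κ : V4 → ℍ[ℝ] := fun x => (1 - star (p x) * q x)⁻¹
  let V1 : V4 → ℍ[ℝ] := fun x => -((‖V x‖ + 1 - ‖x‖) • (φ x * qi * (φ x)⁻¹))
  let W : ℝ × V4 → ℍ[ℝ] := fun y => (1 - y.1) • V y.2 + y.1 • V1 y.2
  let F : ℝ × V4 → ℍ[ℝ] := fun y => p y.2 * rcv (κ y.2) (W y)
  have hκ : ∀ x, (κ x).re = 1 / 2 := fun x => re_inv_half (norm_star_mul (hp x) (hq x)) (star_mul_ne_one (hp x) (hpq x).symm)
  have hκc : Continuous κ := by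
    apply Continuous.inv₀ (by fun_prop)
    intro x; exact sub_ne_zero.2 (star_mul_ne_one (hp x) (hpq x).symm).symm
  have hVc : ContinuousOn V (closedBall 0 1) := by
    apply ContinuousOn.mul (by fun_prop)
    apply ContinuousOn.inv₀ 
    · exact continuousOn_const.sub (hκc.continuousOn.mul (by fun_prop))
    · intro x hx
      exact vV_den (hp x) (hpq x) (hfq x hx)
  have hVre : ∀ x ∈ closedBall (0 : V4) 1, (V x).re = 0 := fun x hx => vV_re (hp x) (hq x) (hf x) (hpq x) (hfq x hx)
  have hqn : ∀ {a : ℍ[ℝ]}, a ≠ 0 → (a * qi * a⁻¹).re = 0 := by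
    intro a ha
    rw [q_inv]
    simp; right; ring
  have hqq : ∀ {a : ℍ[ℝ]}, a ≠ 0 → a * qi * a⁻¹ ≠ 0 := fun ha => mul_ne_zero (mul_ne_zero ha qi_ne) (inv_ne_zero ha)
  have hV1re : ∀ x ∈ closedBall (0 : V4) 1, (V1 x).re = 0 := by
    intro x hx
    have := hqn (hφ0 x hx)
    show (-((‖V x‖ + 1 - ‖x‖) • (φ x * qi * (φ x)⁻¹))).re = 0
    rw [Quaternion.re_neg, Quaternion.re_smul, this]; simp
  have hV1c : ContinuousOn V1 (closedBall 0 1) := by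
    have h1 : ContinuousOn (fun x => ‖V x‖ + 1 - ‖x‖) (closedBall (0 : V4) 1) := by fun_prop
    have h2 : ContinuousOn (fun x => φ x * qi * (φ x)⁻¹) (closedBall (0 : V4) 1) := (hφ.mul continuousOn_const).mul (hφ.inv₀ hφ0)
    exact (ContinuousOn.smul h1 h2).neg
  have hVne : ∀ x, f x ≠ p x → x ∈ closedBall (0 : V4) 1 → V x ≠ 0 := by
    intro x h hx
    show vV _ _ _ ≠ 0
    rw [vV_inv (hp x) h]
    exact inv_ne_zero (uU_mem (hp x) (hq x) (hf x) (hpq x) h (hfq x hx)).2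
  have hV1ne : ∀ x ∈ closedBall (0 : V4) 1, V1 x ≠ 0 := by
    intro x hx
    apply neg_ne_zero.2
    apply smul_ne_zero _ (hqq (hφ0 x hx))
    have hx' : ‖x‖ ≤ 1 := by simpa using hx
    rcases hx'.lt_or_eq with h | h
    · have := norm_nonneg (V x); intro h'; linarith
    · have := norm_pos_iff.2 (hVne x (hfp x h.ge) hx); intro h'; linarith
  have hWre : ∀ t, ∀ x ∈ closedBall (0 : V4) 1, (W (t, x)).re = 0 := by
    intro t x hx
    simp [W, hVre x hx, hV1re x hx]
  have hsph : ∀ t, ∀ x ∈ sphere (0 : V4) 1, W (t, x) = V x := by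
    intro t x hx
    have hx' : ‖x‖ = 1 := by simpa using hx
    have hxc := sphere_subset_closedBall hx
    have hfx := hfp x hx'.ge
    have : V1 x = V x := by
      have hl := hL x hx
      have hU := (uU_mem (hp x) (hq x) (hf x) (hpq x) hfx (hfq x hxc))
      have e1 : φ x * qi * (φ x)⁻¹ = nrm (uU (p x) (q x) (f x)) := by
        rw [hl.2, mul_assoc, mul_inv_cancel₀ hl.1, mul_one]
      show -((‖V x‖ + 1 - ‖x‖) • (φ x * qi * (φ x)⁻¹)) = V x
      rw [e1, hx']
      show -((‖vV _ _ _‖ + 1 - 1) • _) = vV _ _ _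
      rw [vV_inv (hp x) hfx, norm_inv, nrm, smul_smul, q_inv]
      set u := uU (p x) (q x) (f x)
      have : star u = -u := by
        ext <;> simp [hU.1]
      rw [this, smul_neg, add_sub_cancel_right]
      congr 2
      rw [sq, mul_inv]
    show (1 - t) • V x + t • V1 x = V x
    rw [this]; module
  have hWc : ContinuousOn W (Icc 0 1 ×ˢ closedBall 0 1) := by
    have a1 : ContinuousOn (fun y : ℝ × V4 => V y.2) (Icc 0 1 ×ˢ closedBall 0 1) := hVc.comp continuousOn_snd (fun y hy => hy.2)
    have a2 : ContinuousOn (fun y : ℝ × V4 => V1 y.2) (Icc 0 1 ×ˢ closedBall 0 1) := hV1c.comp continuousOn_snd (fun y hy => hy.2)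
    have a3 : ContinuousOn (fun y : ℝ × V4 => 1 - y.1) (Icc 0 1 ×ˢ closedBall 0 1) := by fun_prop
    exact (ContinuousOn.smul a3 a1).add (ContinuousOn.smul continuousOn_fst a2)
  have hFc : ContinuousOn F (Icc 0 1 ×ˢ closedBall 0 1) := by
    have b : ContinuousOn (fun y : ℝ × V4 => 1 + W y * κ y.2) (Icc 0 1 ×ˢ closedBall 0 1) := by
      have : Continuous (fun y : ℝ × V4 => κ y.2) := hκc.comp continuous_snd
      exact continuousOn_const.add (hWc.mul this.continuousOn)
    have b' := b.inv₀ (fun y hy => one_add_ne (hWre y.1 y.2 hy.2) (hκ y.2))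
    exact (hpc.comp continuous_snd).continuousOn.mul (continuousOn_const.sub (b'.mul hWc))
  have hF0 : ∀ x ∈ closedBall (0 : V4) 1, F (0, x) = f x := by
    intro x hx
    have : W (0, x) = V x := by simp [W]
    show p x * rcv (κ x) (W (0, x)) = f x
    rw [this]
    exact vV_rcv (hp x) (hq x) (hf x) (hpq x) (hfq x hx)
  have hFs : ∀ t, ∀ x ∈ sphere (0 : V4) 1, F (t, x) = f x := by
    intro t x hx
    show p x * rcv (κ x) (W (t, x)) = f x
    rw [hsph t x hx]
    exact vV_rcv (hp x) (hq x) (hf x) (hpq x) (hfq x (sphere_subset_closedBall hx))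
  classical
  refine ⟨fun y => if ‖y.2‖ ≤ 1 then F y else f y.2, ?_, ?_, ?_, ?_, ?_⟩
  · have c1 : ContinuousOn (fun y : ℝ × V4 => if ‖y.2‖ ≤ 1 then F y else f y.2) (Icc 0 1 ×ˢ closedBall 0 1) := by
      refine hFc.congr fun y hy => ?_
      have : ‖y.2‖ ≤ 1 := by simpa using hy.2
      simp [this]
    have c2 : ContinuousOn (fun y : ℝ × V4 => if ‖y.2‖ ≤ 1 then F y else f y.2) (Icc 0 1 ×ˢ {x | 1 ≤ ‖x‖}) := by
      refine ((hfc.comp continuous_snd).continuousOn).congr fun y hy => ?_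
      have h1 : 1 ≤ ‖y.2‖ := hy.2
      by_cases h : ‖y.2‖ ≤ 1
      · simp only [h, if_true]
        exact hFs y.1 y.2 (by simpa using le_antisymm h h1)
      · simp [h]
    have := c1.union_of_isClosed c2 (isClosed_Icc.prod isClosed_closedBall) (isClosed_Icc.prod (isClosed_le continuous_const continuous_norm))
    refine this.mono ?_
    rintro ⟨t, x⟩ ⟨ht, -⟩
    rcases le_total ‖x‖ 1 with h | h
    · left; exact ⟨ht, by simpa using h⟩
    · right; exact ⟨ht, h⟩
  · intro t ht x
    by_cases h : ‖x‖ ≤ 1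
    · simp only [h, if_true]
      show ‖p x * rcv (κ x) (W (t, x))‖ = 1
      rw [norm_mul, hp, rcv_norm (hWre t x (by simpa using h)) (hκ x), one_mul]
    · simp [h, hf]
  · intro x
    by_cases h : ‖x‖ ≤ 1
    · simp only [h, if_true]; exact hF0 x (by simpa using h)
    · simp [h]
  · intro x
    by_cases h : ‖x‖ ≤ 1
    · simp only [h, if_true]
      have hx : x ∈ closedBall (0 : V4) 1 := by simpa using h
      show p x * rcv (κ x) (W (1, x)) ≠ p x
      intro h'
      have h1 : W (1, x) ≠ 0 := by
        have : W (1, x) = V1 x := by simp [W]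
        rw [this]; exact hV1ne x hx
      apply rcv_ne (hWre 1 x hx) (hκ x) h1
      have := congrArg (fun y => star (p x) * y) h'
      simpa [← mul_assoc, (q_unit (hp x)).1] using this
    · simp only [h, if_false]; exact hfp x (le_of_not_ge h)
  · intro t ht x hx
    by_cases h : ‖x‖ ≤ 1
    · simp only [h, if_true]; exact hFs t x (by simpa using le_antisymm h hx)
    · simp [h]

end

section 
open Set Metric Filter Topology
open scoped Quaternion

theorem qd_of_hom {c : V4} {r : ℝ} (hr : 0 < r) {U₀ U₁ φ₀ φ₁ : V4 → ℍ[ℝ]} (h : HomOn (sphere c r) T2 U₀ U₁)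
    (h0 : ContinuousOn φ₀ (sphere c r)) (h1 : ContinuousOn φ₁ (sphere c r))
    (l0 : ∀ z ∈ sphere c r, L2 (U₀ z) (φ₀ z)) (l1 : ∀ z ∈ sphere c r, L2 (U₁ z) (φ₁ z)) : qd φ₀ c r = qd φ₁ c r :=
  qd_hom hr (lift_homotopic (isCompact_sphere c r) (sphere_PL1 c hr) h h0 h1 l0 l1)

theorem const_path {Z : Set V4} {a b : ℍ[ℝ]} (ha : a ≠ 0) (hb : b ≠ 0) : HomOn Z {0}ᶜ (fun _ => a) (fun _ => b) := by
  have hr : 1 < Module.rank ℝ ℍ[ℝ] := by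
    rw [Quaternion.rank_eq_four]; norm_num
  have := (isPathConnected_compl_singleton_of_one_lt_rank hr (0 : ℍ[ℝ])).joinedIn a ha b hb
  refine ⟨fun y => this.somePath.extend y.1, ?_, ?_, ?_, ?_⟩
  · exact (this.somePath.continuous_extend.comp continuous_fst).continuousOn
  · intro t ht x hx
    show this.somePath.extend t ∈ _
    rw [Path.extend_apply _ ht]
    exact this.somePath_mem _
  · intro x hx; simp
  · intro x hx; simp

theorem HomOn.mul {Z : Set V4} {a b c d : V4 → ℍ[ℝ]} (h : HomOn Z {0}ᶜ a b) (h' : HomOn Z {0}ᶜ c d) :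
    HomOn Z {0}ᶜ (fun x => a x * c x) (fun x => b x * d x) := by
  obtain ⟨H, h1, h2, h3, h4⟩ := h
  obtain ⟨H', h1', h2', h3', h4'⟩ := h'
  exact ⟨fun y => H y * H' y, h1.mul h1', fun t ht x hx => mul_ne_zero (h2 t ht x hx) (h2' t ht x hx),
    fun x hx => by simp only [h3 x hx, h3' x hx], fun x hx => by simp only [h4 x hx, h4' x hx]⟩

theorem qd_swap {c : V4} {r : ℝ} (hr : 0 < r) {a φ : V4 → ℍ[ℝ]} (ha : Continuous a) (ha0 : ∀ x, a x ≠ 0)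
    (hφ : ContinuousOn φ (sphere c r)) (h0 : ∀ x ∈ sphere c r, φ x ≠ 0) :
    qd (fun x => a x * φ x * qj) c r = qd φ c r := by
  apply qd_hom hr
  have e1 : HomOn (sphere c r) {0}ᶜ a (fun _ => a c) :=
    ⟨fun y => a (c + (1 - y.1) • (y.2 - c)), by fun_prop, fun t ht x hx => ha0 _, fun x hx => by simp, fun x hx => by simp⟩
  have e2 := e1.trans (const_path (ha0 c) one_ne_zero)
  have e3 := HomOn.mul (HomOn.mul e2 (HomOn.refl hφ h0)) (const_path qj_ne one_ne_zero)
  simpa using e3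

theorem qd_far {R : ℝ} (hR : 0 < R) {U φ : V4 → ℍ[ℝ]} {u : ℍ[ℝ]} (hU : ContinuousOn U (sphere 0 R))
    (hT : ∀ x ∈ sphere (0 : V4) R, U x ∈ TI) (hu : u ∈ TI) (hc : ∀ x ∈ sphere (0 : V4) R, ‖U x - u‖ < ‖u‖)
    (hφ : ContinuousOn φ (sphere 0 R)) (hL : ∀ x ∈ sphere (0 : V4) R, L2 (nrm (U x)) (φ x)) : qd φ 0 R = 0 := by
  obtain ⟨ψ, hψ⟩ := trans2.ex (nrm u) (nrm_mem hu)
  have hh : HomOn (sphere (0 : V4) R) TI U (fun _ => u) := by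
    apply HomOn.linear hU continuousOn_const
    intro t ht x hx
    refine ⟨by simp [(hT x hx).1, hu.1], fun h => ?_⟩
    have : u = -((1 - t) • (U x - u)) := by
      have : (1 - t) • U x + t • u = u + (1 - t) • (U x - u) := by module
      rw [this] at h
      exact eq_neg_of_add_eq_zero_left h
    have h2 : ‖u‖ ≤ ‖U x - u‖ := by
      conv_lhs => rw [this]
      rw [norm_neg, norm_smul, Real.norm_of_nonneg (by linarith [ht.2])]
      have := norm_nonneg (U x - u)
      nlinarith [ht.1]
    exact absurd (hc x hx) (not_lt.2 h2)
  rw [qd_of_hom hR hh.nrm hφ continuousOn_const hL (φ₁ := fun _ => ψ) (fun z hz => hψ)]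
  exact qd_zero hR continuousOn_const (fun x hx => hψ.1)

theorem near_open {f p q : V4 → ℍ[ℝ]} (hfc : Continuous f) (hpc : Continuous p) (hqc : Continuous q)
    (hp : ∀ x, ‖p x‖ = 1) (hpq : ∀ x, p x ≠ q x) : IsOpen {x | near (p x) (q x) (f x)} := by
  have hκc : Continuous (fun x => (1 - star (p x) * q x)⁻¹) := by
    apply Continuous.inv₀ (by fun_prop)
    intro x; exact sub_ne_zero.2 (star_mul_ne_one (hp x) (hpq x).symm).symm
  have h1 : Continuous (fun x => ((1 - star (p x) * q x)⁻¹).im) := Quaternion.continuous_im.comp hκc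
  have h2 : Continuous (fun x => (star (p x) * f x).re) := Quaternion.continuous_re.comp (by fun_prop)
  unfold near
  exact isOpen_lt (by fun_prop) (by fun_prop)

theorem near_of_eq {p q f : ℍ[ℝ]} (hp : ‖p‖ = 1) (h : f = p) : near p q f := by
  unfold near
  rw [h, (q_unit hp).1]; simp

theorem T3core {f : V4 → ℍ[ℝ]} {g : Fin 3 → V4 → ℍ[ℝ]} (hfc : Continuous f) (hgc : ∀ i, Continuous (g i))
    (hf : ∀ x, ‖f x‖ = 1) (hg : ∀ i x, ‖g i x‖ = 1) (hgg : ∀ i j, i ≠ j → ∀ x, g i x ≠ g j x)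
    {f' : ℍ[ℝ]} {g' : Fin 3 → ℍ[ℝ]} (tf : Tendsto f (cocompact V4) (𝓝 f')) (tg : ∀ i, Tendsto (g i) (cocompact V4) (𝓝 (g' i)))
    (hfg' : ∀ i, f' ≠ g' i) (hgg' : ∀ i j, i ≠ j → g' i ≠ g' j)
    (C : Fin 3 → Finset V4) (hC : ∀ i x, f x = g i x ↔ x ∈ C i)
    (hs : ∀ i j, ∀ x ∈ C i, ∀ y ∈ C j, x ≠ y → x.2 ≠ y.2)
    (hC0 : ∀ x ∈ C 0, ‖x‖ < 1) (hC1 : ∀ i, i ≠ 0 → ∀ x ∈ C i, 1 < ‖x‖) :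
    ∃ H : ℝ × V4 → ℍ[ℝ], ContinuousOn H (Icc 0 1 ×ˢ univ) ∧ (∀ t ∈ Icc (0 : ℝ) 1, ∀ x, ‖H (t, x)‖ = 1) ∧
      (∀ x, H (0, x) = f x) ∧ (∀ x, H (1, x) ≠ g 0 x) ∧ ∀ t ∈ Icc (0 : ℝ) 1, ∀ x, 1 ≤ ‖x‖ → H (t, x) = f x := by
  classical
  -- choose epsilon
  have lt_ev : ∀ a : ℝ, 0 < a → ∀ᶠ ε in 𝓝[>] (0 : ℝ), 2 * ε < a := by
    intro a ha
    filter_upwards [Ioo_mem_nhdsGT (show (0 : ℝ) < a / 2 by linarith)] with ε hε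
    linarith [hε.2]
  have ev : ∀ᶠ ε in 𝓝[>] (0 : ℝ), 0 < ε ∧ (∀ i j, ∀ x ∈ C i, ∀ y ∈ C j, x ≠ y → 2 * ε < |x.2 - y.2|) ∧
      (∀ i j, i ≠ j → ∀ x ∈ C i, closedBall x ε ⊆ {y | near (g i y) (g j y) (f y)}) ∧
      (∀ x ∈ C 0, 2 * ε < 1 - ‖x‖) ∧ (∀ i, i ≠ 0 → ∀ x ∈ C i, 2 * ε < ‖x‖ - 1) := by
    refine Filter.Eventually.and self_mem_nhdsWithin (Filter.Eventually.and ?_ (Filter.Eventually.and ?_ (Filter.Eventually.and ?_ ?_)))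
    · simp only [Filter.eventually_all, Filter.eventually_all_finset]
      intro i j x hx y hy hxy
      exact lt_ev _ (abs_pos.2 (sub_ne_zero.2 (hs i j x hx y hy hxy)))
    · simp only [Filter.eventually_all, Filter.eventually_all_finset]
      intro i j hij x hx
      obtain ⟨δ, hδ, hb⟩ := Metric.isOpen_iff.1 (near_open hfc (hgc i) (hgc j) (hg i) (hgg i j hij)) x (near_of_eq (hg i x) ((hC i x).2 hx))
      filter_upwards [lt_ev δ hδ, self_mem_nhdsWithin] with ε hε hε0
      exact (closedBall_subset_ball (by simp at hε0; linarith)).trans hb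
    · simp only [Filter.eventually_all_finset]
      intro x hx
      exact lt_ev _ (by linarith [hC0 x hx])
    · simp only [Filter.eventually_all, Filter.eventually_all_finset]
      intro i hi x hx
      exact lt_ev _ (by linarith [hC1 i hi x hx])
  obtain ⟨ε, hε, hsep, hnear, hin, hout⟩ := ev.exists
  -- choose R
  have hf' : ‖f'‖ = 1 := by
    have := tf.norm
    simp only [hf] at this
    exact (tendsto_nhds_unique this tendsto_const_nhds)
  have hg' : ∀ i, ‖g' i‖ = 1 := by
    intro i
    have := (tg i).norm
    simp only [hg] at this
    exact (tendsto_nhds_unique this tendsto_const_nhds)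
  have hUT : ∀ i j, i ≠ j → uU (g' i) (g' j) f' ∈ TI := fun i j hij => uU_mem (hg' i) (hg' j) hf' (hgg' i j hij) (hfg' i) (hfg' j)
  have tU : ∀ i j, i ≠ j → Tendsto (fun x => uU (g i x) (g j x) (f x)) (cocompact V4) (𝓝 (uU (g' i) (g' j) f')) := by
    intro i j hij
    unfold uU
    have s1 : Tendsto (fun x => star (g i x)) (cocompact V4) (𝓝 (star (g' i))) := (continuous_star.tendsto _).comp (tg i)
    refine Tendsto.sub ?_ ?_
    · exact (tendsto_const_nhds.sub (s1.mul tf)).inv₀ (sub_ne_zero.2 (star_mul_ne_one (hg' i) (hfg' i)).symm)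
    · exact (tendsto_const_nhds.sub (s1.mul (tg j))).inv₀ (sub_ne_zero.2 (star_mul_ne_one (hg' i) (hgg' i j hij).symm).symm)
  have evR : ∀ᶠ x in Bornology.cobounded V4, ∀ i j, i ≠ j → ‖uU (g i x) (g j x) (f x) - uU (g' i) (g' j) f'‖ < ‖uU (g' i) (g' j) f'‖ := by
    simp only [Filter.eventually_all, Metric.cobounded_eq_cocompact]
    intro i j hij
    have := (Metric.tendsto_nhds.1 (tU i j hij)) _ (norm_pos_iff.2 (hUT i j hij).2)
    simpa [dist_eq_norm] using this
  obtain ⟨R0, -, hR0⟩ := (Filter.hasBasis_cobounded_norm.eventually_iff).1 evR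
  obtain ⟨R, hRR, hR1, hRC⟩ : ∃ R : ℝ, R0 ≤ R ∧ 1 < R ∧ ∀ i, ∀ x ∈ C i, ‖x‖ + ε < R := by
    have : ∀ᶠ R : ℝ in atTop, R0 ≤ R ∧ 1 < R ∧ ∀ i, ∀ x ∈ C i, ‖x‖ + ε < R := by
      refine (eventually_ge_atTop _).and ((eventually_gt_atTop _).and ?_)
      simp only [Filter.eventually_all, Filter.eventually_all_finset]
      intro i x hx
      exact eventually_gt_atTop _
    exact this.exists
  have hRpos : 0 < R := by linarith
  let D : Fin 3 → Fin 3 → Set V4 := fun i j => closedBall (0 : V4) R \ ⋃ x ∈ C i ∪ C j, ball x ε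
  have mC : ∀ {i j x}, x ∈ C i ∪ C j → ∃ k, x ∈ C k := by
    intro i j x hx
    rcases Finset.mem_union.1 hx with h | h
    exacts [⟨_, h⟩, ⟨_, h⟩]
  have hDfi : ∀ i j, ∀ x ∈ D i j, f x ≠ g i x := by
    intro i j x hx h
    exact hx.2 (mem_biUnion (Finset.mem_coe.2 (Finset.mem_union_left _ ((hC i x).1 h))) (mem_ball_self hε))
  have hDsymm : ∀ i j, D i j = D j i := by
    intro i j; simp only [D, Finset.union_comm]
  have hDfj : ∀ i j, ∀ x ∈ D i j, f x ≠ g j x := by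
    intro i j x hx; rw [hDsymm] at hx; exact hDfi j i x hx
  have hUD : ∀ i j, i ≠ j → ∀ x ∈ D i j, uU (g i x) (g j x) (f x) ∈ TI := fun i j hij x hx =>
    uU_mem (hg i x) (hg j x) (hf x) (hgg i j hij x) (hDfi i j x hx) (hDfj i j x hx)
  have hUDc : ∀ i j, i ≠ j → ContinuousOn (fun x => uU (g i x) (g j x) (f x)) (D i j) := fun i j hij =>
    uU_cont (hgc i).continuousOn (hgc j).continuousOn hfc.continuousOn (fun x _ => hg i x) (fun x _ => hgg i j hij x) (hDfi i j)
  have exφ : ∀ i j, ∃ φ : V4 → ℍ[ℝ], i ≠ j → ContinuousOn φ (D i j) ∧ ∀ x ∈ D i j, L2 (nrm (uU (g i x) (g j x) (f x))) (φ x) := by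
    intro i j
    by_cases hij : i = j
    · exact ⟨0, fun h => absurd hij h⟩
    have := mball_PL2 (C i ∪ C j) id hε hRpos.le (R := R) ?_ ?_
    · obtain ⟨φ, h⟩ := this (fun x => nrm (uU (g i x) (g j x) (f x))) (nrm_cont.comp (hUDc i j hij) (fun x hx => (hUD i j hij x hx).2))
        (fun x hx => nrm_mem (hUD i j hij x hx))
      exact ⟨φ, fun _ => h⟩
    · intro x hx
      obtain ⟨k, hk⟩ := mC hx
      exact (hRC k x hk).le
    · intro x hx y hy hxy
      obtain ⟨k, hk⟩ := mC hx
      obtain ⟨l, hl⟩ := mC hy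
      exact (hsep k l x hk y hl hxy).le
  choose φ hφ using exφ
  have snd_le : ∀ x y : V4, |x.2 - y.2| ≤ dist x y := by
    intro x y
    rw [← Real.dist_eq, Prod.dist_eq]; exact le_max_right _ _
  have hsphD : ∀ i j, ∀ c ∈ C i ∪ C j, sphere c ε ⊆ D i j := by
    intro i j c hc z hz
    obtain ⟨k, hk⟩ := mC hc
    refine ⟨?_, ?_⟩
    · have h1 := hRC k c hk
      have h2 : dist z c = ε := hz
      rw [mem_closedBall]
      have := dist_triangle z c 0
      rw [dist_zero_right c] at this
      linarith
    · intro h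
      simp only [mem_iUnion, exists_prop] at h
      obtain ⟨y, hy, hzy⟩ := h
      obtain ⟨l, hl⟩ := mC hy
      have h2 : dist z c = ε := hz
      by_cases hcy : c = y
      · rw [← hcy, mem_ball] at hzy; linarith
      · have h3 := hsep k l c hk y hl hcy
        have h4 := snd_le c y
        have := dist_triangle c z y
        rw [dist_comm c z] at this
        rw [mem_ball] at hzy
        linarith
  have hdisj : ∀ i j, ∀ x ∈ C i ∪ C j, ∀ y ∈ C i ∪ C j, x ≠ y → Disjoint (closedBall x ε) (closedBall y ε) := by
    intro i j x hx y hy hxy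
    obtain ⟨k, hk⟩ := mC hx
    obtain ⟨l, hl⟩ := mC hy
    apply closedBall_disjoint_closedBall
    have := hsep k l x hk y hl hxy
    have := snd_le x y
    linarith
  have hsubR : ∀ i j, ∀ x ∈ C i ∪ C j, closedBall x ε ⊆ ball (0 : V4) R := by
    intro i j x hx z hz
    obtain ⟨k, hk⟩ := mC hx
    have := hRC k x hk
    rw [mem_closedBall] at hz
    rw [mem_ball]
    have h3 := dist_triangle z x 0
    rw [dist_zero_right x] at h3
    linarith
  have hsphR : ∀ i j, sphere (0 : V4) R ⊆ D i j := by
    intro i j z hz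
    refine ⟨sphere_subset_closedBall hz, fun h => ?_⟩
    simp only [mem_iUnion, exists_prop] at h
    obtain ⟨y, hy, hzy⟩ := h
    have := hsubR i j y hy (ball_subset_closedBall hzy)
    rw [mem_ball, mem_sphere.1 hz] at this
    exact lt_irrefl _ this
  have htot : ∀ i j, i ≠ j → ∑ x ∈ C i ∪ C j, qd (φ i j) x ε = 0 := by
    intro i j hij
    obtain ⟨h1, h2⟩ := hφ i j hij
    refine (qd_additive (C i ∪ C j) hRpos id (fun _ => ε) (fun _ _ => hε) (hsubR i j) (hdisj i j) h1 (fun x hx => (h2 x hx).1)).symm.trans ?_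
    refine qd_far hRpos ((hUDc i j hij).mono (hsphR i j)) (fun x hx => hUD i j hij x (hsphR i j hx)) (hUT i j hij) ?_ (h1.mono (hsphR i j)) (fun x hx => h2 x (hsphR i j hx))
    intro x hx
    have : ‖x‖ = R := by simpa using hx
    exact hR0 (show R0 ≤ ‖x‖ by rw [this]; exact hRR) i j hij
  have hswap : ∀ i j, i ≠ j → ∀ c ∈ C i ∪ C j, qd (φ i j) c ε = qd (φ j i) c ε := by
    intro i j hij c hc
    have hc' : c ∈ C j ∪ C i := by rwa [Finset.union_comm]
    obtain ⟨h1, h2⟩ := hφ i j hij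
    obtain ⟨h3, h4⟩ := hφ j i hij.symm
    have s1 := hsphD i j c hc
    have s2 := hsphD j i c hc'
    have ha : Continuous (fun x => 1 - star (g i x) * g j x) := by
      have := hgc i; have := hgc j; fun_prop
    have hac : ∀ x, 1 - star (g i x) * g j x ≠ 0 := fun x => sub_ne_zero.2 (star_mul_ne_one (hg i x) (hgg i j hij x).symm).symm
    rw [← qd_swap hε ha hac (h3.mono s2) (fun x hx => (h4 x (s2 hx)).1)]
    have hcc : ContinuousOn (fun x => nrm (uU (g i x) (g j x) (f x))) (sphere c ε) :=
      (nrm_cont.comp (hUDc i j hij) (fun x hx => (hUD i j hij x hx).2)).mono s1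
    refine qd_of_hom hε (HomOn.refl hcc (fun x hx => nrm_mem (hUD i j hij x (s1 hx)))) (h1.mono s1) ?_ (fun x hx => h2 x (s1 hx)) ?_
    · exact (ha.continuousOn.mul (h3.mono s2)).mul continuousOn_const
    · intro x hx
      exact swap_lift (hg i x) (hg j x) (hf x) (hgg i j hij x) (hDfi i j x (s1 hx)) (hDfj i j x (s1 hx)) (h4 x (s2 hx))
  have hnr : ∀ i j k, i ≠ j → i ≠ k → ∀ c ∈ C i, qd (φ i j) c ε = qd (φ i k) c ε := by
    intro i j k hij hik c hc
    obtain ⟨h1, h2⟩ := hφ i j hij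
    obtain ⟨h3, h4⟩ := hφ i k hik
    have s1 := hsphD i j c (Finset.mem_union_left _ hc)
    have s2 := hsphD i k c (Finset.mem_union_left _ hc)
    have e : ∀ l, i ≠ l → HomOn (sphere c ε) T2 (fun x => nrm (uU (g i x) (g l x) (f x))) (fun x => nrm ((star (g i x) * f x).im)) := by
      intro l hl
      have s := hsphD i l c (Finset.mem_union_left _ hc)
      exact near_hom (hgc i).continuousOn (hgc l).continuousOn hfc.continuousOn (fun x _ => hg i x) (fun x _ => hg l x) (fun x _ => hf x)
        (fun x _ => hgg i l hl x) (fun x hx => hDfi i l x (s hx)) (fun x hx => hnear i l hl c hc (sphere_subset_closedBall hx))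
    exact qd_of_hom hε ((e j hij).trans (e k hik).symm) (h1.mono s1) (h3.mono s2) (fun x hx => h2 x (s1 hx)) (fun x hx => h4 x (s2 hx))
  have hCdis : ∀ i j, i ≠ j → Disjoint (C i) (C j) := by
    intro i j hij
    rw [Finset.disjoint_left]
    intro x hx hy
    exact hgg i j hij x (((hC i x).2 hx).symm.trans ((hC j x).2 hy))
  let n : Fin 3 → Fin 3 → ℝ := fun i j => ∑ x ∈ C i, qd (φ i j) x ε
  have n1 : ∀ i j, i ≠ j → n i j + n j i = 0 := by
    intro i j hij
    have := htot i j hij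
    rw [Finset.sum_union (hCdis i j hij)] at this
    rw [← this]
    congr 1
    apply Finset.sum_congr rfl
    intro c hc
    exact (hswap i j hij c (Finset.mem_union_right _ hc)).symm
  have n2 : ∀ i j k, i ≠ j → i ≠ k → n i j = n i k := fun i j k hij hik => Finset.sum_congr rfl (fun c hc => hnr i j k hij hik c hc)
  have n01 : n 0 1 = 0 := by
    have a1 := n1 0 1 (by decide)
    have a2 := n1 0 2 (by decide)
    have a3 := n1 1 2 (by decide)
    have b1 := n2 0 1 2 (by decide) (by decide)
    have b2 := n2 1 0 2 (by decide) (by decide)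
    have b3 := n2 2 0 1 (by decide) (by decide)
    linarith
  obtain ⟨h1, h2⟩ := hφ 0 1 (by decide)
  have hB : closedBall (0 : V4) 1 \ ⋃ x ∈ C 0, ball x ε ⊆ D 0 1 := by
    rintro z ⟨hz, hz'⟩
    refine ⟨closedBall_subset_closedBall hR1.le hz, fun h => ?_⟩
    simp only [mem_iUnion, exists_prop] at h hz'
    obtain ⟨y, hy, hzy⟩ := h
    rcases Finset.mem_union.1 hy with hy | hy
    · exact hz' ⟨y, hy, hzy⟩
    · have q1 := hout 1 (by decide) y hy
      rw [mem_ball, dist_comm] at hzy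
      rw [mem_closedBall] at hz
      have := dist_triangle y z 0
      rw [dist_zero_right y] at this
      linarith
  have hin' : ∀ x ∈ C 0, closedBall x ε ⊆ ball (0 : V4) 1 := by
    intro x hx z hz
    have q1 := hin x hx
    rw [mem_closedBall] at hz
    rw [mem_ball]
    have := dist_triangle z x 0
    rw [dist_zero_right x] at this
    linarith
  have hS1 : sphere (0 : V4) 1 ⊆ D 0 1 := by
    intro z hz
    apply hB
    refine ⟨sphere_subset_closedBall hz, fun h => ?_⟩
    simp only [mem_iUnion, exists_prop] at h
    obtain ⟨y, hy, hzy⟩ := h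
    have := hin' y hy (ball_subset_closedBall hzy)
    rw [mem_ball, mem_sphere.1 hz] at this
    exact lt_irrefl _ this
  have hz : qd (φ 0 1) 0 1 = 0 := by
    rw [qd_additive (C 0) one_pos id (fun _ => ε) (fun _ _ => hε) hin'
      (fun x hx y hy => hdisj 0 0 x (Finset.mem_union_left _ hx) y (Finset.mem_union_left _ hy)) (h1.mono hB) (fun x hx => (h2 x (hB hx)).1)]
    exact n01
  obtain ⟨ψ, p1, p2, p3⟩ := q_extend (h1.mono hS1) (fun x hx => (h2 x (hS1 hx)).1) hz
  refine push hfc (hgc 0) (hgc 1) hf (hg 0) (hg 1) (hgg 0 1 (by decide)) ?_ ?_ p1 p2 ?_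
  · intro x hx h
    have q1 := hout 1 (by decide) x ((hC 1 x).1 h)
    have : ‖x‖ ≤ 1 := by simpa using hx
    linarith
  · intro x hx h
    have q1 := hC0 x ((hC 0 x).1 h)
    linarith
  · intro x hx
    rw [p3 x hx]
    exact h2 x (hS1 hx)

end

section 
open Set Metric Filter Topology
open scoped Quaternion

theorem tilt (A : Finset V4) : ∃ h : V4 ≃ₜ V4, ∀ x ∈ A, ∀ y ∈ A, x ≠ y → (h x).2 ≠ (h y).2 := by
  classical
  let P : V4 → Polynomial ℝ := fun d => Polynomial.C d.2 + Polynomial.C d.1.1.1 * Polynomial.X + Polynomial.C d.1.1.2 * Polynomial.X ^ 2 + Polynomial.C d.1.2 * Polynomial.X ^ 3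
  have hP : ∀ d : V4, d ≠ 0 → P d ≠ 0 := by
    intro d hd h
    apply hd
    have c0 := congrArg (fun p => Polynomial.coeff p 0) h
    have c1 := congrArg (fun p => Polynomial.coeff p 1) h
    have c2 := congrArg (fun p => Polynomial.coeff p 2) h
    have c3 := congrArg (fun p => Polynomial.coeff p 3) h
    simp [P, Polynomial.coeff_X, Polynomial.coeff_X_pow, Polynomial.coeff_C] at c0 c1 c2 c3
    obtain ⟨⟨⟨a, b⟩, c⟩, t⟩ := d
    simp at c0 c1 c2 c3
    simp [c0, c1, c2, c3]
  obtain ⟨s, hs⟩ := Infinite.exists_notMem_finset (A.biUnion fun x => A.biUnion fun y => (P (x - y)).roots.toFinset)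
  let l : V3 → ℝ := fun a => a.1.1 * s + a.1.2 * s ^ 2 + a.2 * s ^ 3
  have hl : Continuous l := by fun_prop
  refine ⟨⟨⟨fun x => (x.1, x.2 + l x.1), fun x => (x.1, x.2 - l x.1), fun x => by simp, fun x => by simp⟩, by fun_prop, by fun_prop⟩, ?_⟩
  intro x hx y hy hxy h
  apply hs
  simp only [Finset.mem_biUnion]
  refine ⟨x, hx, y, hy, ?_⟩
  rw [Multiset.mem_toFinset, Polynomial.mem_roots (hP _ (sub_ne_zero.2 hxy))]
  have h' : x.2 + l x.1 = y.2 + l y.1 := h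
  simp only [l] at h'
  simp [P]
  linarith

theorem exists_sigma (A : Finset V4) (hA : ∀ x ∈ A, ∀ y ∈ A, x ≠ y → x.2 ≠ y.2) (val : V4 → V3) :
    ∃ σ : ℝ → V3, Continuous σ ∧ ∀ a ∈ A, σ a.2 = val a := by
  have hi : InjOn (Prod.snd : V4 → ℝ) (A : Set V4) := by
    intro x hx y hy h
    by_contra hne
    exact hA x hx y hy hne h
  have hfin : (Prod.snd '' (A : Set V4)).Finite := A.finite_toSet.image _
  obtain ⟨σ, h1, h2⟩ := tietze_fd hfin.isClosed (hfin.continuousOn (fun t => val (Function.invFunOn Prod.snd (A : Set V4) t)))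
  refine ⟨σ, h1, fun a ha => ?_⟩
  rw [h2 a.2 (mem_image_of_mem _ ha), hi.leftInvOn_invFunOn ha]

theorem arrange {E : Type*} [NormedAddCommGroup E] [NormedSpace ℝ E] [FiniteDimensional ℝ E] [DecidableEq E] (hE : Module.finrank ℝ E = 4)
    (A B : Finset E) (hAB : Disjoint A B) :
    ∃ h : E ≃ₜ V4, (∀ x ∈ A, ‖h x‖ < 1) ∧ (∀ x ∈ B, 1 < ‖h x‖) ∧ ∀ x ∈ A ∪ B, ∀ y ∈ A ∪ B, x ≠ y → (h x).2 ≠ (h y).2 := by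
  classical
  have hd : Module.finrank ℝ E = Module.finrank ℝ V4 := by
    rw [hE]; simp
  let L := (ContinuousLinearEquiv.ofFinrankEq hd).toHomeomorph
  obtain ⟨k, hk⟩ := tilt ((A ∪ B).image L)
  let m := L.trans k
  have hm : ∀ x ∈ A ∪ B, ∀ y ∈ A ∪ B, x ≠ y → (m x).2 ≠ (m y).2 := by
    intro x hx y hy hxy
    exact hk (L x) (Finset.mem_image_of_mem _ hx) (L y) (Finset.mem_image_of_mem _ hy) (fun h => hxy (L.injective h))
  let e : V3 := ((3, 0), 0)
  have he : ‖e‖ = 3 := by simp [e]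
  obtain ⟨σ, hσ, hσA⟩ := exists_sigma ((A ∪ B).image m) (by
    intro x hx y hy hxy
    obtain ⟨a, ha, rfl⟩ := Finset.mem_image.1 hx
    obtain ⟨b, hb, rfl⟩ := Finset.mem_image.1 hy
    exact hm a ha b hb (fun h => hxy (by rw [h]))) (fun z => if m.symm z ∈ A then z.1 else z.1 - e)
  obtain ⟨δ, hδ, hδA⟩ : ∃ δ : ℝ, 0 < δ ∧ ∀ x ∈ A, δ * |(m x).2| < 1 := by
    have : ∀ᶠ δ in 𝓝[>] (0 : ℝ), 0 < δ ∧ ∀ x ∈ A, δ * |(m x).2| < 1 := by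
      refine Filter.Eventually.and self_mem_nhdsWithin ?_
      simp only [Filter.eventually_all_finset]
      intro x hx
      have : Tendsto (fun δ : ℝ => δ * |(m x).2|) (𝓝[>] 0) (𝓝 (0 * |(m x).2|)) :=
        ((continuous_id.mul continuous_const).tendsto (0 : ℝ)).mono_left nhdsWithin_le_nhds
      rw [zero_mul] at this
      exact this.eventually (gt_mem_nhds one_pos)
    exact this.exists
  let w : V4 ≃ₜ V4 := ⟨⟨fun x => (x.1 - σ x.2, δ * x.2), fun x => (x.1 + σ (δ⁻¹ * x.2), δ⁻¹ * x.2),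
    fun x => by simp [inv_mul_cancel_left₀ hδ.ne'], fun x => by simp [mul_inv_cancel_left₀ hδ.ne']⟩, by fun_prop, by fun_prop⟩
  have hw : ∀ x, w x = (x.1 - σ x.2, δ * x.2) := fun x => rfl
  refine ⟨m.trans w, ?_, ?_, ?_⟩
  · intro x hx
    show ‖w (m x)‖ < 1
    rw [hw, hσA (m x) (Finset.mem_image_of_mem _ (Finset.mem_union_left _ hx))]
    simp only [Homeomorph.symm_apply_apply, hx, if_true, sub_self, Prod.norm_mk, norm_zero, norm_mul, Real.norm_eq_abs, abs_of_pos hδ]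
    exact max_lt one_pos (hδA x hx)
  · intro x hx
    have hxA : x ∉ A := fun h => (Finset.disjoint_left.1 hAB h hx)
    show 1 < ‖w (m x)‖
    rw [hw, hσA (m x) (Finset.mem_image_of_mem _ (Finset.mem_union_right _ hx))]
    simp only [Homeomorph.symm_apply_apply, hxA, if_false, sub_sub_cancel, Prod.norm_mk, he]
    exact lt_max_of_lt_left (by norm_num)
  · intro x hx y hy hxy
    show (w (m x)).2 ≠ (w (m y)).2
    rw [hw, hw]
    intro h
    exact hm x hx y hy hxy (mul_left_cancel₀ hδ.ne' h)

abbrev S4 : Type := Metric.sphere (0 : EuclideanSpace ℝ (Fin (4 + 1))) 1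

theorem sph_infinite : Infinite S4 := by
  have hr : 1 < Module.rank ℝ (EuclideanSpace ℝ (Fin (4 + 1))) := by
    rw [← Module.finrank_eq_rank]; simp
  have h := isPreconnected_sphere hr 0 1
  rw [Set.infinite_coe_iff]
  apply h.infinite_of_nontrivial
  refine ⟨EuclideanSpace.single 0 1, by simp, -EuclideanSpace.single 0 1, by simp, ?_⟩
  intro h
  have := congrArg (fun v => v 0) h
  simp at this
  norm_num at this

theorem T3a {f : S4 → ℍ[ℝ]} {g : Fin 3 → S4 → ℍ[ℝ]} (hfc : Continuous f) (hgc : ∀ i, Continuous (g i))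
    (hf : ∀ x, ‖f x‖ = 1) (hg : ∀ i x, ‖g i x‖ = 1) (hgg : ∀ i j, i ≠ j → ∀ x, g i x ≠ g j x)
    (hfin : ∀ i, {x | f x = g i x}.Finite) :
    ∃ f₁ : S4 → ℍ[ℝ], HomOn univ (sphere 0 1) f f₁ ∧ ∀ x, f₁ x ≠ g 0 x := by
  classical
  haveI := sph_infinite
  haveI : Fact (Module.finrank ℝ (EuclideanSpace ℝ (Fin (4 + 1))) = 4 + 1) := ⟨by simp⟩
  obtain ⟨v, hv⟩ := Infinite.exists_notMem_finset ((hfin 0).toFinset ∪ (hfin 1).toFinset ∪ (hfin 2).toFinset)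
  simp only [Finset.mem_union, Set.Finite.mem_toFinset, mem_setOf_eq, not_or] at hv
  have hv' : ∀ i, f v ≠ g i v := by
    intro i; fin_cases i
    exacts [hv.1.1, hv.1.2, hv.2]
  let e := stereographic' 4 v
  have es : e.source = {v}ᶜ := stereographic'_source v
  have et : e.target = univ := stereographic'_target v
  have einj : Function.Injective e.symm := by
    intro a b h
    have := congrArg e h
    rwa [e.right_inv (by rw [et]; trivial), e.right_inv (by rw [et]; trivial)] at this
  have hfin' : ∀ i, {x | f (e.symm x) = g i (e.symm x)}.Finite := fun i => (hfin i).preimage einj.injOn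
  obtain ⟨h, hA, hB, hsep⟩ := arrange (E := EuclideanSpace ℝ (Fin 4)) (by simp) ((hfin' 0).toFinset) ((hfin' 1).toFinset ∪ (hfin' 2).toFinset) (by
    rw [Finset.disjoint_left]
    intro x hx hy
    simp only [Finset.mem_union, Set.Finite.mem_toFinset, mem_setOf_eq] at hx hy
    rcases hy with hy | hy
    · exact hgg 0 1 (by decide) _ (hx.symm.trans hy)
    · exact hgg 0 2 (by decide) _ (hx.symm.trans hy))
  have hsep' : ∀ i j, ∀ x ∈ (hfin' i).toFinset, ∀ y ∈ (hfin' j).toFinset, x ≠ y → (h x).2 ≠ (h y).2 := by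
    intro i j x hx y hy
    have : ∀ i x, x ∈ (hfin' i).toFinset → x ∈ (hfin' 0).toFinset ∪ ((hfin' 1).toFinset ∪ (hfin' 2).toFinset) := by
      intro i x hx
      fin_cases i
      · exact Finset.mem_union_left _ hx
      · exact Finset.mem_union_right _ (Finset.mem_union_left _ hx)
      · exact Finset.mem_union_right _ (Finset.mem_union_right _ hx)
    exact hsep x (this i x hx) y (this j y hy)
  let j : V4 → S4 := fun y => e.symm (h.symm y)
  have jc : Continuous j := by
    have : ContinuousOn e.symm e.target := e.continuousOn_symm
    rw [et, continuousOn_univ] at this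
    exact this.comp h.symm.continuous
  have jv : ∀ y, j y ≠ v := by
    intro y
    have := e.map_target (show h.symm y ∈ e.target by rw [et]; trivial)
    rw [es] at this
    exact this
  let k : S4 → V4 := fun x => h (e x)
  have kc : ContinuousOn k {v}ᶜ := by
    have := e.continuousOn
    rw [es] at this
    exact h.continuous.comp_continuousOn this
  have jk : ∀ x, x ≠ v → j (k x) = x := by
    intro x hx
    show e.symm (h.symm (h (e x))) = x
    rw [h.symm_apply_apply, e.left_inv (by rw [es]; exact hx)]
  have kj : ∀ y, k (j y) = y := by
    intro y
    show h (e (e.symm (h.symm y))) = y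
    rw [e.right_inv (by rw [et]; trivial), h.apply_symm_apply]
  have jt : Tendsto j (cocompact V4) (𝓝 v) := by
    rw [(nhds_basis_opens v).tendsto_right_iff]
    rintro O ⟨hvO, hO⟩
    have hK : IsCompact (k '' Oᶜ) := (hO.isClosed_compl.isCompact).image_of_continuousOn (kc.mono (fun x hx h => hx (by rw [mem_singleton_iff.1 h]; exact hvO)))
    filter_upwards [hK.compl_mem_cocompact] with y hy
    by_contra hc
    exact hy ⟨j y, hc, kj y⟩
  let Cf : Fin 3 → Finset V4 := fun i => (hfin' i).toFinset.image h
  have hCf : ∀ i y, f (j y) = g i (j y) ↔ y ∈ Cf i := by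
    intro i y
    simp only [Cf, Finset.mem_image, Set.Finite.mem_toFinset, mem_setOf_eq]
    constructor
    · intro hy; exact ⟨h.symm y, hy, h.apply_symm_apply y⟩
    · rintro ⟨x, hx, rfl⟩
      show f (e.symm (h.symm (h x))) = g i (e.symm (h.symm (h x)))
      rw [h.symm_apply_apply]; exact hx
  obtain ⟨H, H1, H2, H3, H4, H5⟩ := T3core (f := fun y => f (j y)) (g := fun i y => g i (j y)) (hfc.comp jc) (fun i => (hgc i).comp jc)
    (fun y => hf _) (fun i y => hg i _) (fun i l hil y => hgg i l hil _) ((hfc.tendsto v).comp jt) (fun i => ((hgc i).tendsto v).comp jt)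
    hv' (fun i l hil => hgg i l hil v) Cf hCf (by
      intro i l x hx y hy hxy
      obtain ⟨a, ha, rfl⟩ := Finset.mem_image.1 hx
      obtain ⟨b, hb, rfl⟩ := Finset.mem_image.1 hy
      exact hsep' i l a ha b hb (fun h => hxy (by rw [h]))) (by
      intro x hx
      obtain ⟨a, ha, rfl⟩ := Finset.mem_image.1 hx
      exact hA a ha) (by
      intro i hi x hx
      obtain ⟨a, ha, rfl⟩ := Finset.mem_image.1 hx
      apply hB a
      fin_cases i
      · exact absurd rfl hi
      · exact Finset.mem_union_left _ ha
      · exact Finset.mem_union_right _ ha)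
  let K : ℝ × S4 → ℍ[ℝ] := fun y => if y.2 = v then f v else H (y.1, k y.2)
  have K1 : ContinuousOn K (Icc 0 1 ×ˢ {v}ᶜ) := by
    have : ContinuousOn (fun y : ℝ × S4 => H (y.1, k y.2)) (Icc 0 1 ×ˢ {v}ᶜ) := by
      refine H1.comp (continuousOn_fst.prodMk (kc.comp continuousOn_snd (fun y hy => hy.2))) ?_
      intro y hy
      exact ⟨hy.1, trivial⟩
    refine this.congr fun y hy => ?_
    have : y.2 ≠ v := hy.2
    simp [K, this]
  let O : Set S4 := (j '' closedBall 0 1)ᶜ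
  have hO : IsOpen O := ((isCompact_closedBall _ _).image jc).isClosed.isOpen_compl
  have hvO : v ∈ O := by rintro ⟨y, -, hy⟩; exact jv y hy
  have K2' : ∀ t ∈ Icc (0 : ℝ) 1, ∀ x ∈ O, K (t, x) = f x := by
    intro t ht x hx
    by_cases hxv : x = v
    · simp [K, hxv]
    · simp only [K, hxv, if_false]
      rw [H5 t ht, jk x hxv]
      by_contra hc
      exact hx ⟨k x, by simpa using (not_le.1 hc).le, jk x hxv⟩
  have K2 : ContinuousOn K (Icc 0 1 ×ˢ O) :=
    ((hfc.comp continuous_snd).continuousOn).congr (fun y hy => K2' y.1 hy.1 y.2 hy.2)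
  refine ⟨fun x => K (1, x), ⟨K, ?_, ?_, ?_, fun _ _ => rfl⟩, ?_⟩
  · rintro ⟨t, x⟩ ⟨ht, -⟩
    by_cases hxv : x = v
    · refine (K2 (t, x) ⟨ht, by rw [hxv]; exact hvO⟩).mono_of_mem_nhdsWithin ?_
      rw [nhdsWithin_prod_eq]
      exact Filter.prod_mem_prod self_mem_nhdsWithin (mem_nhdsWithin_of_mem_nhds (hO.mem_nhds (by rw [hxv]; exact hvO)))
    · refine (K1 (t, x) ⟨ht, hxv⟩).mono_of_mem_nhdsWithin ?_
      rw [nhdsWithin_prod_eq]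
      exact Filter.prod_mem_prod self_mem_nhdsWithin (mem_nhdsWithin_of_mem_nhds (isOpen_compl_singleton.mem_nhds hxv))
  · intro t ht x _
    rw [mem_sphere_zero_iff_norm]
    by_cases hxv : x = v
    · simp [K, hxv, hf]
    · simp only [K, hxv, if_false]; exact H2 t ht _
  · intro x _
    by_cases hxv : x = v
    · simp [K, hxv]
    · simp only [K, hxv, if_false]; rw [H3, jk x hxv]
  · intro x
    by_cases hxv : x = v
    · simp only [K, hxv, if_true]; exact hv' 0
    · simp only [K, hxv, if_false]
      have := H4 (k x)
      rwa [jk x hxv] at this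

theorem avoid_hom {X : Type*} [TopologicalSpace X] {f g : X → ℍ[ℝ]} (hfc : Continuous f) (hgc : Continuous g)
    (hf : ∀ x, ‖f x‖ = 1) (hg : ∀ x, ‖g x‖ = 1) (h : ∀ x, f x ≠ g x) : HomOn univ (sphere 0 1) f (fun x => -g x) := by
  have h1 : HomOn univ {0}ᶜ f (fun x => -g x) := by
    apply HomOn.linear hfc.continuousOn hgc.neg.continuousOn
    intro t ht x _ h0
    have h0' : (1 - t) • f x = t • g x := by
      have h0' : (1 - t) • f x + t • -g x = 0 := h0
      rw [smul_neg, ← sub_eq_add_neg] at h0'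
      exact sub_eq_zero.1 h0'
    have hn := congrArg norm h0'
    rw [norm_smul, norm_smul, hf, hg, Real.norm_of_nonneg (by linarith [ht.2]), Real.norm_of_nonneg ht.1] at hn
    have ht2 : t = 1 / 2 := by linarith
    rw [ht2, show (1 : ℝ) - 1 / 2 = 1 / 2 by norm_num] at h0'
    exact h x (smul_right_injective _ (by norm_num : (1 / 2 : ℝ) ≠ 0) h0')
  have h2 := h1.comp_left (k := nrm) (T' := sphere 0 1) nrm_cont (fun x hx => by
    have : ‖x‖ ≠ 0 := norm_ne_zero_iff.2 hx
    rw [mem_sphere_zero_iff_norm, nrm, norm_smul, norm_inv, norm_norm, inv_mul_cancel₀ this])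
  refine h2.congr ?_ ?_
  · intro x _; simp [nrm, hf]
  · intro x _; simp [nrm, hg]

end

section 
open Set Metric Filter Topology
open scoped Quaternion

theorem th_ne {δ y : ℍ[ℝ]} (hδ : δ.re = 0) (hy : ‖y‖ = 1) : 1 + δ * (1 - y) ≠ 0 := by
  intro h
  have h1 : δ * (1 - y) = -1 := by rw [eq_neg_iff_add_eq_zero, add_comm]; exact h
  have hδ0 : δ ≠ 0 := by rintro rfl; simp at h1
  have h2 : 1 - y = -δ⁻¹ := by
    have := congrArg (fun x => δ⁻¹ * x) h1
    simpa [← mul_assoc, inv_mul_cancel₀ hδ0] using this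
  have h3 : (1 - y).re = 0 := by rw [h2, q_inv]; simp [hδ]
  have h4 := unit_one_sub hy
  have h5 : 1 - y.re = 0 := by simpa using h3
  rw [h5, mul_zero] at h4
  have : 1 - y = 0 := by simpa using h4
  rw [this] at h1; simp at h1

noncomputable def th (δ y : ℍ[ℝ]) : ℍ[ℝ] := 1 - (1 - y) * (1 + δ * (1 - y))⁻¹

theorem th_norm {δ y : ℍ[ℝ]} (hδ : δ.re = 0) (hy : ‖y‖ = 1) : ‖th δ y‖ = 1 := by
  have h := th_ne hδ hy
  have e : th δ y = (1 + δ * (1 - y) - (1 - y)) * (1 + δ * (1 - y))⁻¹ := by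
    rw [th, sub_mul (1 + δ * (1 - y)), mul_inv_cancel₀ h]
  have n : ‖1 + δ * (1 - y) - (1 - y)‖ = ‖1 + δ * (1 - y)‖ := by
    have : ‖1 + δ * (1 - y) - (1 - y)‖ ^ 2 = ‖1 + δ * (1 - y)‖ ^ 2 := by
      have hn := q_nsq y
      rw [hy] at hn
      rw [q_nsq, q_nsq]; simp [hδ]; linear_combination -hn
    exact (sq_eq_sq₀ (norm_nonneg _) (norm_nonneg _)).1 this
  rw [e, norm_mul, norm_inv, n, mul_inv_cancel₀ (norm_ne_zero_iff.2 h)]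

theorem th_inj {δ y y' : ℍ[ℝ]} (hδ : δ.re = 0) (hy : ‖y‖ = 1) (hy' : ‖y'‖ = 1) (h : th δ y = th δ y') : y = y' := by
  have key : ∀ {y : ℍ[ℝ]}, ‖y‖ = 1 → (1 - (1 - th δ y) * δ) * (1 - y) = 1 - th δ y := by
    intro y hy
    have h := th_ne hδ hy
    have e : (1 - th δ y) * (1 + δ * (1 - y)) = 1 - y := by
      rw [th, sub_sub_cancel, mul_assoc, inv_mul_cancel₀ h, mul_one]
    rw [mul_add, mul_one, ← mul_assoc] at e
    rw [sub_mul, one_mul]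
    exact sub_eq_iff_eq_add.2 e.symm
  have k1 := key hy
  have k2 := key hy'
  rw [← h] at k2
  have h0 : 1 - (1 - th δ y) * δ ≠ 0 := by
    intro h0
    rw [h0, zero_mul] at k1
    rw [← k1] at h0
    simp at h0
  have := mul_left_cancel₀ h0 (k1.trans k2.symm)
  simpa using this

theorem theta {a b : ℍ[ℝ]} (ha : ‖a‖ = 1) (hb : ‖b‖ = 1) (hab : a ≠ b) :
    ∃ θ : ℍ[ℝ] → ℍ[ℝ], HomOn (sphere 0 1) (sphere 0 1) id θ ∧ ∀ y, ‖y‖ = 1 → (θ y = a → y = 1) ∧ (θ y = b → y = -1) := by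
  have hw := star_mul_ne_one ha hab.symm
  have hw1 := norm_star_mul ha hb
  let κ := (1 - star a * b)⁻¹
  let δ : ℍ[ℝ] := κ - (1 / 2 : ℝ)
  have hδ : δ.re = 0 := by
    have := re_inv_half hw1 hw
    simp only [δ, κ, Quaternion.re_sub, this, Quaternion.re_coe, sub_self]
  have hr : 1 < Module.rank ℝ ℍ[ℝ] := by
    rw [Quaternion.rank_eq_four]; norm_num
  have a0 : a ≠ 0 := by rintro rfl; simp at ha
  have hj := (isPathConnected_compl_singleton_of_one_lt_rank hr (0 : ℍ[ℝ])).joinedIn 1 (by simp) a a0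
  let γ : ℝ → ℍ[ℝ] := fun t => nrm (hj.somePath.extend t)
  have γ0 : ∀ t ∈ Icc (0 : ℝ) 1, hj.somePath.extend t ∈ ({0}ᶜ : Set ℍ[ℝ]) := by
    intro t ht
    rw [Path.extend_apply _ ht]
    exact hj.somePath_mem _
  have γc : ContinuousOn γ (Icc 0 1) := nrm_cont.comp hj.somePath.continuous_extend.continuousOn γ0
  have γn : ∀ t ∈ Icc (0 : ℝ) 1, ‖γ t‖ = 1 := by
    intro t ht
    have : ‖hj.somePath.extend t‖ ≠ 0 := norm_ne_zero_iff.2 (γ0 t ht)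
    simp only [γ]
    rw [nrm, norm_smul, norm_inv, norm_norm, inv_mul_cancel₀ this]
  refine ⟨fun y => a * th δ y, ⟨fun z => γ z.1 * th (z.1 • δ) z.2, ?_, ?_, ?_, ?_⟩, ?_⟩
  · have b1 : ContinuousOn (fun z : ℝ × ℍ[ℝ] => γ z.1) (Icc 0 1 ×ˢ sphere 0 1) := γc.comp continuousOn_fst (fun z hz => hz.1)
    have b2 : ContinuousOn (fun z : ℝ × ℍ[ℝ] => 1 + (z.1 • δ) * (1 - z.2)) (Icc 0 1 ×ˢ sphere 0 1) := by fun_prop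
    have b3 := b2.inv₀ (fun z hz => th_ne (by simp [hδ]) (by simpa using hz.2))
    have b4 : ContinuousOn (fun z : ℝ × ℍ[ℝ] => 1 - z.2) (Icc 0 1 ×ˢ sphere 0 1) := by fun_prop
    exact b1.mul (continuousOn_const.sub (b4.mul b3))
  · intro t ht y hy
    rw [mem_sphere_zero_iff_norm] at *
    rw [norm_mul, γn t ht, th_norm (by simp [hδ]) hy, one_mul]
  · intro y hy
    simp [γ, nrm, th]
  · intro y hy
    simp [γ, nrm, ha]
  · intro y hy
    have e1 : a * th δ 1 = a := by simp [th]
    have e2 : a * th δ (-1) = b := by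
      have hκ0 : 1 - star a * b ≠ 0 := sub_ne_zero.2 hw.symm
      have : 1 + δ * (1 - -1) = (2 : ℝ) • κ := by
        have h2 : (1 : ℍ[ℝ]) - -1 = (2 : ℝ) • 1 := by rw [two_smul]; abel
        rw [h2, mul_smul_comm, mul_one]
        simp only [δ]
        rw [smul_sub]
        have : (2 : ℝ) • (((1 / 2 : ℝ)) : ℍ[ℝ]) = 1 := by
          rw [← Quaternion.coe_smul]; norm_num
        rw [this]; abel
      rw [th, this]
      have h2 : (1 : ℍ[ℝ]) - -1 = (2 : ℝ) • 1 := by rw [two_smul]; abel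
      rw [h2, smul_mul_assoc, one_mul, smul_inv₀, smul_smul, mul_inv_cancel₀ (by norm_num), one_smul, inv_inv, sub_sub_cancel, ← mul_assoc, (q_unit ha).2, one_mul]
    constructor
    · intro h
      exact th_inj hδ hy (by simp) (mul_left_cancel₀ a0 (h.trans e1.symm))
    · intro h
      exact th_inj hδ hy (by simp) (mul_left_cancel₀ a0 (h.trans e2.symm))

noncomputable def mHl : ℍ[ℝ] ≃ₗ[ℝ] V3 × ℝ where
  toFun q := (((q.imI, q.imJ), q.imK), q.re)
  invFun x := ⟨x.2, x.1.1.1, x.1.1.2, x.1.2⟩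
  map_add' a b := by simp
  map_smul' c a := by simp
  left_inv a := rfl
  right_inv a := rfl

noncomputable def mH : ℍ[ℝ] ≃L[ℝ] V3 × ℝ := mHl.toContinuousLinearEquiv

theorem mH_apply (q : ℍ[ℝ]) : mH q = (((q.imI, q.imJ), q.imK), q.re) := rfl
theorem mH_symm (t : ℝ) : mH.symm ((0 : V3), t) = (t : ℍ[ℝ]) := by
  rw [ContinuousLinearEquiv.symm_apply_eq, mH_apply]; simp; rfl


theorem radial_ext {E : Type*} [NormedAddCommGroup E] [NormedSpace ℝ E] {f : sphere (0 : E) 1 → ℍ[ℝ]} (hfc : Continuous f) (hf : ∀ x, ‖f x‖ = 1) :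
    ∃ f0 : E → ℍ[ℝ], ContinuousOn f0 {0}ᶜ ∧ (∀ v, v ≠ 0 → ‖f0 v‖ = 1) ∧ ∀ x : sphere (0 : E) 1, f0 x = f x := by
  classical
  let f0 : E → ℍ[ℝ] := fun v => if h : ‖v‖⁻¹ • v ∈ sphere (0 : E) 1 then f ⟨_, h⟩ else 0
  have hsm : ∀ v : E, v ≠ 0 → ‖v‖⁻¹ • v ∈ sphere (0 : E) 1 := by
    intro v hv
    have : ‖v‖ ≠ 0 := norm_ne_zero_iff.2 hv
    rw [mem_sphere_zero_iff_norm, norm_smul, norm_inv, norm_norm, inv_mul_cancel₀ this]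
  have sn : ∀ x : sphere (0 : E) 1, ‖(x : E)‖ = 1 := fun x => by simpa using x.2
  refine ⟨f0, ?_, ?_, ?_⟩
  · rw [continuousOn_iff_continuous_restrict]
    have : ({0}ᶜ : Set E).domRestrict f0 = fun v => f ⟨‖v.1‖⁻¹ • v.1, hsm v.1 v.2⟩ := by
      funext v
      exact dif_pos (hsm v.1 v.2)
    rw [this]
    apply hfc.comp
    apply Continuous.subtype_mk
    apply Continuous.smul _ continuous_subtype_val
    exact (continuous_norm.comp continuous_subtype_val).inv₀ (fun v => norm_ne_zero_iff.2 v.2)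
  · intro v hv
    simp only [f0, dif_pos (hsm v hv), hf]
  · intro x
    have h1 : ‖(x : E)‖⁻¹ • (x : E) = x := by rw [sn x]; simp
    have hx := hsm x (fun h => by have := sn x; rw [h] at this; simp at this)
    simp only [f0, dif_pos hx]
    congr 1
    exact Subtype.ext h1

theorem susp_pole {h : V4 → V3} (hn : ∀ x ≠ 0, h x ≠ 0) {y : V4 × ℝ} (hy : y ≠ 0) {s : ℝ} 
    (hx : nrm (mH.symm (susp h y)) = (s : ℍ[ℝ])) : ∃ t : ℝ, 0 < t ∧ y = t • ((0 : V4), s) := by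
  have hz : susp h y ≠ 0 := susp_ne hn hy
  have hz' : mH.symm (susp h y) ≠ 0 := by simpa using hz
  have hnn : 0 < ‖mH.symm (susp h y)‖ := norm_pos_iff.2 hz'
  set t := ‖mH.symm (susp h y)‖ with ht
  have e0 : mH.symm (susp h y) = t • (s : ℍ[ℝ]) := by
    rw [← hx, nrm, smul_smul, ← ht, mul_inv_cancel₀ hnn.ne', one_smul]
  have h2 := congrArg mH e0
  rw [ContinuousLinearEquiv.apply_symm_apply, map_smul, mH_apply] at h2
  simp only [susp, Quaternion.imI_coe, Quaternion.imJ_coe, Quaternion.imK_coe, Quaternion.re_coe, Prod.smul_mk, smul_eq_mul, mul_zero, Prod.mk.injEq] at h2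
  refine ⟨t, hnn, Prod.ext ?_ (by simpa using h2.2)⟩
  by_contra hne
  have hy1 : y.1 ≠ 0 := by simpa using hne
  have := smul_ne_zero (div_ne_zero (norm_ne_zero_iff.2 hy1) (norm_ne_zero_iff.2 (hn _ hy1))) (hn _ hy1)
  exact this h2.1

theorem T2a {f : S4 → ℍ[ℝ]} (hfc : Continuous f) (hf : ∀ x, ‖f x‖ = 1) {a b : ℍ[ℝ]} (ha : ‖a‖ = 1) (hb : ‖b‖ = 1) (hab : a ≠ b) :
    ∃ f' : S4 → ℍ[ℝ], HomOn univ (sphere 0 1) f f' ∧ (∀ x x', f' x = a → f' x' = a → x = x') ∧ (∀ x x', f' x = b → f' x' = b → x = x') := by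
  have hd : Module.finrank ℝ (EuclideanSpace ℝ (Fin (4 + 1))) = Module.finrank ℝ (V4 × ℝ) := by simp
  obtain ⟨l⟩ : Nonempty (EuclideanSpace ℝ (Fin (4 + 1)) ≃L[ℝ] V4 × ℝ) := ⟨ContinuousLinearEquiv.ofFinrankEq hd⟩
  have sn : ∀ x : S4, ‖(x : EuclideanSpace ℝ (Fin (4 + 1)))‖ = 1 := fun x => by simpa using x.2
  have hl0 : ∀ x : S4, l x ≠ 0 := by
    intro x h
    have h1 : (x : EuclideanSpace ℝ (Fin (4 + 1))) = 0 := (map_eq_zero_iff l l.injective).1 h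
    have := sn x
    rw [h1, norm_zero] at this
    exact zero_ne_one this
  obtain ⟨f0, f0c, f0n, f0s⟩ := radial_ext hfc hf
  have ls0 : ∀ y, y ≠ 0 → l.symm y ≠ 0 := fun y hy h => hy ((map_eq_zero_iff l.symm l.symm.injective).1 h)
  have ms0 : ∀ y, y ≠ 0 → mH.symm y ≠ 0 := fun y hy h => hy ((map_eq_zero_iff mH.symm mH.symm.injective).1 h)
  let F : V4 × ℝ → V3 × ℝ := fun y => mH (f0 (l.symm y))
  have hFc : ContinuousOn F {0}ᶜ := mH.continuous.comp_continuousOn (f0c.comp l.symm.continuous.continuousOn (fun y hy => ls0 y hy))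
  have hF0 : ∀ y, y ≠ 0 → F y ≠ 0 := by
    intro y hy h
    have h1 : f0 (l.symm y) = 0 := (map_eq_zero_iff mH mH.injective).1 h
    have := f0n (l.symm y) (ls0 y hy)
    rw [h1] at this; simp at this
  obtain ⟨h, hc, hn, hh⟩ := suspension hFc hF0 (by simp)
  have lc : Continuous (fun x : S4 => l x) := l.continuous.comp continuous_subtype_val
  have g1 : HomOn univ {0}ᶜ (F ∘ fun x : S4 => l x) (susp h ∘ fun x : S4 => l x) := hh.comp_right lc.continuousOn (fun x _ => hl0 x)
  have g2 := g1.comp_left (k := fun y => nrm (mH.symm y)) (T' := sphere 0 1) (nrm_cont.comp mH.symm.continuous.continuousOn (fun y hy => ms0 y hy))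
    (fun y hy => by
      have : ‖mH.symm y‖ ≠ 0 := norm_ne_zero_iff.2 (ms0 y hy)
      rw [mem_sphere_zero_iff_norm, nrm, norm_smul, norm_inv, norm_norm, inv_mul_cancel₀ this])
  obtain ⟨θ, hθ, hθ'⟩ := theta ha hb hab
  have g3 : HomOn univ (sphere 0 1) f (fun x : S4 => nrm (mH.symm (susp h (l x)))) := by
    refine g2.congr ?_ (fun _ _ => rfl)
    intro x _
    simp [F, f0s, nrm, hf]
  have g4 := hθ.comp_right g3.right_cont g3.right_mem
  have g3n : ∀ x : S4, ‖nrm (mH.symm (susp h (l x)))‖ = 1 := fun x => mem_sphere_zero_iff_norm.1 (g3.right_mem x trivial)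
  have key : ∀ (x x' : S4) (s : ℝ), nrm (mH.symm (susp h (l x))) = (s : ℍ[ℝ]) → nrm (mH.symm (susp h (l x'))) = (s : ℍ[ℝ]) → x = x' := by
    intro x x' s hx hx'
    obtain ⟨t, ht, e⟩ := susp_pole hn (hl0 x) hx
    obtain ⟨t', ht', e'⟩ := susp_pole hn (hl0 x') hx'
    have e3 : l (t' • (x : EuclideanSpace ℝ (Fin (4 + 1)))) = l (t • (x' : EuclideanSpace ℝ (Fin (4 + 1)))) := by
      rw [map_smul, map_smul, e, e', smul_smul, smul_smul, mul_comm]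
    have e4 := l.injective e3
    have e5 := congrArg norm e4
    rw [norm_smul, norm_smul, sn, sn, mul_one, mul_one, Real.norm_of_nonneg ht.le, Real.norm_of_nonneg ht'.le] at e5
    rw [e5] at e4
    exact Subtype.ext (smul_right_injective _ ht.ne' e4)
  refine ⟨_, g3.trans g4, ?_, ?_⟩
  · intro x x' hx hx'
    apply key x x' 1
    · rw [(hθ' _ (g3n x)).1 hx]; simp
    · rw [(hθ' _ (g3n x')).1 hx']; simp
  · intro x x' hx hx'
    apply key x x' (-1)
    · rw [(hθ' _ (g3n x)).2 hx]; simp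
    · rw [(hθ' _ (g3n x')).2 hx']; simp

end

section 
open Set Metric Filter Topology
open scoped Quaternion

abbrev S3 : Type := Metric.sphere (0 : EuclideanSpace ℝ (Fin (3 + 1))) 1

noncomputable def qin (x : S3) : ℍ[ℝ] := Quaternion.linearIsometryEquivTuple.symm x.1
noncomputable def qjn (y : ℍ[ℝ]) (hy : ‖y‖ = 1) : S3 :=
  ⟨Quaternion.linearIsometryEquivTuple y, by
    rw [mem_sphere_zero_iff_norm, LinearIsometryEquiv.norm_map, hy]⟩
theorem qin_cont : Continuous qin :=
  Quaternion.linearIsometryEquivTuple.symm.continuous.comp continuous_subtype_val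
theorem qin_norm (x : S3) : ‖qin x‖ = 1 := by
  rw [qin, LinearIsometryEquiv.norm_map]; simpa using x.2
theorem qin_inj {x y : S3} (h : qin x = qin y) : x = y :=
  Subtype.ext (Quaternion.linearIsometryEquivTuple.symm.injective h)
theorem qin_qjn (y : ℍ[ℝ]) (hy : ‖y‖ = 1) : qin (qjn y hy) = y :=
  Quaternion.linearIsometryEquivTuple.symm_apply_apply y
theorem qjn_qin (x : S3) (h : ‖qin x‖ = 1) : qjn (qin x) h = x := qin_inj (qin_qjn _ _)

noncomputable def mkq {X : Type*} [TopologicalSpace X] (f : X → ℍ[ℝ]) (hf : Continuous f) (h : ∀ x, ‖f x‖ = 1) : C(X, S3) :=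
  ⟨fun x => qjn (f x) (h x), (Quaternion.linearIsometryEquivTuple.continuous.comp hf).subtype_mk _⟩
theorem qin_mkq {X : Type*} [TopologicalSpace X] (f : X → ℍ[ℝ]) (hf : Continuous f) (h : ∀ x, ‖f x‖ = 1) (x : X) : qin (mkq f hf h x) = f x :=
  qin_qjn (f x) (h x)

theorem homotopic_of_homOn {X : Type*} [TopologicalSpace X] {f g : C(X, S3)}
    (h : HomOn univ (sphere 0 1) (fun x => qin (f x)) (fun x => qin (g x))) : f.Homotopic g := by
  obtain ⟨H, Hc, Hm, H0, H1⟩ := h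
  have hc : Continuous (fun z : unitInterval × X => H (z.1.1, z.2)) := by
    rw [← continuousOn_univ]
    exact Hc.comp (by fun_prop) (fun z _ => ⟨z.1.2, trivial⟩)
  have hn : ∀ z : unitInterval × X, ‖H (z.1.1, z.2)‖ = 1 := fun z => mem_sphere_zero_iff_norm.1 (Hm _ z.1.2 _ trivial)
  refine ⟨⟨mkq _ hc hn, ?_, ?_⟩⟩
  · intro x
    apply qin_inj
    refine (qin_mkq _ hc hn _).trans ?_
    exact H0 x trivial
  · intro x
    apply qin_inj
    refine (qin_mkq _ hc hn _).trans ?_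
    exact H1 x trivial

theorem homOn_cont {X : Type*} [TopologicalSpace X] {f g : X → ℍ[ℝ]} (h : HomOn univ (sphere 0 1) f g) :
    Continuous g ∧ ∀ x, ‖g x‖ = 1 :=
  ⟨continuousOn_univ.1 h.right_cont, fun x => mem_sphere_zero_iff_norm.1 (h.right_mem x trivial)⟩

theorem T2b (f : C(S4, S3)) {a b : S3} (hab : a ≠ b) : ∃ f' : C(S4, S3), f.Homotopic f' ∧
    (∀ x x', f' x = a → f' x' = a → x = x') ∧ (∀ x x', f' x = b → f' x' = b → x = x') := by
  obtain ⟨f', h, h1, h2⟩ := T2a (qin_cont.comp f.continuous) (fun x => qin_norm _) (qin_norm a) (qin_norm b) (fun h => hab (qin_inj h))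
  obtain ⟨hc, hn⟩ := homOn_cont h
  refine ⟨mkq f' hc hn, homotopic_of_homOn ?_, ?_, ?_⟩
  · simp only [qin_mkq]; exact h
  · intro x x' e e'
    apply h1 x x'
    · rw [← e, qin_mkq]
    · rw [← e', qin_mkq]
  · intro x x' e e'
    apply h2 x x'
    · rw [← e, qin_mkq]
    · rw [← e', qin_mkq]

noncomputable def negq : C(S3, S3) := mkq (fun x => -qin x) qin_cont.neg (fun x => by rw [norm_neg, qin_norm])

theorem negq_val (x : S3) : qin (negq x) = -qin x := qin_qjn _ (by rw [norm_neg, qin_norm])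

theorem avoidb (f g : C(S4, S3)) (h : ∀ x, f x ≠ g x) : f.Homotopic (negq.comp g) := by
  apply homotopic_of_homOn
  have := avoid_hom (qin_cont.comp f.continuous) (qin_cont.comp g.continuous) (fun x => qin_norm _) (fun x => qin_norm _)
    (fun x e => h x (qin_inj e))
  refine this.congr (fun _ _ => rfl) ?_
  intro x _
  exact (negq_val (g x)).symm

theorem T3b (f : C(S4, S3)) (g : Fin 3 → C(S4, S3)) (hg : ∀ i j, i ≠ j → ∀ x, g i x ≠ g j x)
    (hfin : ∀ i, {x | f x = g i x}.Finite) : ∃ f₁ : C(S4, S3), f.Homotopic f₁ ∧ ∀ x, f₁ x ≠ g 0 x := by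
  obtain ⟨f', h, h1⟩ := T3a (f := fun x => qin (f x)) (g := fun i x => qin (g i x)) (qin_cont.comp f.continuous) (fun i => qin_cont.comp (g i).continuous) (fun x => qin_norm _) (fun i x => qin_norm _)
    (fun i j hij x e => hg i j hij x (qin_inj e)) (fun i => (hfin i).subset (fun x hx => qin_inj hx))
  obtain ⟨hc, hn⟩ := homOn_cont h
  refine ⟨mkq f' hc hn, homotopic_of_homOn ?_, ?_⟩
  · simp only [qin_mkq]; exact h
  · intro x e
    apply h1 x
    rw [← e, qin_mkq]

/-! lifting through coverings -/
noncomputable def spt (t : ℝ) (u : S3) : EuclideanSpace ℝ (Fin (4 + 1)) :=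
  WithLp.toLp 2 (Fin.cons (Real.cos (Real.pi * t)) (fun i => Real.sin (Real.pi * t) * u.1 i))

theorem s3_sq (u : S3) : ∑ i, (u.1 i) ^ 2 = 1 := by
  have h1 : ‖u.1‖ = 1 := by simpa using u.2
  have := EuclideanSpace.norm_sq_eq u.1
  rw [h1] at this
  simpa using this.symm
theorem s4_sq (x : S4) : (x.1 0) ^ 2 + ∑ i : Fin 4, (x.1 i.succ) ^ 2 = 1 := by
  have h1 : ‖x.1‖ = 1 := by simpa using x.2
  have := EuclideanSpace.norm_sq_eq x.1
  rw [h1, Fin.sum_univ_succ] at this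
  simpa using this.symm

theorem spt_norm (t : ℝ) (u : S3) : ‖spt t u‖ = 1 := by
  have := EuclideanSpace.norm_sq_eq (spt t u)
  rw [Fin.sum_univ_succ] at this
  simp only [spt, Fin.cons_zero, Fin.cons_succ, Real.norm_eq_abs, sq_abs, mul_pow, ← Finset.mul_sum] at this
  have h := s3_sq u
  have h2 : ‖spt t u‖ ^ 2 = 1 := by
    refine this.trans ?_
    rw [show (∑ i : Fin 4, (u.1 i)^2) = 1 from h, mul_one, Real.cos_sq_add_sin_sq]
  nlinarith [norm_nonneg (spt t u)]

theorem spt_cont : Continuous (fun z : unitInterval × S3 => spt z.1.1 z.2) := by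
  apply (PiLp.continuous_toLp 2 _).comp
  apply continuous_pi
  intro i
  refine Fin.cases ?_ ?_ i
  · simp only [Fin.cons_zero]; fun_prop
  · intro j
    simp only [Fin.cons_succ]
    apply Continuous.mul (by fun_prop)
    exact (EuclideanSpace.proj (𝕜 := ℝ) j).continuous.comp (continuous_subtype_val.comp continuous_snd)

noncomputable def KS : C(unitInterval × S3, S4) :=
  ⟨fun z => ⟨spt z.1.1 z.2, by rw [mem_sphere_zero_iff_norm]; exact spt_norm _ _⟩, spt_cont.subtype_mk (fun z => by rw [mem_sphere_zero_iff_norm]; exact spt_norm _ _)⟩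

theorem s3_nonempty : Nonempty S3 := ⟨qjn 1 (by simp)⟩

theorem KS_surj : Function.Surjective KS := by
  intro x
  have hx := s4_sq x
  set b := x.1 0 with hb
  have hs : 0 ≤ ∑ i : Fin 4, (x.1 i.succ) ^ 2 := Finset.sum_nonneg (fun i _ => sq_nonneg _)
  have hb1 : b ^ 2 ≤ 1 := by linarith
  have hb2 : -1 ≤ b := by nlinarith
  have hb3 : b ≤ 1 := by nlinarith
  set t := Real.arccos b / Real.pi with ht
  have htp : Real.pi * t = Real.arccos b := by rw [ht]; field_simp
  have htI : t ∈ Icc (0:ℝ) 1 := ⟨div_nonneg (Real.arccos_nonneg _) Real.pi_pos.le, by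
    rw [ht, div_le_one Real.pi_pos]; exact Real.arccos_le_pi _⟩
  have hc : Real.cos (Real.pi * t) = b := by rw [htp, Real.cos_arccos hb2 hb3]
  have hsn : Real.sin (Real.pi * t) = √(1 - b ^ 2) := by rw [htp, Real.sin_arccos]
  set s := √(1 - b ^ 2) with hsd
  have hs2 : s ^ 2 = ∑ i : Fin 4, (x.1 i.succ) ^ 2 := by
    rw [hsd, Real.sq_sqrt (by linarith)]; linarith
  obtain ⟨u, hu⟩ : ∃ u : S3, ∀ i : Fin 4, s * u.1 i = x.1 i.succ := by
    by_cases h0 : s = 0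
    · obtain ⟨u⟩ := s3_nonempty
      refine ⟨u, fun i => ?_⟩
      rw [h0] at hs2
      have := (Finset.sum_eq_zero_iff_of_nonneg (fun i _ => sq_nonneg _)).1 (hs2.symm.trans (by norm_num)) i (Finset.mem_univ _)
      rw [h0, zero_mul]
      exact (pow_eq_zero_iff two_ne_zero).1 this |>.symm
    · refine ⟨⟨WithLp.toLp 2 (fun i : Fin 4 => x.1 i.succ / s), ?_⟩, ?_⟩
      · rw [mem_sphere_zero_iff_norm]
        have := EuclideanSpace.norm_sq_eq (WithLp.toLp 2 (fun i : Fin 4 => x.1 i.succ / s))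
        simp only [Real.norm_eq_abs, sq_abs, div_pow, ← Finset.sum_div] at this
        rw [← hs2, div_self (pow_ne_zero 2 h0)] at this
        have hh := norm_nonneg (WithLp.toLp 2 (fun i : Fin 4 => x.1 i.succ / s))
        nlinarith
      · intro i
        show s * (x.1 i.succ / s) = _
        field_simp
  refine ⟨(⟨t, htI⟩, u), ?_⟩
  apply Subtype.ext
  show spt t u = x.1
  ext i
  refine Fin.cases ?_ ?_ i
  · show Real.cos (Real.pi * t) = _
    rw [hc]
  · intro j
    show Real.sin (Real.pi * t) * u.1 j = _
    rw [hsn, hu]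

theorem KS_fib {t t' : unitInterval} {u u' : S3} (h : KS (t, u) = KS (t', u')) : t = t' ∧ (t = 0 ∨ t = 1 ∨ u = u') := by
  have h0 : spt t u = spt t' u' := congrArg Subtype.val h
  have h1 : Real.cos (Real.pi * t) = Real.cos (Real.pi * t') := congrArg (fun z : EuclideanSpace ℝ (Fin (4 + 1)) => z 0) h0
  have hm : ∀ t : unitInterval, Real.pi * t ∈ Icc 0 Real.pi := fun t =>
    ⟨mul_nonneg Real.pi_pos.le t.2.1, mul_le_of_le_one_right Real.pi_pos.le t.2.2⟩
  have h2 := Real.injOn_cos (hm t) (hm t') h1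
  have h3 : t = t' := Subtype.ext (mul_left_cancel₀ Real.pi_ne_zero h2)
  refine ⟨h3, ?_⟩
  subst h3
  by_cases ht0 : t = 0
  · exact Or.inl ht0
  by_cases ht1 : t = 1
  · exact Or.inr (Or.inl ht1)
  refine Or.inr (Or.inr ?_)
  have hp : 0 < (t : ℝ) := lt_of_le_of_ne t.2.1 (fun h => ht0 (Subtype.ext h.symm))
  have hq : (t : ℝ) < 1 := lt_of_le_of_ne t.2.2 (fun h => ht1 (Subtype.ext h))
  have hsin : 0 < Real.sin (Real.pi * t) := Real.sin_pos_of_pos_of_lt_pi (mul_pos Real.pi_pos hp) (by nlinarith [Real.pi_pos])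
  apply Subtype.ext
  ext j
  have := congrArg (fun z : EuclideanSpace ℝ (Fin (4 + 1)) => z j.succ) h0
  exact mul_left_cancel₀ hsin.ne' this

theorem KS_zero (u u' : S3) : KS (0, u) = KS (0, u') := by
  apply Subtype.ext
  show spt 0 u = spt 0 u'
  simp [spt]
theorem KS_one (u u' : S3) : KS (1, u) = KS (1, u') := by
  apply Subtype.ext
  show spt 1 u = spt 1 u'
  simp [spt]

theorem s3_conn : ConnectedSpace S3 := by
  apply isConnected_iff_connectedSpace.1
  apply isConnected_sphere _ _ zero_le_one
  rw [← Module.finrank_eq_rank]; simp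

theorem lift_exists {E N : Type*} [TopologicalSpace E] [TopologicalSpace N] {p : E → N} (cov : IsCoveringMap p)
    (hs : Function.Surjective p) (f : C(S4, N)) : ∃ F : C(S4, E), ∀ x, p (F x) = f x := by
  have := s3_conn
  obtain ⟨u₀⟩ := s3_nonempty
  obtain ⟨e₀, he₀⟩ := hs (f (KS (0, u₀)))
  let H : C(unitInterval × S3, N) := f.comp KS
  have H0 : ∀ a, H (0, a) = p ((ContinuousMap.const S3 e₀) a) := by
    intro a
    show f (KS (0, a)) = p e₀
    rw [he₀, KS_zero a u₀]
  let L := cov.liftHomotopy H (ContinuousMap.const S3 e₀) H0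
  have hL : ∀ z, p (L z) = f (KS z) := fun z => congrFun (cov.liftHomotopy_lifts H (ContinuousMap.const S3 e₀) H0) z
  have hL0 : ∀ u, L (0, u) = e₀ := fun u => cov.liftHomotopy_zero H (ContinuousMap.const S3 e₀) H0 u
  have hL1 : ∀ u u', L (1, u) = L (1, u') := by
    intro u u'
    refine cov.isSeparatedMap.const_of_comp cov.isLocalHomeomorph.isLocallyInjective (show Continuous fun u => L (1, u) from L.continuous.comp (by fun_prop)) ?_ u u'
    intro a a'
    show p (L (1, a)) = p (L (1, a'))
    rw [hL, hL, KS_one a a']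
  have hq : IsQuotientMap KS := KS.continuous.isClosedMap.isQuotientMap KS.continuous KS_surj
  have hfac : Function.FactorsThrough L KS := by
    rintro ⟨t, u⟩ ⟨t', u'⟩ h
    obtain ⟨rfl, h | h | h⟩ := KS_fib h
    · subst h; rw [hL0, hL0]
    · subst h; exact hL1 u u'
    · rw [h]
  refine ⟨hq.lift L hfac, ?_⟩
  intro x
  obtain ⟨z, rfl⟩ := KS_surj x
  have : hq.lift L hfac (KS z) = L z := congrArg (fun k : C(_, _) => k z) (hq.lift_comp L hfac)
  rw [this, hL]

end

section
open Set Metric Filter Topology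
open scoped Quaternion
theorem hom_lift {E N A : Type*} [TopologicalSpace E] [TopologicalSpace N] [TopologicalSpace A] {p : E → N} (cov : IsCoveringMap p)
    {f g : C(A, N)} (h : f.Homotopic g) (F : C(A, E)) (hF : ∀ x, p (F x) = f x) :
    ∃ F' : C(A, E), F.Homotopic F' ∧ ∀ x, p (F' x) = g x := by
  obtain ⟨H⟩ := h
  have H0 : ∀ a, H.toContinuousMap (0, a) = p (F a) := fun a => (H.map_zero_left a).trans (hF a).symm
  let L := cov.liftHomotopy H.toContinuousMap F H0
  refine ⟨⟨fun a => L (1, a), L.continuous.comp (by fun_prop)⟩, ⟨⟨L, fun a => cov.liftHomotopy_zero _ _ H0 a, fun a => rfl⟩⟩, ?_⟩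
  intro x
  exact (congrFun (cov.liftHomotopy_lifts H.toContinuousMap F H0) (1, x)).trans (H.map_one_left x)

theorem s3_pconn : PathConnectedSpace S3 := by
  apply isPathConnected_iff_pathConnectedSpace.1
  apply isPathConnected_sphere _ _ zero_le_one
  rw [← Module.finrank_eq_rank]; simp

theorem s3_infinite : Infinite S3 := by
  have := s3_conn
  have : Nontrivial S3 := ⟨qjn 1 (by simp), qjn (-1) (by simp), fun h => by
    have h1 := congrArg qin h
    rw [qin_qjn, qin_qjn] at h1
    have := congrArg (fun q : ℍ[ℝ] => q.re) h1
    simp at this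
    norm_num at this⟩
  have h := isPreconnected_univ (α := S3).infinite_of_nontrivial nontrivial_univ
  exact infinite_univ_iff.1 h
end

theorem stmt17
    (G : Type) [Group G] [Finite G] [MulAction G (Sph 3)]
    -- the action is by diffeomorphisms:
    (hsmooth : ∀ g : G, ContMDiff (𝓡 3) (𝓡 3) (⊤ : ℕ∞) fun x : Sph 3 => g • x)
    -- the action is free:
    (hfree : ∀ (g : G) (x : Sph 3), g • x = x → g = 1)
    (y₀ : Quotient (MulAction.orbitRel G (Sph 3)))
    (f : C(Sph 4, Quotient (MulAction.orbitRel G (Sph 3)))) :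
    -- (i) if `f` is nullhomotopic then `(f, const y₀)` is loose
    (Nullhomotopic f → Loose f (ContinuousMap.const (Sph 4) y₀)) ∧
    -- (ii) if `f` is not nullhomotopic and `#G ≤ 2` then `MC(f, const y₀) = #G`
    (¬ Nullhomotopic f → Nat.card G ≤ 2 →
      (∃ f' g : C(Sph 4, Quotient (MulAction.orbitRel G (Sph 3))),
        f.Homotopic f' ∧ (ContinuousMap.const (Sph 4) y₀).Homotopic g ∧
        ENat.card {x : Sph 4 // f' x = g x} = (Nat.card G : ℕ∞)) ∧
      (∀ f' g : C(Sph 4, Quotient (MulAction.orbitRel G (Sph 3))),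
        f.Homotopic f' → (ContinuousMap.const (Sph 4) y₀).Homotopic g →
        (Nat.card G : ℕ∞) ≤ ENat.card {x : Sph 4 // f' x = g x})) ∧
    -- (iii) if `f` is not nullhomotopic and `#G ≥ 3` then every coincidence set is infinite
    (¬ Nullhomotopic f → 3 ≤ Nat.card G →
      ∀ f' g : C(Sph 4, Quotient (MulAction.orbitRel G (Sph 3))),
        f.Homotopic f' → (ContinuousMap.const (Sph 4) y₀).Homotopic g →
        Infinite {x : Sph 4 // f' x = g x}) := by
  classical
  have hccs : ContinuousConstSMul G (Sph 3) := ⟨fun g => (hsmooth g).continuous⟩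
  have hcan : IsCancelSMul G (Sph 3) := isCancelSMul_iff_eq_one_of_smul_eq.2 hfree
  have cov : IsCoveringMap (Quotient.mk (MulAction.orbitRel G (Sph 3))) :=
    (isQuotientCoveringMap_quotientMk_of_properlyDiscontinuousSMul (G := G) (E := Sph 3)).isCoveringMap
  set p : Sph 3 → Quotient (MulAction.orbitRel G (Sph 3)) := Quotient.mk _ with hp
  have psurj : Function.Surjective p := Quotient.mk_surjective
  have peq : ∀ x y : Sph 3, p x = p y ↔ ∃ γ : G, x = γ • y := by
    intro x y
    rw [hp, Quotient.eq, MulAction.orbitRel_apply, MulAction.mem_orbit_iff]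
    exact ⟨fun ⟨g, h⟩ => ⟨g, h.symm⟩, fun ⟨g, h⟩ => ⟨g, h.symm⟩⟩
  let pC : C(Sph 3, Quotient (MulAction.orbitRel G (Sph 3))) := ⟨p, cov.continuous⟩
  let sC : G → C(Sph 3, Sph 3) := fun γ => ⟨fun x => γ • x, hccs.continuous_const_smul γ⟩
  have finj : ∀ (γ δ : G) (x : Sph 3), γ • x = δ • x → γ = δ := by
    intro γ δ x h
    have := hfree (δ⁻¹ * γ) x (by rw [mul_smul, h, inv_smul_smul])
    exact (inv_mul_eq_one.1 this).symm
  obtain ⟨e₀, he₀⟩ := psurj y₀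
  obtain ⟨F, hF⟩ := lift_exists cov psurj f
  have setup : ∀ f' g : C(Sph 4, Quotient (MulAction.orbitRel G (Sph 3))),
        f.Homotopic f' → (ContinuousMap.const (Sph 4) y₀).Homotopic g → ∃ F' g' : C(Sph 4, Sph 3), (∀ x, p (F' x) = f' x) ∧ (∀ x, p (g' x) = g x) ∧
          F.Homotopic F' ∧ (ContinuousMap.const (Sph 4) e₀).Homotopic g' := by
    intro f' g hf' hg
    obtain ⟨F', h1, h2⟩ := hom_lift cov hf' F hF
    obtain ⟨g', h3, h4⟩ := hom_lift cov hg (ContinuousMap.const (Sph 4) e₀) (fun x => he₀)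
    exact ⟨F', g', h2, h4, h1, h3⟩
  have key : ¬ Nullhomotopic f → ∀ (F₁ g' : C(Sph 4, Sph 3)) (γ : G), F.Homotopic F₁ → (ContinuousMap.const (Sph 4) e₀).Homotopic g' →
      ∃ x, F₁ x = γ • g' x := by
    intro hnull F₁ g' γ h1 h2
    by_contra! hne
    apply hnull
    have h3 := avoidb F₁ ((sC γ).comp g') hne
    have h4 : F.Homotopic (ContinuousMap.const (Sph 4) (negq (sC γ e₀))) := by
      refine (h1.trans h3).trans ?_
      exact ((ContinuousMap.Homotopic.refl (negq.comp (sC γ))).comp h2).symm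
    refine ⟨p (negq (sC γ e₀)), ?_⟩
    have h5 := (ContinuousMap.Homotopic.refl pC).comp h4
    have e1 : pC.comp F = f := ContinuousMap.ext hF
    rw [e1] at h5
    exact h5
  have lower : ¬ Nullhomotopic f → ∀ f' g : C(Sph 4, Quotient (MulAction.orbitRel G (Sph 3))),
        f.Homotopic f' → (ContinuousMap.const (Sph 4) y₀).Homotopic g →
        (Nat.card G : ℕ∞) ≤ ENat.card {x : Sph 4 // f' x = g x} := by
    intro hnull f' g hf' hg
    obtain ⟨F', g', h1, h2, h3, h4⟩ := setup f' g hf' hg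
    choose x hx using fun γ => key hnull F' g' γ h3 h4
    rw [← ENat.card_eq_coe_natCard]
    refine ENat.card_le_card_of_injective (f := fun γ : G => (⟨x γ, ?_⟩ : {x : Sph 4 // f' x = g x})) ?_
    · rw [← h1, ← h2, peq]
      exact ⟨γ, hx γ⟩
    · intro γ δ h
      have h5 : x γ = x δ := congrArg Subtype.val h
      apply finj γ δ (g' (x γ))
      rw [← hx γ, h5, hx δ]
  have s3inf : Infinite (Sph 3) := s3_infinite
  refine ⟨?_, ?_, ?_⟩
  · rintro ⟨y, hy⟩
    have hpc : PathConnectedSpace (Sph 3) := s3_pconn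
    obtain ⟨e, he⟩ := psurj y
    have hfin : (Set.range (fun γ : G => γ • e₀)).Finite := Set.finite_range _
    obtain ⟨e₁, he₁⟩ := hfin.exists_notMem
    refine ⟨ContinuousMap.const _ (p e₁), ContinuousMap.const _ y₀, hy.trans ?_, ContinuousMap.Homotopic.refl _, ?_⟩
    · have : Nonempty (Sph 4) := ⟨KS (0, e)⟩
      rw [ContinuousMap.homotopic_const_iff, ← he]
      exact (PathConnectedSpace.joined e e₁).map cov.continuous
    · intro x h
      have h' : p e₁ = y₀ := h
      rw [← he₀, peq] at h'
      obtain ⟨γ, h'⟩ := h'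
      exact he₁ ⟨γ, h'.symm⟩
  · intro hnull hcard
    refine ⟨?_, lower hnull⟩
    obtain ⟨b, hb, hG⟩ : ∃ b : Sph 3, e₀ ≠ b ∧ ∀ γ : G, γ • e₀ = e₀ ∨ γ • e₀ = b := by
      by_cases h : ∃ γ : G, γ ≠ 1
      · obtain ⟨γ, hγ⟩ := h
        refine ⟨γ • e₀, fun h => hγ (hfree γ e₀ h.symm), ?_⟩
        intro δ
        by_cases h1 : δ = 1
        · left; rw [h1, one_smul]
        by_cases h2 : δ = γ
        · right; rw [h2]
        exfalso
        have := Fintype.ofFinite G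
        have h3 : ({1, γ, δ} : Finset G).card = 3 := Finset.card_eq_three.2 ⟨1, γ, δ, hγ.symm, fun h => h1 h.symm, fun h => h2 h.symm, rfl⟩
        have h4 := Finset.card_le_univ ({1, γ, δ} : Finset G)
        rw [Nat.card_eq_fintype_card] at hcard
        omega
      · push Not at h
        obtain ⟨b, hb⟩ := exists_ne e₀
        exact ⟨b, hb.symm, fun γ => Or.inl (by rw [h γ, one_smul])⟩
    obtain ⟨F', h1, h2, h3⟩ := T2b F hb
    have hhom : f.Homotopic (pC.comp F') := by
      have h5 := (ContinuousMap.Homotopic.refl pC).comp h1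
      have e1 : pC.comp F = f := ContinuousMap.ext hF
      rwa [e1] at h5
    refine ⟨pC.comp F', ContinuousMap.const _ y₀, hhom, ContinuousMap.Homotopic.refl _, ?_⟩
    apply le_antisymm _ (lower hnull _ _ hhom (ContinuousMap.Homotopic.refl _))
    have hγ : ∀ x : {x : Sph 4 // (pC.comp F') x = (ContinuousMap.const (Sph 4) y₀) x}, ∃ γ : G, F' x.1 = γ • e₀ := by
      intro x
      have h6 : p (F' x.1) = y₀ := x.2
      exact (peq _ _).1 (h6.trans he₀.symm)
    choose γ hγ using hγ
    rw [← ENat.card_eq_coe_natCard]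
    refine ENat.card_le_card_of_injective (f := γ) ?_
    intro x x' hxx
    apply Subtype.ext
    have q1 := hγ x
    have q2 := hγ x'
    rw [← hxx] at q2
    rcases hG (γ x) with h | h
    · exact h2 _ _ (q1.trans h) (q2.trans h)
    · exact h3 _ _ (q1.trans h) (q2.trans h)
  · intro hnull hcard f' g hf' hg
    by_contra hninf
    have hfin : {x : Sph 4 | f' x = g x}.Finite := by
      rw [not_infinite_iff_finite] at hninf
      exact Set.finite_coe_iff.1 hninf
    obtain ⟨F', g', h1, h2, h3, h4⟩ := setup f' g hf' hg
    have := Fintype.ofFinite G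
    rw [Nat.card_eq_fintype_card] at hcard
    obtain ⟨γ⟩ : Nonempty (Fin 3 ↪ G) := Function.Embedding.nonempty_of_card_le (by simpa using hcard)
    obtain ⟨F₁, h5, h6⟩ := T3b F' (fun i => (sC (γ i)).comp g')
      (fun i j hij x h => hij (γ.injective (finj _ _ _ h)))
      (fun i => hfin.subset (fun x hx => by
        show f' x = g x
        rw [← h1, ← h2, peq]
        exact ⟨γ i, hx⟩))
    obtain ⟨x, hx⟩ := key hnull F₁ g' (γ 0) (h3.trans h5) h4
    exact h6 x hx
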